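/- Let k be a positive integer with k ≡ 3 (mod 4) and let n ≥ 2. Then there exists a (finite, loopless) graph G with chromatic number χ(G) = k + 2 such that there is at least one graph homomorphism from the stable Kneser graph SG_{n,k} to G, and any two graph homomorphisms f, g : SG_{n,k} → G are ×-homotopic (f ≃ g); i.e. the complex Hom(SG_{n,k}, G) is non-empty and connected. In particular, SG_{n,k} is not a test graph. -/

import Mathlib

/-- For functions `f g : V(G) → V(H)`, `f ∼ g` iff `(f(u), g(v)) ∈ E(H)`
for every edge `(u,v) ∈ E(G)`. -/
def GraphMapsAdj {V W : Type*} (G : SimpleGraph V) (H : SimpleGraph W)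
    (f g : V → W) : Prop :=
  ∀ ⦃u v : V⦄, G.Adj u v → H.Adj (f u) (g v)

/-- `f ≃ g` (×-homotopic): a finite chain `f = h₀ ∼ h₁ ∼ ⋯ ∼ h_N = g`
of graph homomorphisms. -/
def HomHomotopic {V W : Type*} (G : SimpleGraph V) (H : SimpleGraph W)
    (f g : G →g H) : Prop :=
  Relation.ReflTransGen (fun a b : G →g H => GraphMapsAdj G H a b) f g

/-- `x` is the minimum element of the finset `S`. -/
def IsMinOf (S : Finset ℕ) (x : ℕ) : Prop := x ∈ S ∧ ∀ y ∈ S, x ≤ y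

/-- `S ⊆ {0, …, m−1}` is semi-stable: `{i, i+1} ⊄ S` for all `0 ≤ i ≤ m−2`. -/
def SemiStable (m : ℕ) (S : Finset ℕ) : Prop :=
  S ⊆ Finset.range m ∧ ∀ i, i + 1 < m → ¬(i ∈ S ∧ i + 1 ∈ S)

/-- `S` is stable: semi-stable and additionally `{0, m−1} ⊄ S`. -/
def StableSet (m : ℕ) (S : Finset ℕ) : Prop :=
  SemiStable m S ∧ ¬(0 ∈ S ∧ m - 1 ∈ S)

/-- Vertices of the stable Kneser graph: stable `n`-subsets of `{0, …, 2n+k−1}`. -/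
abbrev SGVert (n k : ℕ) : Type := {S : Finset ℕ // S.card = n ∧ StableSet (2*n+k) S}

/-- Vertices of the semi-stable Kneser graph. -/
abbrev SSGVert (n k : ℕ) : Type := {S : Finset ℕ // S.card = n ∧ SemiStable (2*n+k) S}

/-- The stable Kneser graph `SG_{n,k}`: stable `n`-subsets of `{0, …, 2n+k−1}`,
adjacent iff disjoint. -/
def SG (n k : ℕ) : SimpleGraph (SGVert n k) :=
  SimpleGraph.fromRel (fun S T => Disjoint S.1 T.1)

/-- The semi-stable Kneser graph `SḠ_{n,k}`. -/
def SSG (n k : ℕ) : SimpleGraph (SSGVert n k) :=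
  SimpleGraph.fromRel (fun S T => Disjoint S.1 T.1)

namespace StableKneser

/-- The integers in `L` have distinct absolute values and, listed by increasing absolute value,
they alternate in sign, starting with a positive one. -/
def Alternating (L : Finset ℤ) : Prop :=
  ∀ z ∈ L, (∀ w ∈ L, |z| = |w| → z = w) ∧ (0 < z ↔ Even (L.filter (fun w => |w| < |z|)).card)

open Classical in
/-- Indicator (mod 2) that the labels `l i`, `i ∈ I`, are distinct and alternating. -/
noncomputable def altInd {ι : Type*} (l : ι → ℤ) (I : Finset ι) : ZMod 2 :=
  if (I.image l).card = I.card ∧ Alternating (I.image l) then 1 else 0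

theorem alternating_insert {L : Finset ℤ} {z : ℤ} (h : ∀ w ∈ L, |w| < |z|) :
    Alternating (insert z L) ↔ Alternating L ∧ (0 < z ↔ Even L.card) := by
  have hz : z ∉ L := fun hz => lt_irrefl _ (h z hz)
  have h1 : (insert z L).filter (fun w => |w| < |z|) = L := by
    ext w
    simp only [Finset.mem_filter, Finset.mem_insert]
    constructor
    · rintro ⟨rfl | hw, h'⟩
      · exact absurd h' (lt_irrefl _)
      · exact hw
    · exact fun hw => ⟨Or.inr hw, h w hw⟩
  have h2 : ∀ w ∈ L, (insert z L).filter (fun v => |v| < |w|) = L.filter (fun v => |v| < |w|) := by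
    intro w hw
    rw [Finset.filter_insert, if_neg (not_lt.2 (h w hw).le)]
  constructor
  · intro H
    refine ⟨fun w hw => ⟨fun v hv => (H w (Finset.mem_insert_of_mem hw)).1 v
      (Finset.mem_insert_of_mem hv), ?_⟩, ?_⟩
    · rw [← h2 w hw]; exact (H w (Finset.mem_insert_of_mem hw)).2
    · have := (H z (Finset.mem_insert_self _ _)).2
      rwa [h1] at this
  · rintro ⟨H, Hz⟩ w hw
    rcases Finset.mem_insert.1 hw with rfl | hw
    · refine ⟨fun v hv e => ?_, by rwa [h1]⟩
      rcases Finset.mem_insert.1 hv with rfl | hv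
      · rfl
      · exact absurd (h v hv) (by rw [e]; exact lt_irrefl _)
    · refine ⟨fun v hv e => ?_, by rw [h2 w hw]; exact (H w hw).2⟩
      rcases Finset.mem_insert.1 hv with hvz | hv
      · exact absurd (h w hw) (by rw [e, hvz]; exact lt_irrefl _)
      · exact (H w hw).1 v hv e

theorem altInd_congr {ι : Type*} {l l' : ι → ℤ} {I : Finset ι} (h : ∀ i ∈ I, l i = l' i) :
    altInd l I = altInd l' I := by
  classical
  unfold altInd
  rw [Finset.image_congr (fun i hi => h i hi)]

theorem altInd_eq_zero {ι : Type*} {l : ι → ℤ} {I : Finset ι} {i j : ι} (hi : i ∈ I) (hj : j ∈ I)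
    (hij : i ≠ j) (h : l i = l j) : altInd l I = 0 := by
  classical
  unfold altInd
  rw [if_neg]
  rintro ⟨h1, -⟩
  exact hij (Finset.card_image_iff.1 h1 hi hj h)

open Classical in
theorem altInd_insert {ι : Type*} [DecidableEq ι] {l : ι → ℤ} {I : Finset ι} {a : ι} (ha : a ∉ I)
    (h : ∀ i ∈ I, |l i| < |l a|) :
    altInd l (insert a I) = if (0 < l a ↔ Even I.card) then altInd l I else 0 := by
  unfold altInd
  have hL : ∀ w ∈ I.image l, |w| < |l a| := by
    intro w hw
    obtain ⟨i, hi, rfl⟩ := Finset.mem_image.1 hw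
    exact h i hi
  have hz : l a ∉ I.image l := fun hz => lt_irrefl _ (hL _ hz)
  rw [Finset.image_insert, Finset.card_insert_of_notMem hz, Finset.card_insert_of_notMem ha,
    alternating_insert hL, ← ite_and]
  congr 1
  apply propext
  constructor
  · rintro ⟨h1, h2, h3⟩
    have h1 : (I.image l).card = I.card := by omega
    exact ⟨by rwa [h1] at h3, h1, h2⟩
  · rintro ⟨h3, h1, h2⟩
    exact ⟨by omega, h2, by rwa [h1]⟩

theorem sum_altInd_erase {ι : Type*} [DecidableEq ι] (l : ι → ℤ) (I : Finset ι)
    (hc : ∀ i ∈ I, ∀ j ∈ I, l i + l j ≠ 0) :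
    ∑ i ∈ I, altInd l (I.erase i) = altInd l I + altInd (fun i => - l i) I := by
  classical
  induction I using Finset.induction_on_max_value (fun i => |l i|) with
  | empty =>
    simp [altInd, Alternating]
    rfl
  | insert a s ha hmax ih =>
    have ih := ih (fun i hi j hj => hc i (Finset.mem_insert_of_mem hi) j
      (Finset.mem_insert_of_mem hj))
    rw [Finset.sum_insert ha, Finset.erase_insert ha]
    by_cases hx : ∃ x ∈ s, |l x| = |l a|
    · obtain ⟨x, hx, hxa⟩ := hx
      have hla : l x = l a := by
        rcases abs_eq_abs.1 hxa with h | h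
        · exact h
        · exact absurd (by omega) (hc x (Finset.mem_insert_of_mem hx) a (Finset.mem_insert_self _ _))
      have hne : x ≠ a := fun h => ha (h ▸ hx)
      have hxi : x ∈ insert a s := Finset.mem_insert_of_mem hx
      have hai : a ∈ insert a s := Finset.mem_insert_self _ _
      rw [altInd_eq_zero hxi hai hne hla,
        altInd_eq_zero (l := fun i => - l i) hxi hai hne (by simp [hla]),
        ← Finset.add_sum_erase s _ hx,
        Finset.sum_eq_zero (s := s.erase x), add_zero, add_zero]
      · have : altInd l ((insert a s).erase x) = altInd l s := by
          have h1 : (insert a s).erase x = insert a (s.erase x) := by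
            rw [Finset.erase_insert_of_ne hne.symm]
          have h2 : s = insert x (s.erase x) := (Finset.insert_erase hx).symm
          unfold altInd
          rw [h1]
          conv_rhs => rw [h2]
          rw [Finset.image_insert, Finset.image_insert, hla,
            Finset.card_insert_of_notMem (a := a) (by simp [ha]),
            Finset.card_insert_of_notMem (a := x) (by simp)]
        rw [this]
        exact CharTwo.add_self_eq_zero _
      · intro i hi
        rw [Finset.mem_erase] at hi
        have hia : i ≠ a := fun h => ha (h ▸ hi.2)
        exact altInd_eq_zero (Finset.mem_erase.2 ⟨hi.1.symm, hxi⟩)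
          (Finset.mem_erase.2 ⟨hia.symm, hai⟩) hne hla
    · push Not at hx
      have hlt : ∀ i ∈ s, |l i| < |l a| := fun i hi => lt_of_le_of_ne (hmax i hi) (hx i hi)
      have hla : l a ≠ 0 := by
        have := hc a (Finset.mem_insert_self _ _) a (Finset.mem_insert_self _ _)
        omega
      have hsum : ∑ i ∈ s, altInd l ((insert a s).erase i)
          = if (0 < l a ↔ Even s.card) then 0 else ∑ i ∈ s, altInd l (s.erase i) := by
        have : ∀ i ∈ s, altInd l ((insert a s).erase i)
            = if (0 < l a ↔ Even s.card) then 0 else altInd l (s.erase i) := by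
          intro i hi
          have hia : i ≠ a := fun h => ha (h ▸ hi)
          rw [Finset.erase_insert_of_ne hia.symm, altInd_insert (by simp [ha])
            (fun j hj => hlt j (Finset.mem_of_mem_erase hj)), Finset.card_erase_of_mem hi]
          have hpos : 0 < s.card := Finset.card_pos.2 ⟨i, hi⟩
          have : Even (s.card - 1) ↔ ¬ Even s.card := by
            rw [Nat.even_sub (by omega)]
            simp
          simp only [this]
          by_cases h1 : 0 < l a <;> by_cases h2 : Even s.card <;> simp [h1, h2]
        rw [Finset.sum_congr rfl this]
        split_ifs <;> simp
      rw [hsum, ih, altInd_insert ha hlt, altInd_insert (l := fun i => - l i) ha (by simpa using hlt)]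
      have e1 : ∀ x y : ZMod 2, x + (x + y) = y := by decide
      by_cases h1 : 0 < l a
      · have h3 : ¬ l a < 0 := by omega
        by_cases h2 : Even s.card <;> simp [h1, h2, h3, e1]
      · have h3 : l a < 0 := by omega
        by_cases h2 : Even s.card <;> simp [h1, h2, h3, e1]

theorem altInd_map {ι κ : Type*} (l : κ → ℤ) (f : ι ↪ κ) (I : Finset ι) :
    altInd l (I.map f) = altInd (fun i => l (f i)) I := by
  classical
  unfold altInd
  rw [Finset.card_map, Finset.map_eq_image, Finset.image_image]
  rfl

theorem injOn_natAbs_of_altInd_ne_zero {ι : Type*} {l : ι → ℤ} {I : Finset ι}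
    (h : altInd l I ≠ 0) : Set.InjOn (fun i => (l i).natAbs) I := by
  classical
  unfold altInd at h
  have h := (ite_ne_right_iff.1 h).1
  intro i hi j hj hij
  refine Finset.card_image_iff.1 h.1 hi hj ?_
  refine (h.2 _ (Finset.mem_image_of_mem l hi)).1 _ (Finset.mem_image_of_mem l hj) ?_
  rw [Int.abs_eq_natAbs, Int.abs_eq_natAbs]
  exact congrArg _ hij

/-- An antipodal labelling of the nonzero sign vectors on `Fin d` (given by their positive and
negative supports) without complementary edges. -/
structure FanLabelling {d : ℕ} (lam : Finset (Fin d) → Finset (Fin d) → ℤ) : Prop where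
  neg : ∀ P Q, Disjoint P Q → (P ∪ Q).Nonempty → lam Q P = - lam P Q
  add_ne : ∀ P Q P' Q', P ⊆ P' → Q ⊆ Q' → Disjoint P' Q' → (P ∪ Q).Nonempty →
    lam P Q + lam P' Q' ≠ 0

/-- The labels along the flag of sign vectors determined by a signed permutation. -/
def flagLabel {d : ℕ} (lam : Finset (Fin d) → Finset (Fin d) → ℤ)
    (p : Equiv.Perm (Fin d) × (Fin d → Bool)) (j : Fin d) : ℤ :=
  lam (Finset.univ.filter fun i => j ≤ p.1 i ∧ p.2 i = true)
    (Finset.univ.filter fun i => j ≤ p.1 i ∧ p.2 i = false)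

theorem flagLabel_disjoint {d : ℕ} (p : Equiv.Perm (Fin d) × (Fin d → Bool)) (j : Fin d) :
    Disjoint (Finset.univ.filter fun i => j ≤ p.1 i ∧ p.2 i = true)
      (Finset.univ.filter fun i => j ≤ p.1 i ∧ p.2 i = false) := by
  rw [Finset.disjoint_filter]
  rintro i - ⟨-, h⟩ ⟨-, h'⟩
  simp [h] at h'

theorem flagLabel_nonempty {d : ℕ} (p : Equiv.Perm (Fin d) × (Fin d → Bool)) (j : Fin d) :
    ((Finset.univ.filter fun i => j ≤ p.1 i ∧ p.2 i = true) ∪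
      (Finset.univ.filter fun i => j ≤ p.1 i ∧ p.2 i = false)).Nonempty := by
  refine ⟨p.1.symm j, ?_⟩
  cases h : p.2 (p.1.symm j) <;> simp [h]

theorem FanLabelling.flag_add_ne {d : ℕ} {lam : Finset (Fin d) → Finset (Fin d) → ℤ}
    (h : FanLabelling lam) (p : Equiv.Perm (Fin d) × (Fin d → Bool)) (i j : Fin d) :
    flagLabel lam p i + flagLabel lam p j ≠ 0 := by
  have key : ∀ i j, j ≤ i → flagLabel lam p i + flagLabel lam p j ≠ 0 := by
    intro i j hij
    refine h.add_ne _ _ _ _ ?_ ?_ (flagLabel_disjoint p j) (flagLabel_nonempty p i)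
    · exact Finset.monotone_filter_right _ (fun x _ hx => ⟨hij.trans hx.1, hx.2⟩)
    · exact Finset.monotone_filter_right _ (fun x _ hx => ⟨hij.trans hx.1, hx.2⟩)
  rcases le_total j i with hij | hij
  · exact key i j hij
  · rw [add_comm]
    exact key j i hij

theorem FanLabelling.flag_neg {d : ℕ} {lam : Finset (Fin d) → Finset (Fin d) → ℤ}
    (h : FanLabelling lam) (τ : Equiv.Perm (Fin d)) (ε : Fin d → Bool) :
    flagLabel lam (τ, fun i => !ε i) = fun i => - flagLabel lam (τ, ε) i := by
  funext j
  have := h.neg _ _ (flagLabel_disjoint (τ, ε) j) (flagLabel_nonempty (τ, ε) j)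
  unfold flagLabel
  rw [← this]
  simp

theorem le_swap_castSucc_succ {d : ℕ} (j : Fin d) (l x : Fin (d + 1)) (hl : l ≠ j.succ) :
    l ≤ Equiv.swap j.succ j.castSucc x ↔ l ≤ x := by
  have hl' : (l : ℕ) ≠ j + 1 := fun h => hl (Fin.ext h)
  rcases eq_or_ne x j.succ with rfl | h1
  · rw [Equiv.swap_apply_left, Fin.le_def, Fin.le_def]
    simp only [Fin.val_castSucc, Fin.val_succ]
    omega
  rcases eq_or_ne x j.castSucc with rfl | h2
  · rw [Equiv.swap_apply_right, Fin.le_def, Fin.le_def]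
    simp only [Fin.val_castSucc, Fin.val_succ]
    omega
  rw [Equiv.swap_apply_of_ne_of_ne h1 h2]

theorem flagLabel_succ {d : ℕ} (lam : Finset (Fin (d + 1)) → Finset (Fin (d + 1)) → ℤ)
    (σ : Equiv.Perm (Fin (d + 1))) (δ : Fin (d + 1) → Bool) (τ : Equiv.Perm (Fin d))
    (ε : Fin d → Bool) (h0 : σ 0 = 0) (hσ : ∀ x : Fin d, σ x.succ = (τ x).succ)
    (hδ : ∀ x : Fin d, δ x.succ = ε x) (i : Fin d) :
    flagLabel lam (σ, δ) i.succ = flagLabel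
      (fun P Q => lam (P.map (Fin.succEmb d)) (Q.map (Fin.succEmb d))) (τ, ε) i := by
  unfold flagLabel
  refine congrArg₂ lam ?_ ?_
  all_goals
    ext x
    refine Fin.cases ?_ (fun x => ?_) x <;> simp [h0, hσ, hδ]

theorem sum_altInd_flagLabel {d : ℕ} (lam : Finset (Fin d) → Finset (Fin d) → ℤ)
    (h : FanLabelling lam) : ∑ p, altInd (flagLabel lam p) Finset.univ = 1 := by
  induction d with
  | zero =>
    simp [altInd, Alternating]
  | succ d ih =>
    set U : Finset (Equiv.Perm (Fin (d + 1)) × (Fin (d + 1) → Bool)) :=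
      Finset.univ.filter (fun p => p.2 0 = true) with hU
    have hcompl : ∑ p with ¬ (p : Equiv.Perm (Fin (d + 1)) × (Fin (d + 1) → Bool)).2 0 = true,
        altInd (flagLabel lam p) Finset.univ
        = ∑ p ∈ U, altInd (fun i => - flagLabel lam p i) Finset.univ := by
      refine Finset.sum_bij' (fun p _ => (p.1, fun i => !p.2 i)) (fun p _ => (p.1, fun i => !p.2 i))
        ?_ ?_ ?_ ?_ ?_
      · intro p hp; simpa [hU] using hp
      · intro p hp; simpa [hU] using hp
      · intro p hp; simp
      · intro p hp; simp
      · rintro ⟨τ, ε⟩ hp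
        simp only [h.flag_neg, neg_neg]
    have hsucc : ∀ j : Fin d, ∑ p ∈ U, altInd (flagLabel lam p) (Finset.univ.erase j.succ) = 0 := by
      intro j
      refine Finset.sum_involution (fun p _ => (Equiv.swap j.succ j.castSucc * p.1, p.2)) ?_ ?_ ?_ ?_
      · intro p hp
        have e : altInd (flagLabel lam (Equiv.swap j.succ j.castSucc * p.1, p.2))
            (Finset.univ.erase j.succ) = altInd (flagLabel lam p) (Finset.univ.erase j.succ) := by
          refine altInd_congr fun i hi => ?_
          rw [Finset.mem_erase] at hi
          unfold flagLabel
          simp only [Equiv.Perm.mul_apply, le_swap_castSucc_succ _ _ _ hi.1]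
        rw [e]
        exact CharTwo.add_self_eq_zero _
      · intro p hp _ h'
        have h1 := congrArg (fun q => q.1 (p.1.symm j.succ)) h'
        simp only [Equiv.Perm.mul_apply, Equiv.apply_symm_apply, Equiv.swap_apply_left] at h1
        have := congrArg Fin.val h1
        simp at this
      · intro p hp; simpa [hU] using hp
      · intro p hp; ext <;> simp
    have hzero : ∑ p ∈ U, altInd (flagLabel lam p) (Finset.univ.erase 0) = 1 := by
      have hmove : ∑ p ∈ U with ¬ p.1 0 = 0, altInd (flagLabel lam p) (Finset.univ.erase 0) = 0 := by
        refine Finset.sum_involution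
          (fun p _ => (p.1, Function.update p.2 (p.1.symm 0) (!p.2 (p.1.symm 0)))) ?_ ?_ ?_ ?_
        · intro p hp
          have e : altInd (flagLabel lam (p.1, Function.update p.2 (p.1.symm 0)
              (!p.2 (p.1.symm 0)))) (Finset.univ.erase 0)
              = altInd (flagLabel lam p) (Finset.univ.erase 0) := by
            refine altInd_congr fun i hi => ?_
            rw [Finset.mem_erase] at hi
            have hx : ∀ x, i ≤ p.1 x → x ≠ p.1.symm 0 := by
              rintro x hx rfl
              rw [Equiv.apply_symm_apply] at hx
              exact hi.1 (Fin.le_zero_iff.1 hx)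
            unfold flagLabel
            congr 1
            · refine Finset.filter_congr fun x _ => and_congr_right fun h' => ?_
              simp only [Function.update_of_ne (hx x h')]
            · refine Finset.filter_congr fun x _ => and_congr_right fun h' => ?_
              simp only [Function.update_of_ne (hx x h')]
          rw [e]
          exact CharTwo.add_self_eq_zero _
        · intro p hp _ h'
          have h1 := congrArg (fun q => q.2 (p.1.symm 0)) h'
          simp at h1
        · intro p hp
          simp only [hU, Finset.mem_filter, Finset.mem_univ, true_and] at hp ⊢
          refine ⟨?_, hp.2⟩
          rw [Function.update_of_ne]
          · exact hp.1
          · intro h0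
            apply hp.2
            exact (Equiv.eq_symm_apply _).1 h0
        · intro p hp; ext <;> simp
      rw [← Finset.sum_filter_add_sum_filter_not U (fun p => p.1 0 = 0), hmove, add_zero]
      have h' : FanLabelling (fun P Q : Finset (Fin d) =>
          lam (P.map (Fin.succEmb d)) (Q.map (Fin.succEmb d))) := by
        constructor
        · intro P Q h1 h2
          refine h.neg _ _ ((Finset.disjoint_map _).2 h1) ?_
          rw [← Finset.map_union]
          simpa using h2
        · intro P Q P' Q' h1 h2 h3 h4
          refine h.add_ne _ _ _ _ (Finset.map_subset_map.2 h1) (Finset.map_subset_map.2 h2)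
            ((Finset.disjoint_map _).2 h3) ?_
          rw [← Finset.map_union]
          simpa using h4
      rw [← ih _ h']
      symm
      refine Finset.sum_bij (fun p _ => (Equiv.Perm.decomposeFin.symm (0, p.1), Fin.cons true p.2))
        ?_ ?_ ?_ ?_
      · intro p hp
        simp [hU]
      · rintro ⟨τ, ε⟩ _ ⟨τ', ε'⟩ _ heq
        simpa using heq
      · rintro ⟨τ, ε⟩ hp
        simp only [hU, Finset.mem_filter, Finset.mem_univ, true_and] at hp
        obtain ⟨⟨a, τ'⟩, rfl⟩ := Equiv.Perm.decomposeFin.symm.surjective τ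
        have ha : a = 0 := by simpa using hp.2
        subst ha
        refine ⟨(τ', Fin.tail ε), Finset.mem_univ _, ?_⟩
        simp only [Prod.mk.injEq, true_and]
        have := Fin.cons_self_tail ε
        rw [hp.1] at this
        exact this
      · rintro ⟨τ, ε⟩ _
        have hE : (Finset.univ.erase (0 : Fin (d + 1))) = Finset.univ.map (Fin.succEmb d) := by
          ext x
          simp [Fin.exists_succ_eq]
        rw [hE, altInd_map]
        refine altInd_congr fun i _ => ?_
        refine (flagLabel_succ lam _ _ _ _ ?_ ?_ ?_ i).symm
        · simp
        · intro x; simp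
        · intro x; simp
    rw [← Finset.sum_filter_add_sum_filter_not Finset.univ
      (fun p : Equiv.Perm (Fin (d + 1)) × (Fin (d + 1) → Bool) => p.2 0 = true), hcompl,
      ← Finset.sum_add_distrib,
      Finset.sum_congr rfl (fun p _ => (sum_altInd_erase (flagLabel lam p) Finset.univ
        (fun i _ j _ => h.flag_add_ne p i j)).symm), Finset.sum_comm, Fin.sum_univ_succ, hzero,
      Finset.sum_eq_zero (fun j _ => hsucc j), add_zero]

theorem FanLabelling.le {d N : ℕ} {lam : Finset (Fin d) → Finset (Fin d) → ℤ}
    (h : FanLabelling lam)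
    (hN : ∀ P Q, Disjoint P Q → (P ∪ Q).Nonempty → (lam P Q).natAbs ≤ N) : d ≤ N := by
  have h1 : ∑ p, altInd (flagLabel lam p) Finset.univ ≠ 0 := by
    rw [sum_altInd_flagLabel lam h]
    decide
  obtain ⟨p, -, hp⟩ := Finset.exists_ne_zero_of_sum_ne_zero h1
  have hinj := injOn_natAbs_of_altInd_ne_zero hp
  have := Finset.card_le_card_of_injOn (t := Finset.Icc 1 N) (fun i => (flagLabel lam p i).natAbs)
    (fun i _ => by
      have h0 := h.flag_add_ne p i i
      have h2 := hN _ _ (flagLabel_disjoint p i) (flagLabel_nonempty p i)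
      have h2 : (flagLabel lam p i).natAbs ≤ N := h2
      simp only [Finset.coe_Icc, Set.mem_Icc]
      omega) hinj
  simpa using this

theorem SG_adj {n k : ℕ} (hn : 1 ≤ n) {S T : SGVert n k} :
    (SG n k).Adj S T ↔ Disjoint S.1 T.1 := by
  rw [SG, SimpleGraph.fromRel_adj]
  constructor
  · rintro ⟨-, h | h⟩
    · exact h
    · exact h.symm
  · intro h
    refine ⟨?_, Or.inl h⟩
    rintro rfl
    have h1 := S.2.1
    rw [disjoint_self.1 h] at h1
    simp at h1
    omega

/-- There are `x₀ < x₁ < ⋯ < x_{L-1}` lying alternately in `P` and `Q`, starting in `P`. -/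
def HasAlt (P Q : Finset ℕ) (L : ℕ) : Prop :=
  ∃ c : ℕ → ℕ, (∀ i, i + 1 < L → c i < c (i + 1)) ∧ ∀ i < L, c i ∈ if Even i then P else Q

theorem hasAlt_zero (P Q : Finset ℕ) : HasAlt P Q 0 :=
  ⟨id, fun i hi => by omega, fun i hi => by omega⟩

theorem HasAlt.mono {P Q P' Q' : Finset ℕ} {L : ℕ} (h : HasAlt P Q L) (hP : P ⊆ P') (hQ : Q ⊆ Q') :
    HasAlt P' Q' L := by
  obtain ⟨c, h1, h2⟩ := h
  refine ⟨c, h1, fun i hi => ?_⟩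
  have := h2 i hi
  split_ifs at this ⊢
  · exact hP this
  · exact hQ this

theorem HasAlt.cons {P Q : Finset ℕ} {c : ℕ → ℕ} {L x : ℕ}
    (h1 : ∀ i, i + 1 < L → c i < c (i + 1)) (h2 : ∀ i < L, c i ∈ if Even i then Q else P)
    (hx : x ∈ P) (hxc : x < c 0) : HasAlt P Q (L + 1) := by
  refine ⟨fun i => if i = 0 then x else c (i - 1), fun i hi => ?_, fun i hi => ?_⟩
  · rcases i with _ | i
    · simpa using hxc
    · simpa using h1 i (by omega)
  · rcases i with _ | i
    · simpa using hx
    · have := h2 i (by omega)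
      by_cases he : Even i
      · simpa [he, Nat.even_add_one] using this
      · simpa [he, Nat.even_add_one] using this

theorem HasAlt.succ_of_both {P Q : Finset ℕ} {L : ℕ} (hL : 1 ≤ L) (hd : Disjoint P Q)
    (h : HasAlt P Q L) (h' : HasAlt Q P L) : HasAlt P Q (L + 1) ∨ HasAlt Q P (L + 1) := by
  obtain ⟨c, h1, h2⟩ := h
  obtain ⟨c', h1', h2'⟩ := h'
  have hc := h2 0 hL
  have hc' := h2' 0 hL
  simp only [Even.zero, if_true] at hc hc'
  rcases lt_trichotomy (c 0) (c' 0) with hlt | he | hlt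
  · exact Or.inl (HasAlt.cons h1' h2' hc hlt)
  · rw [he] at hc
    exact absurd hc' (Finset.disjoint_left.1 hd hc)
  · exact Or.inr (HasAlt.cons h1 h2 hc' hlt)

theorem HasAlt.exists_stable {n k : ℕ} {P Q : Finset ℕ} (h : HasAlt P Q (2 * n))
    (hP : P ⊆ Finset.range (2 * n + k)) (hQ : Q ⊆ Finset.range (2 * n + k)) :
    (∃ T : SGVert n k, T.1 ⊆ P) ∧ ∃ T : SGVert n k, T.1 ⊆ Q := by
  obtain ⟨c, h1, h2⟩ := h
  have hlt : ∀ j i, i < j → j < 2 * n → c i < c j := by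
    intro j
    induction j with
    | zero => intro i hi; omega
    | succ j ih =>
      intro i hi hj
      have := h1 j hj
      rcases Nat.lt_succ_iff_lt_or_eq.1 hi with hi | rfl
      · exact (ih i hi (by omega)).trans this
      · exact this
  have hm : ∀ i < 2 * n, c i < 2 * n + k := by
    intro i hi
    have := h2 i hi
    split_ifs at this
    · exact Finset.mem_range.1 (hP this)
    · exact Finset.mem_range.1 (hQ this)
  have key : ∀ b, b < 2 → ∃ T : SGVert n k, T.1 = (Finset.range n).image (fun i => c (2 * i + b)) := by
    intro b hb
    refine ⟨⟨(Finset.range n).image (fun i => c (2 * i + b)), ?_, ⟨?_, ?_⟩, ?_⟩, rfl⟩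
    · rw [Finset.card_image_of_injOn, Finset.card_range]
      intro i hi j hj hij
      simp only [Finset.coe_range, Set.mem_Iio] at hi hj hij
      rcases lt_trichotomy i j with h | h | h
      · have := hlt (2 * j + b) (2 * i + b) (by omega) (by omega); omega
      · exact h
      · have := hlt (2 * i + b) (2 * j + b) (by omega) (by omega); omega
    · intro x hx
      simp only [Finset.mem_image, Finset.mem_range] at hx ⊢
      obtain ⟨i, hi, rfl⟩ := hx
      exact hm _ (by omega)
    · rintro x - ⟨hx, hx'⟩
      simp only [Finset.mem_image, Finset.mem_range] at hx hx'
      obtain ⟨i, hi, hix⟩ := hx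
      obtain ⟨j, hj, hjx⟩ := hx'
      rcases lt_trichotomy i j with h | h | h
      · have h3 := hlt (2 * i + b + 1) (2 * i + b) (by omega) (by omega)
        have h4 := hlt (2 * j + b) (2 * i + b + 1) (by omega) (by omega)
        omega
      · subst h; omega
      · have := hlt (2 * i + b) (2 * j + b) (by omega) (by omega)
        omega
    · rintro ⟨hx, hx'⟩
      simp only [Finset.mem_image, Finset.mem_range] at hx hx'
      obtain ⟨i, hi, hix⟩ := hx
      obtain ⟨j, hj, hjx⟩ := hx'
      rcases Nat.eq_zero_or_pos b with rfl | hb0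
      · have := hlt (2 * j + 0 + 1) (2 * j + 0) (by omega) (by omega)
        have := hm (2 * j + 0 + 1) (by omega)
        omega
      · have := hlt (2 * i + b) (2 * i) (by omega) (by omega)
        omega
  constructor
  · obtain ⟨T, hT⟩ := key 0 (by omega)
    refine ⟨T, hT ▸ fun x hx => ?_⟩
    simp only [Finset.mem_image, Finset.mem_range] at hx
    obtain ⟨i, hi, rfl⟩ := hx
    simpa using h2 (2 * i + 0) (by omega)
  · obtain ⟨T, hT⟩ := key 1 (by omega)
    refine ⟨T, hT ▸ fun x hx => ?_⟩
    simp only [Finset.mem_image, Finset.mem_range] at hx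
    obtain ⟨i, hi, rfl⟩ := hx
    have := h2 (2 * i + 1) (by omega)
    rwa [if_neg (by simp)] at this

/-- The same label with the opposite sign. -/
def flipSign {ι : Type*} (x : ι × Bool) : ι × Bool := (x.1, !x.2)

open Classical in
/-- The length of the longest alternating sequence, capped at `N`. -/
noncomputable def altLength (N : ℕ) (P Q : Finset ℕ) : ℕ :=
  Nat.findGreatest (fun L => HasAlt P Q L ∨ HasAlt Q P L) N

open Classical in
theorem altLength_le (N : ℕ) (P Q : Finset ℕ) : altLength N P Q ≤ N := Nat.findGreatest_le _

open Classical in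
theorem altLength_spec (N : ℕ) (P Q : Finset ℕ) :
    HasAlt P Q (altLength N P Q) ∨ HasAlt Q P (altLength N P Q) :=
  Nat.findGreatest_spec (P := fun L => HasAlt P Q L ∨ HasAlt Q P L) (Nat.zero_le N)
    (Or.inl (hasAlt_zero P Q))

open Classical in
theorem le_altLength {N L : ℕ} {P Q : Finset ℕ} (hL : L ≤ N) (h : HasAlt P Q L ∨ HasAlt Q P L) :
    L ≤ altLength N P Q := Nat.le_findGreatest hL h

theorem altLength_comm (N : ℕ) (P Q : Finset ℕ) : altLength N Q P = altLength N P Q :=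
  le_antisymm (le_altLength (altLength_le _ _ _) (altLength_spec N Q P).symm)
    (le_altLength (altLength_le _ _ _) (altLength_spec N P Q).symm)

theorem altLength_pos {N : ℕ} {P Q : Finset ℕ} (hN : 1 ≤ N) (h : (P ∪ Q).Nonempty) :
    1 ≤ altLength N P Q := by
  obtain ⟨x, hx⟩ := h
  have : ∀ R R' : Finset ℕ, x ∈ R → HasAlt R R' 1 := fun R R' hx =>
    ⟨fun _ => x, fun i hi => by omega, fun i hi => by
      obtain rfl : i = 0 := by omega
      simpa using hx⟩
  exact le_altLength hN ((Finset.mem_union.1 hx).imp (this _ _) (this _ _))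

theorem altLength_not_both {N : ℕ} {P Q : Finset ℕ} (hlt : altLength N P Q < N)
    (hd : Disjoint P Q) (h : (P ∪ Q).Nonempty) :
    ¬ (HasAlt P Q (altLength N P Q) ∧ HasAlt Q P (altLength N P Q)) := by
  rintro ⟨h1, h2⟩
  have := le_altLength (N := N) (by omega)
    (HasAlt.succ_of_both (altLength_pos (by omega) h) hd h1 h2)
  omega

/-- A signed labelling, by at most `k` labels, of the pairs of completely joined vertex sets of a
target of a homomorphism from `SG_{n,k}` cannot be antipodal without having complementary edges. -/
theorem no_antipodal_labelling {n k : ℕ} (hn : 1 ≤ n) {W ι : Type*} [Fintype ι]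
    (hι : Fintype.card ι ≤ k) (H : SimpleGraph W) (φ : SG n k →g H)
    (lab : Set W → Set W → ι × Bool)
    (hanti : ∀ A B : Set W, A.Nonempty → B.Nonempty → (∀ p ∈ A, ∀ q ∈ B, H.Adj p q) →
      lab B A = flipSign (lab A B))
    (hedge : ∀ A B A' B' : Set W, A.Nonempty → B.Nonempty → A ⊆ A' → B ⊆ B' →
      (∀ p ∈ A', ∀ q ∈ B', H.Adj p q) → lab A B ≠ flipSign (lab A' B')) : False := by
  classical
  let st : Finset ℕ → Set W := fun P => φ '' {T | T.1 ⊆ P}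
  have st_mono : ∀ {P P'}, P ⊆ P' → st P ⊆ st P' := fun h =>
    Set.image_mono fun T (hT : T.1 ⊆ _) => hT.trans h
  have st_adj : ∀ {P Q}, Disjoint P Q → ∀ p ∈ st P, ∀ q ∈ st Q, H.Adj p q := by
    rintro P Q hd _ ⟨T, hT, rfl⟩ _ ⟨T', hT', rfl⟩
    exact φ.map_rel ((SG_adj hn).2 (Finset.disjoint_of_subset_left hT
      (Finset.disjoint_of_subset_right hT' hd)))
  have st_ne : ∀ {P Q}, P ⊆ Finset.range (2 * n + k) → Q ⊆ Finset.range (2 * n + k) →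
      ¬ altLength (2 * n) P Q < 2 * n → (st P).Nonempty ∧ (st Q).Nonempty := by
    intro P Q hP hQ ha
    have h1 := altLength_spec (2 * n) P Q
    rw [show altLength (2 * n) P Q = 2 * n from le_antisymm (altLength_le _ _ _) (by omega)] at h1
    have key : ∀ {P : Finset ℕ}, (∃ T : SGVert n k, T.1 ⊆ P) → (st P).Nonempty := by
      rintro P ⟨T, hT⟩
      exact ⟨φ T, T, hT, rfl⟩
    rcases h1 with h1 | h1
    · obtain ⟨h2, h3⟩ := h1.exists_stable hP hQ
      exact ⟨key h2, key h3⟩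
    · obtain ⟨h2, h3⟩ := h1.exists_stable hQ hP
      exact ⟨key h3, key h2⟩
  let num : ι × Bool → ℤ := fun x =>
    if x.2 then 2 * n + (Fintype.equivFin ι x.1 : ℕ) else - (2 * n + (Fintype.equivFin ι x.1 : ℕ))
  have num_flip : ∀ x, num (flipSign x) = - num x := by
    rintro ⟨i, b⟩
    cases b <;> simp [num, flipSign]
  have num_inj : ∀ x y, num x = num y → x = y := by
    rintro ⟨i, b⟩ ⟨j, b'⟩ h
    have : b = b' := by
      cases b <;> cases b' <;> simp [num] at h ⊢ <;> omega
    subst this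
    have : (Fintype.equivFin ι i : ℕ) = Fintype.equivFin ι j := by
      cases b <;> simp [num] at h ⊢ <;> omega
    rw [Prod.mk.injEq]
    exact ⟨(Fintype.equivFin ι).injective (Fin.ext this), rfl⟩
  have num_abs : ∀ x, 2 * n ≤ (num x).natAbs ∧ (num x).natAbs < 2 * n + k := by
    rintro ⟨i, b⟩
    have := (Fintype.equivFin ι i).2
    cases b <;> simp [num] <;> omega
  let f : Finset ℕ → Finset ℕ → ℤ := fun P Q =>
    if altLength (2 * n) P Q < 2 * n then
      if HasAlt P Q (altLength (2 * n) P Q) then altLength (2 * n) P Q else - altLength (2 * n) P Q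
    else num (lab (st P) (st Q))
  have f_lt : ∀ P Q, altLength (2 * n) P Q < 2 * n → (f P Q).natAbs = altLength (2 * n) P Q := by
    intro P Q h
    simp only [f, if_pos h]
    split_ifs <;> simp
  have f_ge : ∀ P Q, ¬ altLength (2 * n) P Q < 2 * n → f P Q = num (lab (st P) (st Q)) := by
    intro P Q h
    simp only [f, if_neg h]
  let val : Finset (Fin (2 * n + k)) → Finset ℕ := fun P => P.map Fin.valEmbedding
  have val_range : ∀ P, val P ⊆ Finset.range (2 * n + k) := by
    intro P x hx
    simp only [val, Finset.mem_map] at hx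
    obtain ⟨i, -, rfl⟩ := hx
    exact Finset.mem_range.2 i.2
  have hfan : FanLabelling (fun P Q => f (val P) (val Q)) := by
    constructor
    · intro P Q hd hne
      have hd' : Disjoint (val P) (val Q) := (Finset.disjoint_map _).2 hd
      have hne' : (val P ∪ val Q).Nonempty := by
        simp only [val, ← Finset.map_union]
        simpa using hne
      by_cases ha : altLength (2 * n) (val P) (val Q) < 2 * n
      · have h1 := altLength_spec (2 * n) (val P) (val Q)
        have h2 := altLength_not_both ha hd' hne'
        simp only [f, altLength_comm (2 * n) (val P) (val Q), if_pos ha]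
        split_ifs with h3 h4 h4
        · exact absurd ⟨h4, h3⟩ h2
        · simp
        · rfl
        · exact absurd h1 (not_or.2 ⟨h4, h3⟩)
      · obtain ⟨h1, h2⟩ := st_ne (val_range P) (val_range Q) ha
        rw [f_ge _ _ ha, f_ge _ _ (by rwa [altLength_comm]), hanti _ _ h1 h2 (st_adj hd'), num_flip]
    · intro P Q P' Q' hPP hQQ hd hne heq
      have hPP' : val P ⊆ val P' := Finset.map_subset_map.2 hPP
      have hQQ' : val Q ⊆ val Q' := Finset.map_subset_map.2 hQQ
      have hd' : Disjoint (val P') (val Q') := (Finset.disjoint_map _).2 hd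
      have hne' : (val P ∪ val Q).Nonempty := by
        simp only [val, ← Finset.map_union]
        simpa using hne
      have hne'' : (val P' ∪ val Q').Nonempty := hne'.mono (Finset.union_subset_union hPP' hQQ')
      have habs : (f (val P) (val Q)).natAbs = (f (val P') (val Q')).natAbs := by
        omega
      by_cases ha : altLength (2 * n) (val P) (val Q) < 2 * n
      · by_cases ha' : altLength (2 * n) (val P') (val Q') < 2 * n
        · rw [f_lt _ _ ha, f_lt _ _ ha'] at habs
          have h0 := altLength_pos (N := 2 * n) (by omega) hne'
          have h1 := altLength_spec (2 * n) (val P) (val Q)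
          have h2 := altLength_not_both ha' hd' hne''
          simp only [f, if_pos ha, if_pos ha', ← habs] at heq h2
          split_ifs at heq with h3 h4 h4
          · omega
          · exact h4 (h3.mono hPP' hQQ')
          · exact h2 ⟨h4, (h1.resolve_left h3).mono hQQ' hPP'⟩
          · omega
        · rw [f_lt _ _ ha, f_ge _ _ ha'] at habs
          have := (num_abs (lab (st (val P')) (st (val Q')))).1
          omega
      · by_cases ha' : altLength (2 * n) (val P') (val Q') < 2 * n
        · rw [f_lt _ _ ha', f_ge _ _ ha] at habs
          have := (num_abs (lab (st (val P)) (st (val Q)))).1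
          omega
        · obtain ⟨h1, h2⟩ := st_ne (val_range P) (val_range Q) ha
          refine hedge _ _ _ _ h1 h2 (st_mono hPP') (st_mono hQQ') (st_adj hd') (num_inj _ _ ?_)
          simp only [f_ge _ _ ha, f_ge _ _ ha'] at heq
          rw [num_flip]
          omega
  have := hfan.le (N := 2 * n + k - 1) (fun P Q _ _ => by
    by_cases ha : altLength (2 * n) (val P) (val Q) < 2 * n
    · rw [f_lt _ _ ha]
      omega
    · rw [f_ge _ _ ha]
      have := (num_abs (lab (st (val P)) (st (val Q)))).2
      omega)
  omega

theorem SG_not_colorable {n k : ℕ} (hn : 1 ≤ n) (hk : 1 ≤ k) : ¬ (SG n k).Colorable (k + 1) := by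
  classical
  rintro ⟨φ⟩
  let mn : Set (Fin (k + 1)) → Set (Fin (k + 1)) → ℕ := fun A B => sInf (Fin.val '' (A ∪ B))
  have mn_mem : ∀ A B : Set (Fin (k + 1)), A.Nonempty →
      mn A B ∈ Fin.val '' A ∨ mn A B ∈ Fin.val '' B := by
    intro A B hA
    have := Nat.sInf_mem ((hA.mono Set.subset_union_left).image Fin.val (s := A ∪ B))
    rw [Set.image_union] at this
    simpa only [mn, Set.image_union, Set.mem_union] using this
  have mn_lt : ∀ A B : Set (Fin (k + 1)), A.Nonempty → B.Nonempty →
      (∀ p ∈ A, ∀ q ∈ B, (⊤ : SimpleGraph (Fin (k + 1))).Adj p q) → mn A B < k := by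
    rintro A B ⟨p, hp⟩ ⟨q, hq⟩ h
    have h1 : mn A B ≤ p := Nat.sInf_le ⟨p, Or.inl hp, rfl⟩
    have h2 : mn A B ≤ q := Nat.sInf_le ⟨q, Or.inr hq, rfl⟩
    have h3 : (p : ℕ) ≠ q := fun h' => (h p hp q hq) (Fin.ext h')
    have := p.2
    have := q.2
    omega
  have disj : ∀ A B : Set (Fin (k + 1)),
      (∀ p ∈ A, ∀ q ∈ B, (⊤ : SimpleGraph (Fin (k + 1))).Adj p q) → ∀ x ∈ Fin.val '' A,
      x ∉ Fin.val '' B := by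
    rintro A B h _ ⟨p, hp, rfl⟩ ⟨q, hq, hqp⟩
    exact h p hp q hq (Fin.ext hqp.symm)
  refine no_antipodal_labelling hn (ι := Fin k) (by simp) ⊤ φ
    (fun A B => (⟨mn A B % k, Nat.mod_lt _ hk⟩, decide (mn A B ∈ Fin.val '' A))) ?_ ?_
  · intro A B hA hB h
    have h1 : mn B A = mn A B := by simp only [mn, Set.union_comm]
    simp only [flipSign, h1, Prod.mk.injEq, true_and]
    have h2 := disj A B h (mn A B)
    rcases mn_mem A B hA with h3 | h3
    · simp only [h3, h2 h3, decide_true, decide_false, Bool.not_true]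
    · have h4 : mn A B ∉ Fin.val '' A := fun h4 => h2 h4 h3
      simp only [h3, h4, decide_true, decide_false, Bool.not_false]
  · intro A B A' B' hA hB hAA hBB h heq
    simp only [flipSign, Prod.mk.injEq, Fin.mk.injEq] at heq
    have h1 := mn_lt A B hA hB (fun p hp q hq => h p (hAA hp) q (hBB hq))
    have h2 := mn_lt A' B' (hA.mono hAA) (hB.mono hBB) h
    rw [Nat.mod_eq_of_lt h1, Nat.mod_eq_of_lt h2] at heq
    obtain ⟨h3, h4⟩ := heq
    rcases mn_mem A B hA with h5 | h5
    · have h6 : mn A' B' ∈ Fin.val '' A' := h3 ▸ Set.image_mono hAA h5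
      simp only [h5, h6, decide_true, Bool.not_true] at h4
      cases h4
    · have h6 : mn A' B' ∈ Fin.val '' B' := h3 ▸ Set.image_mono hBB h5
      have h7 : mn A' B' ∉ Fin.val '' A' := fun h7 => disj A' B' h _ h7 h6
      have h8 : mn A B ∉ Fin.val '' A := fun h8 =>
        disj A' B' h _ (Set.image_mono hAA h8) (h3 ▸ h6)
      simp only [h7, h8, decide_false, Bool.not_false] at h4
      cases h4

theorem succ_notMem {n k : ℕ} (T : SGVert n k) {p : ℕ} (h : p ∈ T.1) : p + 1 ∉ T.1 := fun h' =>
  T.2.2.1.2 p (Finset.mem_range.1 (T.2.2.1.1 h')) ⟨h, h'⟩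

theorem vert_lt {n k : ℕ} (T : SGVert n k) {p : ℕ} (h : p ∈ T.1) : p < 2 * n + k :=
  Finset.mem_range.1 (T.2.2.1.1 h)

/-- A vertex of `SG_{n,k}` containing `0` all of whose internal gaps have length `2` or `3`. -/
structure ShortGaps {n k : ℕ} (S : SGVert n k) : Prop where
  zero_mem : 0 ∈ S.1
  step : ∀ s ∈ S.1, ∀ t ∈ S.1, s < t → s + 2 ∈ S.1 ∨ s + 3 ∈ S.1

/-- The points outside `S ∪ (S + 1)`. -/
def free {n k : ℕ} (S : SGVert n k) : Finset ℕ :=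
  Finset.range (2 * n + k) \ (S.1 ∪ S.1.image (· + 1))

theorem mem_free {n k : ℕ} {S : SGVert n k} {p : ℕ} :
    p ∈ free S ↔ p < 2 * n + k ∧ p ∉ S.1 ∧ ∀ s ∈ S.1, s + 1 ≠ p := by
  simp [free]

theorem card_union_succ {n k : ℕ} (S : SGVert n k) : (S.1 ∪ S.1.image (· + 1)).card = 2 * n := by
  rw [Finset.card_union_of_disjoint, Finset.card_image_of_injective _ (add_left_injective 1), S.2.1]
  · omega
  · rw [Finset.disjoint_left]
    intro p hp hp'
    obtain ⟨s, hs, rfl⟩ := Finset.mem_image.1 hp'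
    exact succ_notMem S hs hp

theorem card_free {n k : ℕ} {S : SGVert n k} (hS : 0 ∈ S.1) : (free S).card = k := by
  rw [free, Finset.card_sdiff_of_subset, Finset.card_range, card_union_succ]
  · omega
  · intro p hp
    rw [Finset.mem_range]
    rcases Finset.mem_union.1 hp with hp | hp
    · exact vert_lt S hp
    · obtain ⟨s, hs, rfl⟩ := Finset.mem_image.1 hp
      have h1 := vert_lt S hs
      have h2 : s ≠ 2 * n + k - 1 := by
        rintro rfl
        exact S.2.2.2 ⟨hS, hs⟩
      show s + 1 < _
      omega

/-- For a predecessor of a point lying above an element of `S`. -/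
theorem exists_greatest_below {S : Finset ℕ} {p : ℕ} (h : ∃ s ∈ S, s < p) :
    ∃ s ∈ S, s < p ∧ ∀ t ∈ S, t < p → t ≤ s := by
  obtain ⟨s, hs, hsp⟩ := h
  obtain ⟨t, ht, hmax⟩ := (S.filter (· < p)).exists_max_image id ⟨s, by simp [hs, hsp]⟩
  simp only [Finset.mem_filter, id_eq] at ht hmax
  exact ⟨t, ht.1, ht.2, fun u hu hup => hmax u ⟨hu, hup⟩⟩

section Critical
variable {n k : ℕ} {S : SGVert n k}

theorem ShortGaps.of_free (hS : ShortGaps S) {p : ℕ} (hp : p ∈ free S) (hlt : ∃ s ∈ S.1, p < s) :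
    2 ≤ p ∧ p - 2 ∈ S.1 ∧ p + 1 ∈ S.1 := by
  obtain ⟨-, h1, h2⟩ := mem_free.1 hp
  obtain ⟨t, ht, hpt⟩ := hlt
  have h0 : p ≠ 0 := by rintro rfl; exact h1 hS.zero_mem
  obtain ⟨s, hs, hsp, hmax⟩ := exists_greatest_below ⟨0, hS.zero_mem, Nat.pos_of_ne_zero h0⟩
  have h3 := h2 s hs
  rcases hS.step s hs t ht (hsp.trans hpt) with h4 | h4
  · have h5 : s + 2 ≠ p := by rintro rfl; exact h1 h4
    have := hmax _ h4
    omega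
  · have h5 : s + 3 ≠ p := by rintro rfl; exact h1 h4
    have h6 := hmax _ h4
    obtain rfl : p = s + 2 := by omega
    exact ⟨by omega, hs, h4⟩

/-- Free point above `S` carrying a sign. -/
def Starred (S : SGVert n k) (P Q : Set ℕ) (p : ℕ) : Prop :=
  p ∈ free S ∧ (∀ s ∈ S.1, s < p) ∧ (p ∈ P ∨ p ∈ Q)

/-- Free point inside a gap of length `3` both of whose inner points carry different signs. -/
def Mixed (S : SGVert n k) (P Q : Set ℕ) (p : ℕ) : Prop :=
  p ∈ free S ∧ (∃ s ∈ S.1, p < s) ∧ (¬ (p - 1 ∈ P ↔ p ∈ P) ∨ ¬ (p - 1 ∈ Q ↔ p ∈ Q))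

/-- Free point inside a gap of length `3` whose two end points carry different signs. -/
def Unbalanced (S : SGVert n k) (P Q : Set ℕ) (p : ℕ) : Prop :=
  p ∈ free S ∧ (∃ s ∈ S.1, p < s) ∧ (¬ (p - 2 ∈ P ↔ p + 1 ∈ P) ∨ ¬ (p - 2 ∈ Q ↔ p + 1 ∈ Q))

theorem starred_comm (S : SGVert n k) (P Q : Set ℕ) : Starred S Q P = Starred S P Q := by
  funext p; simp only [Starred, or_comm]

theorem mixed_comm (S : SGVert n k) (P Q : Set ℕ) : Mixed S Q P = Mixed S P Q := by
  funext p; simp only [Mixed, or_comm]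

theorem unbalanced_comm (S : SGVert n k) (P Q : Set ℕ) : Unbalanced S Q P = Unbalanced S P Q := by
  funext p; simp only [Unbalanced, or_comm]

theorem exists_lt_of_free {P Q : Set ℕ} (h1 : ¬ ∃ p, Starred S P Q p) {p : ℕ}
    (hp : p ∈ free S) (hpP : p ∈ P ∨ p ∈ Q) : ∃ s ∈ S.1, p < s := by
  by_contra! h
  refine h1 ⟨p, hp, fun s hs => lt_of_le_of_ne (h s hs) ?_, hpP⟩
  rintro rfl
  exact (mem_free.1 hp).2.1 hs

/-- If there are no starred and no mixed points, every cell is hit. -/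
theorem ShortGaps.cells (hS : ShortGaps S) {P Q : Set ℕ} (hd : Disjoint P Q)
    (h1 : ¬ ∃ p, Starred S P Q p) (h2 : ¬ ∃ p, Mixed S P Q p) {T T' : SGVert n k}
    (hT : ∀ p ∈ T.1, p ∈ P) (hT' : ∀ p ∈ T'.1, p ∈ Q) :
    (∀ s ∈ S.1, s ∈ T.1 ∨ s ∈ T'.1) ∧
    (∀ s ∈ S.1, (s + 1 ∈ T.1 ∨ s + 1 ∈ T'.1) ∨
      (s + 2 ∈ free S ∧ (s + 2 ∈ T.1 ∨ s + 2 ∈ T'.1))) := by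
  classical
  have hPQ : ∀ p, p ∈ P → p ∉ Q := fun p hp => Set.disjoint_left.1 hd hp
  have hU : ∀ p, p ∈ T.1 ∪ T'.1 → p ∈ P ∨ p ∈ Q := fun p hp =>
    (Finset.mem_union.1 hp).imp (hT p) (hT' p)
  have hTT : Disjoint T.1 T'.1 := Finset.disjoint_left.2 fun p hp hp' => hPQ p (hT p hp) (hT' p hp')
  let g : ℕ → ℕ := fun p => if p ∈ free S then p - 1 else p
  have hg : Set.MapsTo g (T.1 ∪ T'.1 : Finset ℕ) (S.1 ∪ S.1.image (· + 1) : Finset ℕ) := by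
    intro p hp
    have hp : p ∈ T.1 ∪ T'.1 := hp
    show g p ∈ S.1 ∪ S.1.image (· + 1)
    by_cases hf : p ∈ free S
    · obtain ⟨h3, h4, -⟩ := hS.of_free hf (exists_lt_of_free h1 hf (hU p hp))
      simp only [g, if_pos hf]
      exact Finset.mem_union_right _ (Finset.mem_image.2 ⟨_, h4, by omega⟩)
    · simp only [g, if_neg hf]
      by_contra h
      refine hf (Finset.mem_sdiff.2 ⟨Finset.mem_range.2 ?_, h⟩)
      rcases Finset.mem_union.1 hp with hp | hp
      · exact vert_lt T hp
      · exact vert_lt T' hp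
  have key : ∀ p q, p ∈ T.1 ∪ T'.1 → q ∈ T.1 ∪ T'.1 → p < q → g p ≠ g q := by
    intro p q hp hq hpq he
    have h3 : q = p + 1 ∧ q ∈ free S := by
      simp only [g] at he
      split_ifs at he with h3 h4 h4
      · have := (hS.of_free h3 (exists_lt_of_free h1 h3 (hU p hp))).1
        omega
      · omega
      · exact ⟨by omega, h4⟩
      · omega
    obtain ⟨rfl, h4⟩ := h3
    refine h2 ⟨p + 1, h4, exists_lt_of_free h1 h4 (hU _ hq), ?_⟩
    rw [Nat.add_sub_cancel]
    rcases Finset.mem_union.1 hp with hp | hp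
    · rcases Finset.mem_union.1 hq with hq | hq
      · exact absurd hq (succ_notMem T hp)
      · exact Or.inl fun h => hPQ _ (h.1 (hT p hp)) (hT' _ hq)
    · rcases Finset.mem_union.1 hq with hq | hq
      · exact Or.inl fun h => hPQ _ (h.2 (hT _ hq)) (hT' _ hp)
      · exact absurd hq (succ_notMem T' hp)
  have hinj : Set.InjOn g (T.1 ∪ T'.1 : Finset ℕ) := by
    intro p hp q hq he
    rcases lt_trichotomy p q with h | h | h
    · exact absurd he (key p q hp hq h)
    · exact h
    · exact absurd he.symm (key q p hq hp h)
  have hsurj := Finset.surjOn_of_injOn_of_card_le g hg hinj (by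
    rw [card_union_succ, Finset.card_union_of_disjoint hTT, T.2.1, T'.2.1]
    omega)
  constructor
  · intro s hs
    obtain ⟨p, hp, hps⟩ := hsurj (Finset.mem_coe.2 (Finset.mem_union_left _ hs))
    have hp : p ∈ T.1 ∪ T'.1 := hp
    by_cases hf : p ∈ free S
    · obtain ⟨h3, h4, -⟩ := hS.of_free hf (exists_lt_of_free h1 hf (hU p hp))
      simp only [g, if_pos hf] at hps
      have := succ_notMem S h4
      rw [show p - 2 + 1 = s by omega] at this
      exact absurd hs this
    · simp only [g, if_neg hf] at hps
      rw [← hps]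
      exact Finset.mem_union.1 hp
  · intro s hs
    obtain ⟨p, hp, hps⟩ := hsurj (Finset.mem_coe.2 (Finset.mem_union_right _
      (Finset.mem_image_of_mem _ hs)))
    have hp : p ∈ T.1 ∪ T'.1 := hp
    by_cases hf : p ∈ free S
    · obtain ⟨h3, -⟩ := hS.of_free hf (exists_lt_of_free h1 hf (hU p hp))
      simp only [g, if_pos hf] at hps
      obtain rfl : p = s + 2 := by omega
      exact Or.inr ⟨hf, Finset.mem_union.1 hp⟩
    · simp only [g, if_neg hf] at hps
      rw [← hps]
      exact Or.inl (Finset.mem_union.1 hp)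

theorem ShortGaps.eq_of_balanced (hS : ShortGaps S) {P Q : Set ℕ} (hd : Disjoint P Q)
    (h1 : ¬ ∃ p, Starred S P Q p) (h2 : ¬ ∃ p, Mixed S P Q p) (h3 : ¬ ∃ p, Unbalanced S P Q p)
    {T T' : SGVert n k} (hT : ∀ p ∈ T.1, p ∈ P) (hT' : ∀ p ∈ T'.1, p ∈ Q) (h0 : 0 ∈ T.1) :
    T = S := by
  obtain ⟨hc, hc'⟩ := hS.cells hd h1 h2 hT hT'
  have hPQ : ∀ p, p ∈ P → p ∉ Q := fun p hp => Set.disjoint_left.1 hd hp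
  have hsub : ∀ s, s ∈ S.1 → s ∈ T.1 := by
    intro s
    induction s using Nat.strong_induction_on with
    | _ s ih =>
      intro hs
      rcases Nat.eq_zero_or_pos s with rfl | hpos
      · exact h0
      obtain ⟨t, ht, hts, hmax⟩ := exists_greatest_below ⟨0, hS.zero_mem, hpos⟩
      have htT := ih t hts ht
      rcases hS.step t ht s hs hts with h4 | h4
      · have h5 : s = t + 2 := by
          have := hmax _ h4
          have : s ≠ t + 1 := by rintro rfl; exact succ_notMem S ht hs
          omega
        subst h5
        have h6 : t + 1 ∈ T'.1 := by
          rcases hc' t ht with (h | h) | ⟨h, -⟩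
          · exact absurd h (succ_notMem T htT)
          · exact h
          · exact absurd hs (mem_free.1 h).2.1
        exact (hc _ hs).resolve_right (succ_notMem T' h6)
      · have h7 : t + 2 ∉ S.1 := fun h => succ_notMem S h h4
        have h5 : s = t + 3 := by
          have := hmax _ h4
          have : s ≠ t + 1 := by rintro rfl; exact succ_notMem S ht hs
          have : s ≠ t + 2 := by rintro rfl; exact h7 hs
          omega
        subst h5
        have hf : t + 2 ∈ free S := by
          refine mem_free.2 ⟨by have := vert_lt S hs; omega, h7, ?_⟩
          intro u hu hut
          obtain rfl : u = t + 1 := by omega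
          exact succ_notMem S ht hu
        by_contra hsT
        refine h3 ⟨t + 2, hf, ⟨_, hs, by omega⟩, Or.inl fun h => ?_⟩
        exact hPQ _ (h.1 (hT _ htT)) (hT' _ ((hc _ hs).resolve_left hsT))
  refine (Subtype.ext (Finset.eq_of_subset_of_card_le hsub ?_)).symm
  rw [T.2.1, S.2.1]

end Critical

section Critical
variable {n k : ℕ} {S : SGVert n k}

open Classical in
/-- The signed free point attached to a sign vector `(P, Q)`. -/
noncomputable def gapLabel (S : SGVert n k) (P Q : Set ℕ) : ℕ × Bool :=
  if ∃ p, Starred S P Q p then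
    (sInf {p | Starred S P Q p}, decide (sInf {p | Starred S P Q p} ∈ P))
  else if ∃ p, Mixed S P Q p then
    (sInf {p | Mixed S P Q p}, decide (sInf {p | Mixed S P Q p} - 1 ∈ P ∨
      (sInf {p | Mixed S P Q p} - 1 ∉ Q ∧ sInf {p | Mixed S P Q p} ∈ Q)))
  else (sInf {p | Unbalanced S P Q p}, decide (sInf {p | Unbalanced S P Q p} - 2 ∈ Q))

open Classical in
/-- The possible situations for `gapLabel`. -/
theorem gapLabel_cases (S : SGVert n k) (P Q : Set ℕ) :
    (∃ p b, gapLabel S P Q = (p, b) ∧ Starred S P Q p ∧ (b = true ↔ p ∈ P)) ∨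
    ((¬ ∃ p, Starred S P Q p) ∧ ∃ p b, gapLabel S P Q = (p, b) ∧ Mixed S P Q p ∧
      (b = true ↔ p - 1 ∈ P ∨ (p - 1 ∉ Q ∧ p ∈ Q))) ∨
    ((¬ ∃ p, Starred S P Q p) ∧ (¬ ∃ p, Mixed S P Q p) ∧ ((∃ p, Unbalanced S P Q p) →
      ∃ p b, gapLabel S P Q = (p, b) ∧ Unbalanced S P Q p ∧ (b = true ↔ p - 2 ∈ Q))) := by
  by_cases h1 : ∃ p, Starred S P Q p
  · refine Or.inl ⟨sInf {p | Starred S P Q p}, _, by rw [gapLabel, if_pos h1], Nat.sInf_mem h1, decide_eq_true_iff⟩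
  by_cases h2 : ∃ p, Mixed S P Q p
  · refine Or.inr (Or.inl ⟨h1, sInf {p | Mixed S P Q p}, _, by rw [gapLabel, if_neg h1, if_pos h2], Nat.sInf_mem h2,
      decide_eq_true_iff⟩)
  · exact Or.inr (Or.inr ⟨h1, h2, fun h3 => ⟨sInf {p | Unbalanced S P Q p}, _,
      by rw [gapLabel, if_neg h1, if_neg h2], Nat.sInf_mem h3, decide_eq_true_iff⟩⟩)

theorem ShortGaps.exists_unbalanced (hS : ShortGaps S) {P Q : Set ℕ} (hd : Disjoint P Q)
    (h1 : ¬ ∃ p, Starred S P Q p) (h2 : ¬ ∃ p, Mixed S P Q p)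
    {T T' : SGVert n k} (hT : ∀ p ∈ T.1, p ∈ P) (hT' : ∀ p ∈ T'.1, p ∈ Q) (hTS : T ≠ S)
    (hTS' : T' ≠ S) : ∃ p, Unbalanced S P Q p := by
  by_contra h3
  rcases (hS.cells hd h1 h2 hT hT').1 0 hS.zero_mem with h0 | h0
  · exact hTS (hS.eq_of_balanced hd h1 h2 h3 hT hT' h0)
  · exact hTS' (hS.eq_of_balanced hd.symm (by rwa [starred_comm]) (by rwa [mixed_comm])
      (by rwa [unbalanced_comm]) hT' hT h0)

theorem ShortGaps.gapLabel_mem_free (hS : ShortGaps S) {P Q : Set ℕ} (hd : Disjoint P Q)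
    {T T' : SGVert n k} (hT : ∀ p ∈ T.1, p ∈ P) (hT' : ∀ p ∈ T'.1, p ∈ Q) (hTS : T ≠ S)
    (hTS' : T' ≠ S) : (gapLabel S P Q).1 ∈ free S := by
  rcases gapLabel_cases S P Q with ⟨p, b, h, h1, -⟩ | ⟨-, p, b, h, h1, -⟩ | ⟨h1, h2, h3⟩
  · rw [h]; exact h1.1
  · rw [h]; exact h1.1
  · obtain ⟨p, b, h, h4, -⟩ := h3 (hS.exists_unbalanced hd h1 h2 hT hT' hTS hTS')
    rw [h]; exact h4.1

theorem ShortGaps.gapLabel_swap (hS : ShortGaps S) {P Q : Set ℕ} (hd : Disjoint P Q)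
    {T T' : SGVert n k} (hT : ∀ p ∈ T.1, p ∈ P) (hT' : ∀ p ∈ T'.1, p ∈ Q) (hTS : T ≠ S)
    (hTS' : T' ≠ S) : gapLabel S Q P = flipSign (gapLabel S P Q) := by
  classical
  have hPQ : ∀ p, p ∈ P → p ∉ Q := fun p hp => Set.disjoint_left.1 hd hp
  simp only [gapLabel, flipSign, starred_comm S P Q, mixed_comm S P Q, unbalanced_comm S P Q]
  split_ifs with h1 h2
  · obtain ⟨-, -, h⟩ := Nat.sInf_mem (s := {p | Starred S P Q p}) h1
    have := hPQ (sInf {p | Starred S P Q p})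
    simp only [Prod.mk.injEq, true_and, ← decide_not, decide_eq_decide]
    tauto
  · obtain ⟨-, -, h⟩ := Nat.sInf_mem (s := {p | Mixed S P Q p}) h2
    have h3 := hPQ (sInf {p | Mixed S P Q p})
    have h4 := hPQ (sInf {p | Mixed S P Q p} - 1)
    simp only [Prod.mk.injEq, true_and, ← decide_not, decide_eq_decide]
    tauto
  · have h3 := hS.exists_unbalanced hd h1 h2 hT hT' hTS hTS'
    obtain ⟨hf, hlt, h⟩ := Nat.sInf_mem (s := {p | Unbalanced S P Q p}) h3
    have h4 := hPQ (sInf {p | Unbalanced S P Q p} - 2)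
    have h5 : sInf {p | Unbalanced S P Q p} - 2 ∈ P ∨ sInf {p | Unbalanced S P Q p} - 2 ∈ Q :=
      ((hS.cells hd h1 h2 hT hT').1 _ (hS.of_free hf hlt).2.1).imp (hT _) (hT' _)
    simp only [Prod.mk.injEq, true_and, ← decide_not, decide_eq_decide]
    tauto

set_option maxHeartbeats 1000000 in
/-- Enlarging the sign vector never flips the sign of a label. -/
theorem ShortGaps.gapLabel_ne (hS : ShortGaps S) {P Q P' Q' : Set ℕ} (hd' : Disjoint P' Q')
    (hPP : P ⊆ P') (hQQ : Q ⊆ Q')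
    {T T' : SGVert n k} (hT : ∀ p ∈ T.1, p ∈ P) (hT' : ∀ p ∈ T'.1, p ∈ Q) (hTS : T ≠ S)
    (hTS' : T' ≠ S) : gapLabel S P Q ≠ flipSign (gapLabel S P' Q') := by
  intro heq
  have hd : Disjoint P Q := hd'.mono hPP hQQ
  have hPQ : ∀ p, p ∈ P' → p ∉ Q' := fun p hp => Set.disjoint_left.1 hd' hp
  have hP := @hPP
  have hQ := @hQQ
  have key : ∀ {p b b'}, (b = true ↔ p) → (b' = true ↔ ¬ p) → b = !b' := by
    intro p b b' h h'
    cases b <;> cases b' <;> simp_all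
  have nostar : ∀ {p}, p ∈ free S → (∃ s ∈ S.1, p < s) → (∀ s ∈ S.1, s < p) → False := by
    rintro p - ⟨s, hs, hps⟩ h
    exact absurd (h s hs) (by omega)
  have dec : ∀ {p b p' b'}, gapLabel S P Q = (p, b) → gapLabel S P' Q' = (p', b') →
      p = p' ∧ (b = true ↔ ¬ b' = true) := by
    intro p b p' b' h h'
    rw [h, h', flipSign, Prod.mk.injEq] at heq
    refine ⟨heq.1, ?_⟩
    rw [heq.2]
    simp
  rcases gapLabel_cases S P Q with ⟨p, b, h, h1, hb⟩ | ⟨h1, p, b, h, h2, hb⟩ | ⟨h1, h2, h3⟩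
  · rcases gapLabel_cases S P' Q' with ⟨p', b', h', h1', hb'⟩ | ⟨h1', p', b', h', h2', hb'⟩ |
      ⟨h1', h2', h3'⟩
    · obtain ⟨rfl, hbb⟩ := dec h h'
      have h4 := @hP p
      have h5 := @hQ p
      have h6 := hPQ p
      have h7 := h1.2.2
      clear heq key nostar dec hP hQ hPQ hT hT' hPP hQQ h1 h1'
      grind
    · obtain ⟨rfl, -⟩ := dec h h'
      exact nostar h1.1 h2'.2.1 h1.2.1
    · obtain ⟨p', b', h', h4', -⟩ := h3' (hS.exists_unbalanced hd' h1' h2'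
        (fun p hp => hPP (hT p hp)) (fun p hp => hQQ (hT' p hp)) hTS hTS')
      obtain ⟨rfl, -⟩ := dec h h'
      exact nostar h1.1 h4'.2.1 h1.2.1
  · rcases gapLabel_cases S P' Q' with ⟨p', b', h', h1', hb'⟩ | ⟨h1', p', b', h', h2', hb'⟩ |
      ⟨h1', h2', h3'⟩
    · obtain ⟨rfl, -⟩ := dec h h'
      exact nostar h1'.1 h2.2.1 h1'.2.1
    · obtain ⟨rfl, hbb⟩ := dec h h'
      have h4 := @hP p
      have h5 := @hQ p
      have h6 := hPQ p
      have h7 := h2.2.2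
      have h4' := @hP (p - 1)
      have h5' := @hQ (p - 1)
      have h6' := hPQ (p - 1)
      have h7' := h2'.2.2
      clear heq key nostar dec h1 h2 hP hQ hPQ hT hT' hPP hQQ h1' h2'
      grind
    · obtain ⟨p', b', h', h4', hb'⟩ := h3' (hS.exists_unbalanced hd' h1' h2'
        (fun p hp => hPP (hT p hp)) (fun p hp => hQQ (hT' p hp)) hTS hTS')
      obtain ⟨rfl, hbb⟩ := dec h h'
      obtain ⟨hp2, hpS, hpS'⟩ := hS.of_free h4'.1 h4'.2.1
      obtain ⟨hc, hc'⟩ := hS.cells hd' h1' h2' (fun p hp => hPP (hT p hp))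
        (fun p hp => hQQ (hT' p hp))
      obtain ⟨q, rfl⟩ := Nat.exists_eq_add_of_le' hp2
      have hmono : (q + 1 ∈ P' ↔ q + 2 ∈ P') ∧ (q + 1 ∈ Q' ↔ q + 2 ∈ Q') := by
        by_contra h
        exact h2' ⟨q + 2, h4'.1, h4'.2.1, by
          simp only [show q + 2 - 1 = q + 1 by omega]
          tauto⟩
      have c1 := hc q hpS
      have c2 := hc' q hpS
      have c3 := hc _ hpS'
      have u := h4'.2.2
      have v := h2.2.2
      simp only [show q + 2 - 1 = q + 1 by omega, show q + 2 - 2 = q by omega,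
        show q + 2 + 1 = q + 3 by omega] at u v hb hb' c1 c2 c3
      have t0 := hT q
      have t1 := hT (q + 1)
      have t2 := hT (q + 2)
      have t3 := hT (q + 3)
      have t0' := hT' q
      have t1' := hT' (q + 1)
      have t2' := hT' (q + 2)
      have t3' := hT' (q + 3)
      have s0 := succ_notMem T (p := q)
      have s2 := succ_notMem T (p := q + 2)
      have s0' := succ_notMem T' (p := q)
      have s2' := succ_notMem T' (p := q + 2)
      have p0 := @hP q
      have p1 := @hP (q + 1)
      have p2 := @hP (q + 2)
      have p3 := @hP (q + 3)
      have q0 := @hQ q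
      have q1 := @hQ (q + 1)
      have q2 := @hQ (q + 2)
      have q3 := @hQ (q + 3)
      have d0 := hPQ q
      have d1 := hPQ (q + 1)
      have d2 := hPQ (q + 2)
      have d3 := hPQ (q + 3)
      clear heq key nostar dec h1 h2 h3' hc hc' h1' h2' h4' hP hQ hPQ hT hT' hPP hQQ
      grind
  · obtain ⟨p, b, h, h4, hb⟩ := h3 (hS.exists_unbalanced hd h1 h2 hT hT' hTS hTS')
    have hc := (hS.cells hd h1 h2 hT hT').1 _ (hS.of_free h4.1 h4.2.1).2.1
    rcases gapLabel_cases S P' Q' with ⟨p', b', h', h1', hb'⟩ | ⟨h1', p', b', h', h2', hb'⟩ |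
      ⟨h1', h2', h3'⟩
    · obtain ⟨rfl, -⟩ := dec h h'
      exact nostar h1'.1 h4.2.1 h1'.2.1
    · obtain ⟨rfl, hbb⟩ := dec h h'
      obtain ⟨hp2, hpS, hpS'⟩ := hS.of_free h4.1 h4.2.1
      have hc' := (hS.cells hd h1 h2 hT hT').2 _ hpS
      obtain ⟨q, rfl⟩ := Nat.exists_eq_add_of_le' hp2
      have hmono : (q + 1 ∈ P ↔ q + 2 ∈ P) ∧ (q + 1 ∈ Q ↔ q + 2 ∈ Q) := by
        by_contra h
        exact h2 ⟨q + 2, h4.1, h4.2.1, by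
          simp only [show q + 2 - 1 = q + 1 by omega]
          tauto⟩
      have v := h2'.2.2
      simp only [show q + 2 - 1 = q + 1 by omega, show q + 2 - 2 = q by omega] at v hc'
      have t1 := hT (q + 1)
      have t2 := hT (q + 2)
      have t1' := hT' (q + 1)
      have t2' := hT' (q + 2)
      have p1 := @hP (q + 1)
      have p2 := @hP (q + 2)
      have q1 := @hQ (q + 1)
      have q2 := @hQ (q + 2)
      have d1 := hPQ (q + 1)
      have d2 := hPQ (q + 2)
      clear heq key nostar dec h1 h2 h3 h4 h2' h1' hP hQ hPQ hT hT' hPP hQQ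
      grind
    · obtain ⟨p', b', h', h4', hb'⟩ := h3' (hS.exists_unbalanced hd' h1' h2'
        (fun p hp => hPP (hT p hp)) (fun p hp => hQQ (hT' p hp)) hTS hTS')
      obtain ⟨rfl, hbb⟩ := dec h h'
      have c := hc.imp (hT _) (hT' _)
      have h4 := @hP (p - 2)
      have h5 := @hQ (p - 2)
      have h6 := hPQ (p - 2)
      clear heq key nostar dec h1 h2 h3 h4' hc hP hQ hPQ hT hT' hPP hQQ h1' h2' h3'
      grind

/-- Vertices with short gaps are critical: they are in the image of every endomorphism. -/
theorem ShortGaps.mem_range (hn : 1 ≤ n) (hk : 1 ≤ k) (hS : ShortGaps S) (φ : SG n k →g SG n k) :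
    ∃ T, φ T = S := by
  classical
  by_contra! hφ
  let H : SimpleGraph {T : SGVert n k // T ≠ S} := (SG n k).comap Subtype.val
  let ψ : SG n k →g H := ⟨fun T => ⟨φ T, hφ T⟩, fun h => φ.map_rel h⟩
  let un : Set {T : SGVert n k // T ≠ S} → Set ℕ := fun A => {p | ∃ T ∈ A, p ∈ T.1.1}
  have un_mono : ∀ {A B}, A ⊆ B → un A ⊆ un B := fun h p ⟨T, hT, hp⟩ => ⟨T, h hT, hp⟩
  have un_disj : ∀ {A B}, (∀ p ∈ A, ∀ q ∈ B, H.Adj p q) → Disjoint (un A) (un B) := by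
    intro A B h
    rw [Set.disjoint_left]
    rintro p ⟨T, hT, hp⟩ ⟨T', hT', hp'⟩
    exact Finset.disjoint_left.1 ((SG_adj hn).1 (h T hT T' hT')) hp hp'
  have wit : ∀ {A}, A.Nonempty → ∃ T : SGVert n k, T ≠ S ∧ ∀ p ∈ T.1, p ∈ un A := by
    rintro A ⟨T, hT⟩
    exact ⟨T.1, T.2, fun p hp => ⟨T, hT, hp⟩⟩
  have hcard : Fintype.card {p // p ∈ free S} = k := by
    rw [Fintype.card_coe, card_free hS.zero_mem]
  obtain ⟨x₀, hx₀⟩ : ∃ x₀, x₀ ∈ free S := by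
    rw [← Finset.Nonempty, ← Finset.card_pos, card_free hS.zero_mem]
    exact hk
  let lab : Set {T : SGVert n k // T ≠ S} → Set {T : SGVert n k // T ≠ S} →
      {p // p ∈ free S} × Bool := fun A B =>
    (if h : (gapLabel S (un A) (un B)).1 ∈ free S then ⟨_, h⟩ else ⟨x₀, hx₀⟩,
      (gapLabel S (un A) (un B)).2)
  have lab_eq : ∀ A B A' B', (gapLabel S (un A) (un B)).1 ∈ free S →
      (gapLabel S (un A') (un B')).1 ∈ free S →
      (lab A B = flipSign (lab A' B') ↔
        gapLabel S (un A) (un B) = flipSign (gapLabel S (un A') (un B'))) := by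
    intro A B A' B' h h'
    simp only [lab, dif_pos h, dif_pos h', flipSign, Prod.ext_iff, Subtype.mk.injEq]
  refine no_antipodal_labelling hn (ι := {p // p ∈ free S}) hcard.le H ψ lab ?_ ?_
  · intro A B hA hB h
    obtain ⟨T, hTS, hT⟩ := wit hA
    obtain ⟨T', hTS', hT'⟩ := wit hB
    rw [lab_eq]
    · exact hS.gapLabel_swap (un_disj h) hT hT' hTS hTS'
    · exact hS.gapLabel_mem_free (un_disj h).symm hT' hT hTS' hTS
    · exact hS.gapLabel_mem_free (un_disj h) hT hT' hTS hTS'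
  · intro A B A' B' hA hB hAA hBB h
    obtain ⟨T, hTS, hT⟩ := wit hA
    obtain ⟨T', hTS', hT'⟩ := wit hB
    have hd := un_disj h
    rw [ne_eq, lab_eq]
    · exact hS.gapLabel_ne hd (un_mono hAA) (un_mono hBB) hT hT' hTS hTS'
    · exact hS.gapLabel_mem_free (hd.mono (un_mono hAA) (un_mono hBB)) hT hT' hTS hTS'
    · exact hS.gapLabel_mem_free hd (fun p hp => un_mono hAA (hT p hp))
        (fun p hp => un_mono hBB (hT' p hp)) hTS hTS'

end Critical

section Greedy
variable {n k : ℕ}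

/-- The number of elements of `T` that are at least `p`. -/
def tailCard (T : SGVert n k) (p : ℕ) : ℕ := (T.1.filter (p ≤ ·)).card

theorem tailCard_zero (T : SGVert n k) : tailCard T 0 = n := by
  simp [tailCard, T.2.1]

theorem tailCard_succ (T : SGVert n k) (p : ℕ) :
    tailCard T p = tailCard T (p + 1) + if p ∈ T.1 then 1 else 0 := by
  have h : T.1.filter (p ≤ ·) = T.1.filter (p + 1 ≤ ·) ∪ T.1.filter (p = ·) := by
    ext x
    simp only [Finset.mem_filter, Finset.mem_union, ← and_or_left]
    refine and_congr_right fun _ => ?_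
    omega
  rw [tailCard, h, Finset.card_union_of_disjoint, Finset.filter_eq]
  · split_ifs <;> rfl
  · rw [Finset.disjoint_left]
    simp only [Finset.mem_filter]
    omega

theorem two_mul_tailCard_le (T : SGVert n k) {p : ℕ} (hp : p ≤ 2 * n + k) :
    2 * tailCard T p + p ≤ 2 * n + k + 1 := by
  have h : Disjoint (T.1.filter (p ≤ ·)) ((T.1.filter (p ≤ ·)).image (· + 1)) := by
    rw [Finset.disjoint_left]
    simp only [Finset.mem_filter, Finset.mem_image]
    rintro _ ⟨hx, -⟩ ⟨y, ⟨hy, -⟩, rfl⟩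
    exact succ_notMem T hy hx
  have h2 : T.1.filter (p ≤ ·) ∪ (T.1.filter (p ≤ ·)).image (· + 1) ⊆
      Finset.Ico p (2 * n + k + 1) := by
    intro x
    simp only [Finset.mem_union, Finset.mem_filter, Finset.mem_image, Finset.mem_Ico]
    rintro (⟨hx, h⟩ | ⟨y, ⟨hy, h⟩, rfl⟩)
    · have := vert_lt T hx
      omega
    · have := vert_lt T hy
      omega
  have h3 := Finset.card_le_card h2
  rw [Finset.card_union_of_disjoint h, Finset.card_image_of_injective _ (add_left_injective 1),
    Nat.card_Ico] at h3
  unfold tailCard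
  omega

/-- Greedy enumeration of a set avoiding `T` with gaps `2` and `3`. -/
def greedy (T : SGVert n k) : ℕ → ℕ
  | 0 => 0
  | i + 1 => if greedy T i + 2 ∈ T.1 then greedy T i + 3 else greedy T i + 2

theorem greedy_spec {T : SGVert n k} (h0 : 0 ∉ T.1) {i : ℕ} (hi : i ≤ n) :
    greedy T i ∉ T.1 ∧ n ≤ tailCard T (greedy T i) + i ∧ greedy T i ≤ 2 * i + k := by
  induction i with
  | zero => exact ⟨h0, (tailCard_zero T).ge, Nat.zero_le _⟩
  | succ i ih =>
    obtain ⟨h1, h2, h3⟩ := ih (by omega)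
    have e0 := tailCard_succ T (greedy T i)
    have e1 := tailCard_succ T (greedy T i + 1)
    have e2 := tailCard_succ T (greedy T i + 1 + 1)
    rw [if_neg h1] at e0
    by_cases h : greedy T i + 2 ∈ T.1
    · rw [greedy, if_pos h]
      rw [if_neg fun h' => succ_notMem T h' h] at e1
      rw [if_pos h] at e2
      have h4 := two_mul_tailCard_le T (p := greedy T i + 2) (vert_lt T h).le
      exact ⟨succ_notMem T h, by simp only [add_assoc, Nat.reduceAdd] at *; omega,
        by simp only [add_assoc, Nat.reduceAdd] at *; omega⟩
    · rw [greedy, if_neg h]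
      refine ⟨h, ?_, by omega⟩
      simp only [add_assoc, Nat.reduceAdd] at *
      split_ifs at e1 <;> omega

theorem greedy_lt (T : SGVert n k) {i j : ℕ} (h : i < j) : greedy T i + 2 ≤ greedy T j := by
  induction j, h using Nat.le_induction with
  | base => rw [greedy]; split_ifs <;> omega
  | succ j _ ih => rw [greedy]; split_ifs <;> omega

/-- A stable set avoiding `0` is disjoint from a stable set with short gaps. -/
theorem exists_shortGaps_disjoint (hn : 1 ≤ n) (hk : 1 ≤ k) (T : SGVert n k) (h0 : 0 ∉ T.1) :
    ∃ S : SGVert n k, ShortGaps S ∧ Disjoint S.1 T.1 := by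
  have hinj : StrictMono (greedy T) := fun i j h => by have := greedy_lt T h; omega
  have hmem : ∀ p, p ∈ (Finset.range n).image (greedy T) ↔ ∃ i < n, greedy T i = p := by simp
  have hlt : ∀ i < n, greedy T i + 2 ≤ 2 * n + k := fun i hi => by
    have := (greedy_spec h0 hi.le).2.2
    omega
  refine ⟨⟨(Finset.range n).image (greedy T), ?_, ⟨?_, ?_⟩, ?_⟩, ⟨?_, ?_⟩, ?_⟩
  · rw [Finset.card_image_of_injective _ hinj.injective, Finset.card_range]
  · intro p hp
    obtain ⟨i, hi, rfl⟩ := (hmem p).1 hp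
    have := hlt i hi
    exact Finset.mem_range.2 (by omega)
  · intro p _
    rw [hmem, hmem]
    rintro ⟨⟨i, hi, rfl⟩, j, hj, hij⟩
    rcases lt_trichotomy i j with h | rfl | h
    · have := greedy_lt T h; omega
    · omega
    · have := hinj h; omega
  · rw [hmem, hmem]
    rintro ⟨-, j, hj, h⟩
    have := hlt j hj
    omega
  · exact (hmem 0).2 ⟨0, hn, rfl⟩
  · intro s hs t ht hst
    obtain ⟨i, hi, rfl⟩ := (hmem s).1 hs
    obtain ⟨j, hj, rfl⟩ := (hmem t).1 ht
    have hij : i < j := hinj.lt_iff_lt.1 hst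
    have h1 : greedy T (i + 1) = greedy T i + 2 ∨ greedy T (i + 1) = greedy T i + 3 := by
      rw [greedy]; split_ifs <;> simp
    exact h1.imp (fun h => (hmem _).2 ⟨i + 1, by omega, h⟩)
      fun h => (hmem _).2 ⟨i + 1, by omega, h⟩
  · rw [Finset.disjoint_left]
    intro p hp
    obtain ⟨i, hi, rfl⟩ := (hmem p).1 hp
    exact (greedy_spec h0 hi.le).1

end Greedy

/-- The `n`-subsets of `ℤ/m` without two cyclically consecutive elements. -/
abbrev CVert (n m : ℕ) : Type := {S : Finset (ZMod m) // S.card = n ∧ ∀ i ∈ S, i + 1 ∉ S}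

/-- The cyclic model of the stable Kneser graph. -/
def CG (n m : ℕ) : SimpleGraph (CVert n m) := SimpleGraph.fromRel (fun S T => Disjoint S.1 T.1)

theorem CG_adj {n m : ℕ} (hn : 1 ≤ n) {S T : CVert n m} : (CG n m).Adj S T ↔ Disjoint S.1 T.1 := by
  rw [CG, SimpleGraph.fromRel_adj, disjoint_comm (a := T.1), or_self, and_iff_right_iff_imp]
  rintro h rfl
  have h1 := S.2.1
  rw [disjoint_self.1 h, Finset.bot_eq_empty, Finset.card_empty] at h1
  omega

section Symmetries
variable {n m : ℕ}

/-- Rotation of a set by `a`. -/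
def rotateVert (a : ZMod m) (S : CVert n m) : CVert n m :=
  ⟨S.1.map (Equiv.addRight a).toEmbedding, by rw [Finset.card_map, S.2.1], by
    intro i hi hi'
    simp only [Finset.mem_map_equiv, Equiv.addRight_symm, Equiv.coe_addRight] at hi hi'
    exact S.2.2 _ hi (by convert hi' using 1; ring)⟩

@[simp] theorem mem_rotateVert {a x : ZMod m} {S : CVert n m} :
    x ∈ (rotateVert a S).1 ↔ x - a ∈ S.1 := by
  simp [rotateVert, sub_eq_add_neg]

/-- The reflection `x ↦ -x` of a set. -/
def reflectVert (S : CVert n m) : CVert n m :=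
  ⟨S.1.map (Equiv.neg _).toEmbedding, by rw [Finset.card_map, S.2.1], by
    intro i hi hi'
    simp only [Finset.mem_map_equiv, Equiv.neg_symm, Equiv.neg_apply] at hi hi'
    exact S.2.2 _ hi' (by convert hi using 1; ring)⟩

@[simp] theorem mem_reflectVert {x : ZMod m} {S : CVert n m} :
    x ∈ (reflectVert S).1 ↔ -x ∈ S.1 := by
  simp [reflectVert]

theorem CG_iso_of_map {e : CVert n m ≃ CVert n m} (f : ZMod m ≃ ZMod m)
    (h : ∀ S : CVert n m, ∀ x, x ∈ (e S).1 ↔ f x ∈ S.1) {S T : CVert n m} :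
    (CG n m).Adj (e S) (e T) ↔ (CG n m).Adj S T := by
  have : ∀ S T : CVert n m, Disjoint (e S).1 (e T).1 ↔ Disjoint S.1 T.1 := by
    intro S T
    simp only [Finset.disjoint_left, h]
    exact ⟨fun H x hx => by simpa using H (a := f.symm x) (by simpa using hx), fun H x hx => H hx⟩
  simp only [CG, SimpleGraph.fromRel_adj, this, ne_eq, e.injective.eq_iff]

/-- Rotations are automorphisms. -/
def rotate (n : ℕ) {m : ℕ} (a : ZMod m) : CG n m ≃g CG n m where
  toFun := rotateVert a
  invFun := rotateVert (-a)
  left_inv S := by ext x; simp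
  right_inv S := by ext x; simp
  map_rel_iff' := CG_iso_of_map (Equiv.subRight a) (e := ⟨rotateVert a, rotateVert (-a),
    fun S => by ext x; simp, fun S => by ext x; simp⟩) fun S x => mem_rotateVert

/-- The reflection as an automorphism. -/
def reflect (n m : ℕ) : CG n m ≃g CG n m where
  toFun := reflectVert
  invFun := reflectVert
  left_inv S := by ext x; simp
  right_inv S := by ext x; simp
  map_rel_iff' := CG_iso_of_map (Equiv.neg _) (e := ⟨reflectVert, reflectVert,
    fun S => by ext x; simp, fun S => by ext x; simp⟩) fun S x => mem_reflectVert

@[simp] theorem mem_rotate {a x : ZMod m} {S : CVert n m} :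
    x ∈ (rotate n a S).1 ↔ x - a ∈ S.1 := mem_rotateVert

@[simp] theorem mem_reflect {x : ZMod m} {S : CVert n m} :
    x ∈ (reflect n m S).1 ↔ -x ∈ S.1 := mem_reflectVert

end Symmetries

section Model
variable {n k : ℕ} [NeZero (2 * n + k)]

omit [NeZero (2 * n + k)] in
theorem natCast_mem_image {S : Finset ℕ} (hS : S ⊆ Finset.range (2 * n + k)) {p : ℕ}
    (hp : p < 2 * n + k) :
    (p : ZMod (2 * n + k)) ∈ S.image (Nat.cast : ℕ → ZMod (2 * n + k)) ↔ p ∈ S := by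
  rw [Finset.mem_image]
  refine ⟨?_, fun h => ⟨p, h, rfl⟩⟩
  rintro ⟨q, hq, h⟩
  have h1 := congrArg ZMod.val h
  rw [ZMod.val_natCast_of_lt hp, ZMod.val_natCast_of_lt (Finset.mem_range.1 (hS hq))] at h1
  exact h1 ▸ hq

theorem mem_image_natCast {S : Finset ℕ} (hS : S ⊆ Finset.range (2 * n + k))
    {x : ZMod (2 * n + k)} :
    x ∈ S.image (Nat.cast : ℕ → ZMod (2 * n + k)) ↔ x.val ∈ S := by
  rw [← natCast_mem_image hS (ZMod.val_lt x), ZMod.natCast_zmod_val]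

theorem val_add_one' {m : ℕ} [NeZero m] (x : ZMod m) :
    (x + 1).val = if x.val + 1 = m then 0 else x.val + 1 := by
  have h := ZMod.val_lt x
  have h1 : x + 1 = ((x.val + 1 : ℕ) : ZMod m) := by push_cast; rw [ZMod.natCast_zmod_val]
  split_ifs with h2
  · rw [h1, h2, ZMod.natCast_self, ZMod.val_zero]
  · rw [h1, ZMod.val_natCast_of_lt (by omega)]

/-- The cyclic model of a stable set. -/
def toCVert (S : SGVert n k) : CVert n (2 * n + k) :=
  ⟨S.1.image Nat.cast, by
    rw [Finset.card_image_of_injOn, S.2.1]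
    intro p hp q hq h
    have h1 := congrArg ZMod.val h
    rwa [ZMod.val_natCast_of_lt (Finset.mem_range.1 (S.2.2.1.1 hp)),
      ZMod.val_natCast_of_lt (Finset.mem_range.1 (S.2.2.1.1 hq))] at h1, by
    intro x hx hx'
    rw [mem_image_natCast S.2.2.1.1] at hx hx'
    rw [val_add_one'] at hx'
    split_ifs at hx' with h
    · exact S.2.2.2 ⟨hx', by rwa [show 2 * n + k - 1 = x.val by omega]⟩
    · exact succ_notMem S hx hx'⟩

theorem mem_toCVert {S : SGVert n k} {x : ZMod (2 * n + k)} : x ∈ (toCVert S).1 ↔ x.val ∈ S.1 :=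
  mem_image_natCast S.2.2.1.1

/-- The stable set described by its cyclic model. -/
def ofCVert (S : CVert n (2 * n + k)) : SGVert n k :=
  ⟨S.1.image ZMod.val, by
    have hmem : ∀ p < 2 * n + k, p ∈ S.1.image ZMod.val ↔ (p : ZMod (2 * n + k)) ∈ S.1 := by
      intro p hp
      rw [Finset.mem_image]
      refine ⟨?_, fun h => ⟨_, h, ZMod.val_natCast_of_lt hp⟩⟩
      rintro ⟨x, hx, rfl⟩
      rwa [ZMod.natCast_zmod_val]
    have hsub : S.1.image ZMod.val ⊆ Finset.range (2 * n + k) := by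
      intro p hp
      obtain ⟨x, -, rfl⟩ := Finset.mem_image.1 hp
      exact Finset.mem_range.2 (ZMod.val_lt x)
    refine ⟨by rw [Finset.card_image_of_injective _ (ZMod.val_injective _), S.2.1],
      ⟨hsub, fun i hi h => ?_⟩, fun h => ?_⟩
    · rw [hmem _ hi, hmem _ (by omega), Nat.cast_add, Nat.cast_one] at h
      exact S.2.2 _ h.1 h.2
    · have h0 : 0 < 2 * n + k := Nat.pos_of_ne_zero (NeZero.ne _)
      rw [hmem _ h0, hmem _ (by omega)] at h
      refine S.2.2 _ h.2 ?_
      rw [← Nat.cast_add_one, Nat.sub_add_cancel h0, ZMod.natCast_self]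
      simpa using h.1⟩

theorem mem_ofCVert {S : CVert n (2 * n + k)} {p : ℕ} (hp : p < 2 * n + k) :
    p ∈ (ofCVert S).1 ↔ (p : ZMod (2 * n + k)) ∈ S.1 := by
  rw [ofCVert, Finset.mem_image]
  refine ⟨?_, fun h => ⟨_, h, ZMod.val_natCast_of_lt hp⟩⟩
  rintro ⟨x, hx, rfl⟩
  rwa [ZMod.natCast_zmod_val]

theorem natCast_mem_toCVert {S : SGVert n k} {p : ℕ} (hp : p < 2 * n + k) :
    (p : ZMod (2 * n + k)) ∈ (toCVert S).1 ↔ p ∈ S.1 := by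
  rw [mem_toCVert, ZMod.val_natCast_of_lt hp]

/-- Stable sets and their cyclic models. -/
def cvertEquiv (n k : ℕ) [NeZero (2 * n + k)] : SGVert n k ≃ CVert n (2 * n + k) where
  toFun := toCVert
  invFun := ofCVert
  left_inv S := by
    refine Subtype.ext (Finset.ext fun p => ?_)
    by_cases hp : p < 2 * n + k
    · rw [mem_ofCVert hp, natCast_mem_toCVert hp]
    · exact iff_of_false (fun h => hp (vert_lt _ h)) fun h => hp (vert_lt _ h)
  right_inv S := by
    refine Subtype.ext (Finset.ext fun x => ?_)
    rw [mem_toCVert, mem_ofCVert (ZMod.val_lt x), ZMod.natCast_zmod_val]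

theorem disjoint_toCVert {S T : SGVert n k} :
    Disjoint (toCVert S).1 (toCVert T).1 ↔ Disjoint S.1 T.1 := by
  simp only [Finset.disjoint_left, mem_toCVert]
  refine ⟨fun h p hp => ?_, fun h x => @h _⟩
  have := @h (p : ZMod (2 * n + k))
  rw [ZMod.val_natCast_of_lt (vert_lt S hp)] at this
  exact this hp

/-- The stable Kneser graph is isomorphic to its cyclic model. -/
def toCG (n k : ℕ) [NeZero (2 * n + k)] : SG n k ≃g CG n (2 * n + k) where
  toEquiv := cvertEquiv n k
  map_rel_iff' {S T} := by
    have : ∀ S T : SGVert n k, Disjoint (cvertEquiv n k S).1 (cvertEquiv n k T).1 ↔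
      Disjoint S.1 T.1 := fun S T => disjoint_toCVert
    simp only [SG, CG, SimpleGraph.fromRel_adj, this, ne_eq, (cvertEquiv n k).injective.eq_iff]

theorem mem_toCG {S : SGVert n k} {x : ZMod (2 * n + k)} : x ∈ (toCG n k S).1 ↔ x.val ∈ S.1 :=
  mem_toCVert

theorem natCast_mem_toCG {S : SGVert n k} {p : ℕ} (hp : p < 2 * n + k) :
    (p : ZMod (2 * n + k)) ∈ (toCG n k S).1 ↔ p ∈ S.1 := natCast_mem_toCVert hp

theorem mem_toCG_symm {S : CVert n (2 * n + k)} {p : ℕ} (hp : p < 2 * n + k) :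
    p ∈ ((toCG n k).symm S).1 ↔ (p : ZMod (2 * n + k)) ∈ S.1 := mem_ofCVert hp

end Model

section Endomorphisms
variable {n k : ℕ} [NeZero (2 * n + k)]

/-- Every point outside a stable set `T` lies in a stable set disjoint from `T` that is in the
image of all endomorphisms. -/
theorem exists_critical_disjoint (hn : 1 ≤ n) (hk : 1 ≤ k) (T : CVert n (2 * n + k))
    {x : ZMod (2 * n + k)} (hx : x ∉ T.1) : ∃ F : CVert n (2 * n + k), x ∈ F.1 ∧
      Disjoint F.1 T.1 ∧ ∀ φ : CG n (2 * n + k) →g CG n (2 * n + k), ∃ R, φ R = F := by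
  have hpos : 0 < 2 * n + k := by omega
  have hT0 : 0 ∉ ((toCG n k).symm (rotate n (-x) T)).1 := by
    rw [mem_toCG_symm hpos]
    simpa using hx
  obtain ⟨S, hS, hd⟩ := exists_shortGaps_disjoint hn hk _ hT0
  refine ⟨rotate n x (toCG n k S), ?_, ?_, ?_⟩
  · rw [mem_rotate, sub_self, mem_toCG, ZMod.val_zero]
    exact hS.zero_mem
  · rw [← SG_adj hn, ← (toCG n k).map_adj_iff, ← (rotate n x).map_adj_iff, CG_adj hn] at hd
    convert hd using 2
    ext y
    simp
  · intro φ
    obtain ⟨R, hR⟩ := hS.mem_range hn hk (((toCG n k).symm.toHom.comp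
      (rotate n (-x)).toHom).comp (φ.comp (toCG n k).toHom))
    refine ⟨toCG n k R, ?_⟩
    rw [← hR]
    ext y
    simp

theorem hom_iterate_adj {V : Type*} {G : SimpleGraph V} (φ : G →g G) (r : ℕ) {u v : V}
    (h : G.Adj u v) : G.Adj (φ^[r] u) (φ^[r] v) := by
  induction r with
  | zero => exact h
  | succ r ih => simp only [Function.iterate_succ_apply']; exact φ.map_rel ih

/-- Some power of a self-map of a finite set is idempotent. -/
theorem exists_iterate_idempotent {α : Type*} [Finite α] (φ : α → α) :
    ∃ N, ∀ x, φ^[N + 1] (φ^[N + 1] x) = φ^[N + 1] x := by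
  obtain ⟨i, j, hij, h⟩ := Finite.exists_ne_map_eq_of_infinite (fun i : ℕ => φ^[i])
  wlog hlt : i < j generalizing i j
  · exact this j i hij.symm h.symm (by omega)
  have hper : ∀ p r, i ≤ p → φ^[p + r * (j - i)] = φ^[p] := by
    intro p r hp
    induction r with
    | zero => simp
    | succ r ih =>
      have e1 : p + (r + 1) * (j - i) = (p - i + r * (j - i)) + j := by
        have : (r + 1) * (j - i) = r * (j - i) + (j - i) := by ring
        omega
      have e2 : p + r * (j - i) = (p - i + r * (j - i)) + i := by omega
      rw [e1, Function.iterate_add, ← h, ← Function.iterate_add, ← e2, ih]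
  have hpos : 0 < (i + 1) * (j - i) := Nat.mul_pos (by omega) (by omega)
  refine ⟨(i + 1) * (j - i) - 1, fun x => ?_⟩
  rw [Nat.sub_add_cancel hpos, ← Function.iterate_add_apply,
    hper _ _ (by nlinarith [Nat.sub_pos_of_lt hlt])]

/-- Every endomorphism is an automorphism. -/
theorem exists_iso_of_endo (hn : 1 ≤ n) (hk : 1 ≤ k)
    (φ : CG n (2 * n + k) →g CG n (2 * n + k)) :
    ∃ α : CG n (2 * n + k) ≃g CG n (2 * n + k), ∀ S, α S = φ S := by
  obtain ⟨N, hidem⟩ := exists_iterate_idempotent φ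
  let ψ : CG n (2 * n + k) →g CG n (2 * n + k) := ⟨φ^[N + 1], hom_iterate_adj φ (N + 1)⟩
  have hψ : ∀ T, φ^[N + 1] T = T := by
    intro T
    refine Subtype.ext (Finset.eq_of_subset_of_card_le ?_ (by rw [T.2.1, Subtype.prop (φ^[N + 1] T) |>.1]))
    intro x hx
    by_contra hxT
    obtain ⟨F, hxF, hd, hF⟩ := exists_critical_disjoint hn hk T hxT
    obtain ⟨R, hR⟩ := hF ψ
    have hfix : ψ F = F := by rw [← hR]; exact hidem R
    have h := ψ.map_rel ((CG_adj hn).2 hd)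
    rw [hfix, CG_adj hn] at h
    exact Finset.disjoint_left.1 h hxF hx
  refine ⟨⟨⟨φ, φ^[N], fun S => ?_, fun S => ?_⟩, fun {S T} => ⟨fun h => ?_, fun h => φ.map_rel h⟩⟩,
    fun S => rfl⟩
  · rw [← Function.iterate_succ_apply, hψ]
  · rw [← Function.iterate_succ_apply' (f := φ), hψ]
  · have h1 := hom_iterate_adj φ N h
    simp only [Equiv.coe_fn_mk, ← Function.iterate_succ_apply] at h1
    rwa [hψ, hψ] at h1

end Endomorphisms

section Avoiding
variable {n k : ℕ}

theorem exists_disjoint_avoiding_zero (hn : 1 ≤ n) (S : SGVert n k) (h0 : 0 ∉ S.1) {x : ℕ}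
    (hx0 : x ≠ 0) (hx : ∀ s ∈ S.1, s + 1 = x → s + 2 ∉ S.1) :
    ∃ F : SGVert n k, 0 ∈ F.1 ∧ x ∉ F.1 ∧ Disjoint F.1 S.1 := by
  have hne : S.1.Nonempty := Finset.card_pos.1 (by rw [S.2.1]; exact hn)
  obtain ⟨M, hM, hmax⟩ := S.1.exists_max_image id hne
  simp only [id] at hmax
  let p : ℕ → ℕ := fun s => if s + 1 = x then s + 2 else s + 1
  have hp : ∀ s, (s + 1 = x ∧ p s = s + 2) ∨ (s + 1 ≠ x ∧ p s = s + 1) := by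
    intro s
    by_cases h : s + 1 = x <;> simp [p, h]
  have hsep : ∀ s ∈ S.1, ∀ t ∈ S.1, s < t → p s + 2 ≤ p t ∧ p s < t := by
    intro s hs t ht hst
    have h1 : t ≠ s + 1 := fun h => succ_notMem S hs (h ▸ ht)
    have h2 : s + 1 = x → t ≠ s + 2 := fun h h' => hx s hs h (h' ▸ ht)
    rcases hp s with h | h <;> rcases hp t with h' | h' <;> omega
  have hpos : ∀ s ∈ S.1, 1 ≤ s := fun s hs => Nat.one_le_iff_ne_zero.2 fun h => h0 (h ▸ hs)
  have hML := vert_lt S hM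
  have hlt : ∀ s ∈ S.1.erase M, p s < M := fun s hs =>
    (hsep s (Finset.mem_of_mem_erase hs) M hM
      (lt_of_le_of_ne (hmax s (Finset.mem_of_mem_erase hs)) (Finset.ne_of_mem_erase hs))).2
  have hge : ∀ s ∈ S.1.erase M, 2 ≤ p s := fun s hs => by
    have := hpos s (Finset.mem_of_mem_erase hs)
    rcases hp s with h | h <;> omega
  have hinj : Set.InjOn p (S.1.erase M : Finset ℕ) := by
    intro s hs t ht hst
    have hs := Finset.mem_of_mem_erase hs
    have ht := Finset.mem_of_mem_erase ht
    rcases lt_trichotomy s t with h | h | h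
    · have := (hsep s hs t ht h).1; omega
    · exact h
    · have := (hsep t ht s hs h).1; omega
  have hnot : 0 ∉ (S.1.erase M).image p := by
    intro h
    obtain ⟨s, hs, h⟩ := Finset.mem_image.1 h
    have := hge s hs
    omega
  refine ⟨⟨insert 0 ((S.1.erase M).image p), ?_, ⟨?_, ?_⟩, ?_⟩, Finset.mem_insert_self _ _,
    ?_, ?_⟩
  · rw [Finset.card_insert_of_notMem hnot, Finset.card_image_of_injOn hinj,
      Finset.card_erase_of_mem hM, S.2.1]
    omega
  · intro q hq
    rw [Finset.mem_range]
    rcases Finset.mem_insert.1 hq with rfl | hq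
    · omega
    · obtain ⟨s, hs, rfl⟩ := Finset.mem_image.1 hq
      have := hlt s hs
      omega
  · intro i _
    simp only [Finset.mem_insert, Finset.mem_image]
    rintro ⟨rfl | ⟨s, hs, rfl⟩, h | ⟨t, ht, h⟩⟩
    · omega
    · have := hge t ht; omega
    · omega
    · rcases lt_trichotomy s t with hst | rfl | hst
      · have := (hsep s (Finset.mem_of_mem_erase hs) t (Finset.mem_of_mem_erase ht) hst).1; omega
      · omega
      · have := (hsep t (Finset.mem_of_mem_erase ht) s (Finset.mem_of_mem_erase hs) hst).1; omega
  · simp only [Finset.mem_insert, Finset.mem_image]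
    rintro ⟨-, h | ⟨t, ht, h⟩⟩
    · omega
    · have := hlt t ht; omega
  · simp only [Finset.mem_insert, Finset.mem_image]
    rintro (h | ⟨t, ht, h⟩)
    · exact hx0 h
    · rcases hp t with h' | h' <;> omega
  · rw [Finset.disjoint_left]
    simp only [Finset.mem_insert, Finset.mem_image]
    rintro q (rfl | ⟨t, ht, rfl⟩)
    · exact h0
    · have ht := Finset.mem_of_mem_erase ht
      rcases hp t with h' | h'
      · rw [h'.2]; exact hx t ht h'.1
      · rw [h'.2]; exact succ_notMem S ht

/-- The points outside `S` that are not surrounded by `S`. -/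
def Loose {m : ℕ} (S : CVert n m) (x : ZMod m) : Prop := x ∉ S.1 ∧ ¬ (x - 1 ∈ S.1 ∧ x + 1 ∈ S.1)

/-- There are sets disjoint from `S` that separate any point from any given loose point. -/
theorem Loose.exists_disjoint_avoiding [NeZero (2 * n + k)] (hn : 1 ≤ n)
    {S : CVert n (2 * n + k)} {x r : ZMod (2 * n + k)} (hx : Loose S x) (hr : r ∉ S.1)
    (hrx : r ≠ x) : ∃ F : CVert n (2 * n + k), r ∈ F.1 ∧ x ∉ F.1 ∧ (CG n (2 * n + k)).Adj F S := by
  have hpos : 0 < 2 * n + k := by omega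
  let S' := (toCG n k).symm (rotate n (-r) S)
  have hS' : toCG n k S' = rotate n (-r) S := (toCG n k).apply_symm_apply _
  have mem : ∀ p < 2 * n + k, p ∈ S'.1 ↔ (p : ZMod (2 * n + k)) + r ∈ S.1 := by
    intro p hp
    rw [mem_toCG_symm hp, mem_rotate, sub_neg_eq_add]
  obtain ⟨F, hF0, hFx, hd⟩ := exists_disjoint_avoiding_zero hn S' (x := (x - r).val)
    (by rw [mem 0 hpos]; simpa using hr)
    (by rw [ne_eq, ZMod.val_eq_zero, sub_eq_zero]; exact hrx.symm) (by
      intro s hs hsx h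
      have h1 : (s : ZMod (2 * n + k)) + 1 = x - r := by
        rw [← Nat.cast_add_one, hsx, ZMod.natCast_zmod_val]
      rw [mem s (vert_lt _ hs)] at hs
      rw [mem _ (vert_lt _ h)] at h
      refine hx.2 ⟨?_, ?_⟩
      · convert hs using 1
        rw [eq_sub_of_add_eq h1]; ring
      · convert h using 1
        push_cast
        rw [eq_sub_of_add_eq h1]; ring)
  refine ⟨rotate n r (toCG n k F), ?_, ?_, ?_⟩
  · rw [mem_rotate, sub_self, mem_toCG, ZMod.val_zero]
    exact hF0
  · rw [mem_rotate, mem_toCG]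
    exact hFx
  · rw [← SG_adj hn, ← (toCG n k).map_adj_iff, hS', ← (rotate n r).map_adj_iff] at hd
    convert hd using 1
    ext y
    simp

end Avoiding

section Near
variable {n m : ℕ}

/-- Two sets are near if they differ by the exchange of one element. -/
def Near (S R : CVert n m) : Prop := (S.1 \ R.1).card = 1

theorem Near.symm {S R : CVert n m} (h : Near S R) : Near R S := by
  rw [Near, ← h]
  exact Finset.card_sdiff_comm (by rw [S.2.1, R.2.1])

theorem Near.exists_exchange {S R : CVert n m} (h : Near S R) :
    ∃ s ∈ S.1, ∃ x ∉ S.1, ∀ y, y ∈ R.1 ↔ (y ∈ S.1 ∧ y ≠ s) ∨ y = x := by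
  obtain ⟨s, hs⟩ := Finset.card_eq_one.1 h
  obtain ⟨x, hx⟩ := Finset.card_eq_one.1 h.symm
  simp only [Finset.ext_iff, Finset.mem_sdiff, Finset.mem_singleton] at hs hx
  have h1 := (hs s).2 rfl
  have h2 := (hx x).2 rfl
  refine ⟨s, h1.1, x, h2.2, fun y => ?_⟩
  have h3 := hs y
  have h4 := hx y
  tauto

theorem near_of_exchange {S R : CVert n m} {s x : ZMod m} (hs : s ∈ S.1) (hx : x ∉ S.1)
    (h : ∀ y, y ∈ R.1 ↔ (y ∈ S.1 ∧ y ≠ s) ∨ y = x) : Near S R := by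
  rw [Near, Finset.card_eq_one]
  refine ⟨s, Finset.ext fun y => ?_⟩
  rw [Finset.mem_sdiff, h, Finset.mem_singleton]
  constructor
  · tauto
  · rintro rfl
    refine ⟨hs, ?_⟩
    rintro (h | rfl)
    · exact h.2 rfl
    · exact hx hs

theorem loose_of_exchange {S R : CVert n m} {s x : ZMod m} (hx : x ∉ S.1)
    (h : ∀ y, y ∈ R.1 ↔ (y ∈ S.1 ∧ y ≠ s) ∨ y = x) (hm : (2 : ZMod m) ≠ 0) : Loose S x := by
  refine ⟨hx, fun ⟨h1, h2⟩ => ?_⟩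
  have hxR : x ∈ R.1 := (h x).2 (Or.inr rfl)
  by_cases h3 : x - 1 = s
  · refine R.2.2 x hxR ((h _).2 (Or.inl ⟨h2, fun h4 => hm ?_⟩))
    linear_combination h4 - h3
  · exact R.2.2 (x - 1) ((h _).2 (Or.inl ⟨h1, h3⟩)) (by rwa [sub_add_cancel])

theorem Loose.exists_exchange (hn : 1 ≤ n) {S : CVert n m} {x : ZMod m} (hx : Loose S x)
    (hm : (1 : ZMod m) ≠ 0) : ∃ R : CVert n m, ∃ s ∈ S.1, ∀ y, y ∈ R.1 ↔ (y ∈ S.1 ∧ y ≠ s) ∨ y = x := by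
  classical
  obtain ⟨s, hs, h1⟩ : ∃ s ∈ S.1, ∀ y ∈ S.1, (y = x - 1 ∨ y = x + 1) → y = s := by
    have hne : S.1.Nonempty := Finset.card_pos.1 (by rw [S.2.1]; exact hn)
    obtain ⟨t, ht⟩ := hne
    by_cases h1 : x - 1 ∈ S.1
    · refine ⟨_, h1, ?_⟩
      rintro y hy (h | rfl)
      · exact h
      · exact absurd ⟨h1, hy⟩ hx.2
    · by_cases h2 : x + 1 ∈ S.1
      · refine ⟨_, h2, ?_⟩
        rintro y hy (rfl | h)
        · exact absurd hy h1
        · exact h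
      · refine ⟨t, ht, ?_⟩
        rintro y hy (rfl | rfl)
        · exact absurd hy h1
        · exact absurd hy h2
  have hx' : x ∉ S.1.erase s := fun h => hx.1 (Finset.mem_of_mem_erase h)
  refine ⟨⟨insert x (S.1.erase s), ?_, ?_⟩, s, hs, fun y => ?_⟩
  · rw [Finset.card_insert_of_notMem hx', Finset.card_erase_of_mem hs, S.2.1]
    omega
  · intro i hi hi'
    simp only [Finset.mem_insert, Finset.mem_erase] at hi hi'
    rcases hi with rfl | hi <;> rcases hi' with hi' | hi'
    · exact hm (by linear_combination hi')
    · exact hi'.1 (h1 _ hi'.2 (Or.inr rfl))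
    · exact hi.1 (h1 _ hi.2 (Or.inl (by linear_combination hi')))
    · exact S.2.2 _ hi.2 hi'.2
  · simp only [Finset.mem_insert, Finset.mem_erase]
    tauto

theorem mem_of_add_two_closed (hm : Odd m) {A : Set (ZMod m)} (hA : ∀ x ∈ A, x + 2 ∈ A)
    {x : ZMod m} (hx : x ∈ A) (y : ZMod m) : y ∈ A := by
  have h1 : ∀ j : ℕ, x + 2 * j ∈ A := by
    intro j
    induction j with
    | zero => simpa using hx
    | succ j ih => convert hA _ ih using 1; push_cast; ring
  obtain ⟨t, ht⟩ := hm
  have : NeZero m := ⟨by omega⟩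
  convert h1 ((y - x).val * (t + 1)) using 1
  have h2 : (2 * t + 1 : ZMod m) = 0 := by
    have := ZMod.natCast_self m
    rw [ht] at this ⊢
    exact_mod_cast this
  push_cast
  rw [ZMod.natCast_zmod_val]
  linear_combination (-(y - x)) * h2

theorem exists_loose (hm : Odd m) {S R : CVert n m} (h : R ≠ S) : ∃ x ∈ R.1, Loose S x := by
  by_contra! hc
  have hcard : (R.1 \ S.1).card = (S.1 \ R.1).card := Finset.card_sdiff_comm (by rw [S.2.1, R.2.1])
  have h1 : ∀ x ∈ R.1 \ S.1, x - 1 ∈ S.1 ∧ x + 1 ∈ S.1 := by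
    intro x hx
    rw [Finset.mem_sdiff] at hx
    by_contra h'
    exact hc x hx.1 ⟨hx.2, h'⟩
  have h2 : ∀ x ∈ R.1 \ S.1, x - 1 ∈ S.1 \ R.1 := fun x hx =>
    Finset.mem_sdiff.2 ⟨(h1 x hx).1, fun h' => R.2.2 _ h' (by
      rw [sub_add_cancel]; exact (Finset.mem_sdiff.1 hx).1)⟩
  have h3 : ∀ x ∈ R.1 \ S.1, x + 1 ∈ S.1 \ R.1 := fun x hx =>
    Finset.mem_sdiff.2 ⟨(h1 x hx).2, R.2.2 _ (Finset.mem_sdiff.1 hx).1⟩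
  have hne : (R.1 \ S.1).Nonempty := by
    rw [Finset.sdiff_nonempty]
    intro hsub
    exact h (Subtype.ext (Finset.eq_of_subset_of_card_le hsub (by rw [S.2.1, R.2.1])))
  obtain ⟨x, hx⟩ := hne
  have hsurj := Finset.surj_on_of_inj_on_of_card_le (s := R.1 \ S.1) (t := S.1 \ R.1)
    (fun a _ => a - 1) (fun a ha => h2 a ha) (fun a b _ _ hab => by simpa using hab) hcard.ge
  have h4 : ∀ x ∈ ((R.1 \ S.1 : Finset _) : Set (ZMod m)), x + 2 ∈ ((R.1 \ S.1 : Finset _) : Set _) := by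
    intro x hx
    obtain ⟨a, ha, hax⟩ := hsurj _ (h3 x hx)
    convert Finset.mem_coe.2 ha using 1
    linear_combination hax
  have h5 := mem_of_add_two_closed hm h4 hx (x + 1)
  exact (Finset.mem_sdiff.1 (h3 x hx)).2 (Finset.mem_sdiff.1 h5).1

end Near

section NearGraph
variable {n k : ℕ}

theorem one_ne_zero_two_ne_zero {m : ℕ} (h3 : 3 ≤ m) : (1 : ZMod m) ≠ 0 ∧ (2 : ZMod m) ≠ 0 := by
  constructor
  · have := (ZMod.natCast_eq_zero_iff 1 m).not.2 (Nat.not_dvd_of_pos_of_lt one_pos (by omega))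
    exact_mod_cast this
  · have := (ZMod.natCast_eq_zero_iff 2 m).not.2 (Nat.not_dvd_of_pos_of_lt two_pos (by omega))
    exact_mod_cast this

theorem adj_exchange_iff {m : ℕ} (hn : 1 ≤ n) {S R F : CVert n m} {s x : ZMod m}
    (h : ∀ y, y ∈ R.1 ↔ (y ∈ S.1 ∧ y ≠ s) ∨ y = x) (hF : (CG n m).Adj F S) :
    (CG n m).Adj F R ↔ x ∉ F.1 := by
  rw [CG_adj hn, Finset.disjoint_left] at *
  refine ⟨fun H hx => H hx ((h x).2 (Or.inr rfl)), fun H y hy hyR => ?_⟩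
  rcases (h y).1 hyR with h1 | rfl
  · exact hF hy h1.1
  · exact H hy

/-- Nearness is a graph-theoretic property. -/
theorem near_iff [NeZero (2 * n + k)] (hn : 1 ≤ n) (hk : Odd k) {S R : CVert n (2 * n + k)} :
    Near S R ↔ R ≠ S ∧ ∀ R', R' ≠ S →
      (∀ F, (CG n (2 * n + k)).Adj F S → (CG n (2 * n + k)).Adj F R → (CG n (2 * n + k)).Adj F R') →
      ∀ F, (CG n (2 * n + k)).Adj F S → (CG n (2 * n + k)).Adj F R' →
        (CG n (2 * n + k)).Adj F R := by
  have hm : Odd (2 * n + k) := by obtain ⟨t, rfl⟩ := hk; exact ⟨n + t, by ring⟩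
  obtain ⟨h1, h2⟩ := one_ne_zero_two_ne_zero (m := 2 * n + k) (by obtain ⟨t, rfl⟩ := hk; omega)
  constructor
  · intro h
    obtain ⟨s, hs, x, hx, hR⟩ := h.exists_exchange
    have hloose := loose_of_exchange hx hR h2
    refine ⟨fun h' => hx (h' ▸ (hR x).2 (Or.inr rfl)), fun R' hR' hsub F hFS hFR' => ?_⟩
    rw [adj_exchange_iff hn hR hFS]
    obtain ⟨y, hyR', hy⟩ := exists_loose hm hR'
    have hyx : y = x := by
      by_contra hyx
      obtain ⟨F', h3, h4, h5⟩ := hloose.exists_disjoint_avoiding hn hy.1 hyx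
      have h6 := hsub F' h5 ((adj_exchange_iff hn hR h5).2 h4)
      exact Finset.disjoint_left.1 ((CG_adj hn).1 h6) h3 hyR'
    intro hxF
    exact Finset.disjoint_left.1 ((CG_adj hn).1 hFR') hxF (hyx ▸ hyR')
  · rintro ⟨hne, hmax⟩
    obtain ⟨x, hxR, hx⟩ := exists_loose hm hne
    obtain ⟨R', s, hs, hR'⟩ := hx.exists_exchange hn h1
    have hR'S : R' ≠ S := fun h => hx.1 (h ▸ (hR' x).2 (Or.inr rfl))
    have h3 := hmax R' hR'S fun F hFS hFR => (adj_exchange_iff hn hR' hFS).2 fun hxF =>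
      Finset.disjoint_left.1 ((CG_adj hn).1 hFR) hxF hxR
    refine Near.symm (Finset.card_eq_one.2 ⟨x, Finset.ext fun y => ?_⟩)
    rw [Finset.mem_sdiff, Finset.mem_singleton]
    refine ⟨fun ⟨hyR, hyS⟩ => ?_, fun h => h ▸ ⟨hxR, hx.1⟩⟩
    by_contra hyx
    obtain ⟨F, h4, h5, h6⟩ := hx.exists_disjoint_avoiding hn hyS hyx
    exact Finset.disjoint_left.1 ((CG_adj hn).1 (h3 F h6 ((adj_exchange_iff hn hR' h6).2 h5))) h4 hyR

theorem Near.map [NeZero (2 * n + k)] (hn : 1 ≤ n) (hk : Odd k)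
    (α : CG n (2 * n + k) ≃g CG n (2 * n + k)) {S R : CVert n (2 * n + k)} (h : Near S R) :
    Near (α S) (α R) := by
  rw [near_iff hn hk] at *
  refine ⟨α.injective.ne h.1, fun R' hR' H F hFS hFR' => ?_⟩
  have hF : α (α.symm F) = F := α.apply_symm_apply F
  have hR'' : α (α.symm R') = R' := α.apply_symm_apply R'
  rw [← hF, α.map_adj_iff] at hFS ⊢
  rw [← hF, ← hR'', α.map_adj_iff] at hFR'
  refine h.2 _ (fun h' => hR' (by rw [← hR'', h'])) (fun F' h1 h2 => ?_) _ hFS hFR'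
  have h3 := H (α F') (α.map_adj_iff.2 h1) (α.map_adj_iff.2 h2)
  rwa [← hR'', α.map_adj_iff] at h3

open Classical in
theorem card_loose_le [NeZero (2 * n + k)] (hn : 1 ≤ n) (hk : Odd k)
    (α : CG n (2 * n + k) ≃g CG n (2 * n + k)) (S : CVert n (2 * n + k)) :
    (Finset.univ.filter (Loose S)).card ≤ (Finset.univ.filter (Loose (α S))).card := by
  have hm : Odd (2 * n + k) := by obtain ⟨t, rfl⟩ := hk; exact ⟨n + t, by ring⟩
  obtain ⟨h1, h2⟩ := one_ne_zero_two_ne_zero (m := 2 * n + k) (by obtain ⟨t, rfl⟩ := hk; omega)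
  have key : ∀ x, ∃ y, Loose S x → Loose (α S) y ∧
      ∀ F, (CG n (2 * n + k)).Adj F S → (x ∈ F.1 ↔ y ∈ (α F).1) := by
    intro x
    by_cases hx : Loose S x
    · obtain ⟨R, s, hs, hR⟩ := hx.exists_exchange hn h1
      obtain ⟨s', -, y, hy, hR'⟩ := ((near_of_exchange hs hx.1 hR).map hn hk α).exists_exchange
      refine ⟨y, fun _ => ⟨loose_of_exchange hy hR' h2, fun F hF => ?_⟩⟩
      rw [← not_iff_not, ← adj_exchange_iff hn hR hF,
        ← adj_exchange_iff hn hR' (α.map_adj_iff.2 hF), α.map_adj_iff]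
    · exact ⟨0, fun h => absurd h hx⟩
  choose f hf using key
  refine Finset.card_le_card_of_injOn f (fun x hx => ?_) fun x hx x' hx' hxx => ?_
  · simp only [Finset.coe_filter, Finset.mem_univ, true_and, Set.mem_ofPred_eq] at hx ⊢
    exact (hf x hx).1
  · simp only [Finset.coe_filter, Finset.mem_univ, true_and, Set.mem_ofPred_eq] at hx hx'
    by_contra hne
    obtain ⟨F, h3, h4, h5⟩ := hx.exists_disjoint_avoiding hn hx'.1 (Ne.symm hne)
    rw [(hf x hx).2 F h5, hxx, ← (hf x' hx').2 F h5] at h4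
    exact h4 h3

open Classical in
theorem card_loose {m : ℕ} (hmn : m = 2 * n + k) [NeZero m] (S : CVert n m) :
    (Finset.univ.filter (Loose S)).card = k + (S.1.filter (fun s => s + 2 ∉ S.1)).card := by
  have hgap : (S.1.filter (fun s => s + 2 ∈ S.1)).card =
      (Finset.univ.filter (fun x => x - 1 ∈ S.1 ∧ x + 1 ∈ S.1)).card := by
    refine Finset.card_bij' (fun s _ => s + 1) (fun x _ => x - 1) ?_ ?_ ?_ ?_
    · intro s hs
      simp only [Finset.mem_filter, Finset.mem_univ, true_and] at hs ⊢
      exact ⟨by simpa using hs.1, by convert hs.2 using 1; ring⟩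
    · intro x hx
      simp only [Finset.mem_filter, Finset.mem_univ, true_and] at hx ⊢
      exact ⟨hx.1, by convert hx.2 using 1; ring⟩
    · simp
    · simp
  have h1 := Finset.card_filter_add_card_filter_not (s := S.1) (fun s => s + 2 ∈ S.1)
  have h2 : (Finset.univ : Finset (ZMod m)) = S.1 ∪ (Finset.univ.filter (Loose S) ∪
      Finset.univ.filter (fun x => x - 1 ∈ S.1 ∧ x + 1 ∈ S.1)) := by
    ext x
    simp only [Loose, Finset.mem_univ, Finset.mem_union, Finset.mem_filter, true_and, true_iff]
    tauto
  have h3 := congrArg Finset.card h2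
  rw [Finset.card_union_of_disjoint, Finset.card_union_of_disjoint, Finset.card_univ, ZMod.card,
    S.2.1] at h3
  · rw [S.2.1] at h1
    omega
  · rw [Finset.disjoint_left]
    simp only [Loose, Finset.mem_filter]
    tauto
  · rw [Finset.disjoint_left]
    simp only [Loose, Finset.mem_filter, Finset.mem_univ, Finset.mem_union, true_and]
    rintro x hx (h | h)
    · exact h.1 hx
    · exact S.2.2 x hx h.2

/-- Automorphisms preserve the number of breaks of a set. -/
theorem card_breaks_le [NeZero (2 * n + k)] (hn : 1 ≤ n) (hk : Odd k)
    (α : CG n (2 * n + k) ≃g CG n (2 * n + k)) (S : CVert n (2 * n + k)) :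
    ((α S).1.filter (fun s => s + 2 ∉ (α S).1)).card ≤
      (S.1.filter (fun s => s + 2 ∉ S.1)).card := by
  have h := card_loose_le hn hk α.symm (α S)
  rw [α.symm_apply_apply, card_loose rfl, card_loose rfl] at h
  omega

end NearGraph

theorem intCast_ne_zero_of_lt {m : ℕ} {d : ℤ} (h0 : d ≠ 0) (h1 : d < m) (h2 : -d < m) :
    (d : ZMod m) ≠ 0 := by
  rw [Ne, ZMod.intCast_zmod_eq_zero_iff_dvd]
  intro h
  exact h0 (Int.eq_zero_of_abs_lt_dvd h (abs_lt.2 ⟨by omega, h1⟩))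

section Profile
variable {n k : ℕ} {y : ℕ → ℤ}

/-- The sequences `y` such that the points `y i + 2 i`, `i < n`, form a stable set. -/
structure Profile (n k : ℕ) (y : ℕ → ℤ) : Prop where
  mono : ∀ i j, i ≤ j → j < n → y i ≤ y j
  spread : ∀ i < n, ∀ j < n, y j ≤ y i + k

theorem Profile.eq_of_eq (h : Profile n k y) {i j : ℕ} (hi : i < n) (hj : j < n)
    (hij : ((y i + 2 * i : ℤ) : ZMod (2 * n + k)) = ((y j + 2 * j : ℤ) : ZMod (2 * n + k))) :
    i = j := by
  wlog hlt : i < j generalizing i j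
  · rcases lt_trichotomy i j with h1 | h1 | h1
    · exact absurd h1 hlt
    · exact h1
    · exact (this hj hi hij.symm h1).symm
  have h1 := h.mono i j hlt.le hj
  have h2 := h.spread i hi j hj
  refine absurd ?_ (intCast_ne_zero_of_lt (m := 2 * n + k) (d := y j + 2 * j - (y i + 2 * i))
    (by omega) (by push_cast; omega) (by push_cast; omega))
  rw [Int.cast_sub, hij, sub_self]

/-- The stable set with a given profile. -/
def Profile.vert (h : Profile n k y) : CVert n (2 * n + k) :=
  ⟨(Finset.range n).image (fun i => ((y i + 2 * i : ℤ) : ZMod (2 * n + k))), by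
    rw [Finset.card_image_of_injOn, Finset.card_range]
    intro i hi j hj hij
    exact h.eq_of_eq (Finset.mem_range.1 hi) (Finset.mem_range.1 hj) hij, by
    intro x hx hx'
    simp only [Finset.mem_image, Finset.mem_range] at hx hx'
    obtain ⟨i, hi, rfl⟩ := hx
    obtain ⟨j, hj, hij⟩ := hx'
    have h0 : ((y j + 2 * j - (y i + 2 * i) - 1 : ℤ) : ZMod (2 * n + k)) = 0 := by
      rw [Int.cast_sub, Int.cast_sub, hij]
      simp
    have h2 := h.spread i hi j hj
    have h2' := h.spread j hj i hi
    refine intCast_ne_zero_of_lt ?_ ?_ ?_ h0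
    · rcases lt_trichotomy i j with h3 | rfl | h3
      · have := h.mono i j h3.le hj
        omega
      · omega
      · have := h.mono j i h3.le hi
        omega
    · push_cast
      rcases le_total i j with h3 | h3
      · omega
      · have := h.mono j i h3 hi
        omega
    · push_cast
      rcases le_total i j with h3 | h3
      · have := h.mono i j h3 hj
        omega
      · omega⟩

theorem Profile.mem_vert (h : Profile n k y) {x : ZMod (2 * n + k)} :
    x ∈ h.vert.1 ↔ ∃ i < n, ((y i + 2 * i : ℤ) : ZMod (2 * n + k)) = x := by
  simp [Profile.vert]

theorem Profile.mem_vert_update (h : Profile n k y) {p : ℕ} (hp : p < n) {v : ℤ}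
    (h' : Profile n k (Function.update y p v)) {x : ZMod (2 * n + k)} :
    x ∈ h'.vert.1 ↔ (x ∈ h.vert.1 ∧ x ≠ ((y p + 2 * p : ℤ) : ZMod (2 * n + k))) ∨
      x = ((v + 2 * p : ℤ) : ZMod (2 * n + k)) := by
  rw [h'.mem_vert, h.mem_vert]
  constructor
  · rintro ⟨i, hi, rfl⟩
    by_cases hip : i = p
    · subst hip
      exact Or.inr (by rw [Function.update_self])
    · refine Or.inl ⟨⟨i, hi, by rw [Function.update_of_ne hip]⟩, ?_⟩
      rw [Function.update_of_ne hip]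
      exact fun h1 => hip (h.eq_of_eq hi hp h1)
  · rintro (⟨⟨i, hi, rfl⟩, h1⟩ | rfl)
    · refine ⟨i, hi, ?_⟩
      rw [Function.update_of_ne]
      rintro rfl
      exact h1 rfl
    · exact ⟨p, hp, by rw [Function.update_self]⟩

theorem profile_const (n k : ℕ) (a : ℤ) : Profile n k (fun _ => a) :=
  ⟨fun _ _ _ _ => le_rfl, fun _ _ _ _ => by omega⟩

/-- Every stable set has a profile. -/
theorem exists_profile [NeZero (2 * n + k)] (S : CVert n (2 * n + k)) :
    ∃ y, ∃ h : Profile n k y, h.vert = S := by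
  let S' := (toCG n k).symm S
  let f := S'.1.orderEmbOfFin S'.2.1
  have hstep : ∀ i j : Fin n, i ≤ j → f i + 2 * (j - i) ≤ f j := by
    intro i j hij
    obtain ⟨i, hi⟩ := i
    obtain ⟨j, hj⟩ := j
    rw [Fin.mk_le_mk] at hij
    induction j, hij using Nat.le_induction with
    | base => simp
    | succ j hij ih =>
      have h1 := ih (by omega)
      have h2 : f ⟨j, by omega⟩ < f ⟨j + 1, hj⟩ := f.strictMono (by simp)
      have h3 : f ⟨j + 1, hj⟩ ≠ f ⟨j, by omega⟩ + 1 := fun h =>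
        succ_notMem S' (Finset.orderEmbOfFin_mem S'.1 S'.2.1 ⟨j, by omega⟩)
          (by
            have h4 := Finset.orderEmbOfFin_mem S'.1 S'.2.1 ⟨j + 1, hj⟩
            change f ⟨j + 1, hj⟩ ∈ S'.1 at h4
            rwa [h] at h4)
      simp only at h1 ⊢
      omega
  have hlt : ∀ i, f i < 2 * n + k := fun i =>
    vert_lt S' (Finset.orderEmbOfFin_mem S'.1 S'.2.1 i)
  let y : ℕ → ℤ := fun i => if h : i < n then (f ⟨i, h⟩ : ℤ) - 2 * i else 0
  have hy : ∀ i (h : i < n), y i = (f ⟨i, h⟩ : ℤ) - 2 * i := fun i h => dif_pos h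
  have hmono : ∀ i j, i ≤ j → j < n → y i ≤ y j := by
    intro i j hij hj
    have := hstep ⟨i, by omega⟩ ⟨j, hj⟩ hij
    simp only at this
    rw [hy i (by omega), hy j hj]
    omega
  have hends : ∀ h0 : 0 < n, f ⟨n - 1, by omega⟩ + 2 ≤ f ⟨0, h0⟩ + (2 * n + k) := by
    intro h0
    by_contra hc
    have h1 := hlt ⟨n - 1, by omega⟩
    have h2 := Finset.orderEmbOfFin_mem S'.1 S'.2.1 ⟨0, h0⟩
    have h3 := Finset.orderEmbOfFin_mem S'.1 S'.2.1 ⟨n - 1, by omega⟩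
    change f ⟨0, h0⟩ ∈ S'.1 at h2
    change f ⟨n - 1, _⟩ ∈ S'.1 at h3
    refine S'.2.2.2 ⟨?_, ?_⟩
    · rwa [show f ⟨0, h0⟩ = 0 by omega] at h2
    · rwa [show f ⟨n - 1, by omega⟩ = 2 * n + k - 1 by omega] at h3
  have h : Profile n k y := by
    refine ⟨hmono, fun i hi j hj => ?_⟩
    have h1 := hmono 0 i (by omega) hi
    have h2 := hmono j (n - 1) (by omega) (by omega)
    have h3 := hends (by omega)
    rw [hy 0 (by omega)] at h1
    rw [hy (n - 1) (by omega)] at h2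
    omega
  refine ⟨y, h, Subtype.ext (Finset.ext fun x => ?_)⟩
  have hS : S = toCG n k S' := ((toCG n k).apply_symm_apply S).symm
  rw [h.mem_vert, hS, mem_toCG, ← Finset.mem_coe, ← Finset.range_orderEmbOfFin S'.1 S'.2.1]
  constructor
  · rintro ⟨i, hi, rfl⟩
    refine ⟨⟨i, hi⟩, ?_⟩
    rw [hy i hi, sub_add_cancel, Int.cast_natCast, ZMod.val_natCast_of_lt (hlt _)]
  · rintro ⟨i, hi⟩
    refine ⟨i, i.2, ?_⟩
    rw [hy i i.2, sub_add_cancel, Int.cast_natCast]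
    change ((S'.1.orderEmbOfFin S'.2.1 i : ℕ) : ZMod _) = x
    rw [hi, ZMod.natCast_zmod_val]

end Profile

section Tight
variable {n k : ℕ}

/-- The set `{a, a + 2, …, a + 2 (n - 1)}`. -/
def tight (n k : ℕ) (a : ZMod (2 * n + k)) : CVert n (2 * n + k) :=
  rotate n a (profile_const n k 0).vert

theorem mem_tight {a x : ZMod (2 * n + k)} :
    x ∈ (tight n k a).1 ↔ ∃ i < n, a + 2 * (i : ℕ) = x := by
  rw [tight, mem_rotate, Profile.mem_vert]
  refine exists_congr fun i => and_congr_right fun _ => ?_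
  rw [eq_sub_iff_add_eq]
  push_cast
  constructor <;> intro h <;> linear_combination h

theorem rotate_tight (t a : ZMod (2 * n + k)) : rotate n t (tight n k a) = tight n k (a + t) := by
  refine Subtype.ext (Finset.ext fun x => ?_)
  rw [mem_rotate, mem_tight, mem_tight]
  refine exists_congr fun i => and_congr_right fun _ => ?_
  rw [eq_sub_iff_add_eq, add_right_comm]

theorem reflect_tight (hn : 1 ≤ n) (a : ZMod (2 * n + k)) :
    reflect n _ (tight n k a) = tight n k (-a - 2 * ((n - 1 : ℕ))) := by
  refine Subtype.ext (Finset.ext fun x => ?_)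
  rw [mem_reflect, mem_tight, mem_tight]
  constructor
  · rintro ⟨i, hi, h⟩
    refine ⟨n - 1 - i, by omega, ?_⟩
    rw [Nat.cast_sub (show i ≤ n - 1 by omega)]
    linear_combination -h
  · rintro ⟨i, hi, h⟩
    refine ⟨n - 1 - i, by omega, ?_⟩
    rw [Nat.cast_sub (show i ≤ n - 1 by omega)]
    linear_combination -h

theorem tight_breaks (a : ZMod (2 * n + k)) :
    ((tight n k a).1.filter (fun s => s + 2 ∉ (tight n k a).1)).card ≤ 1 := by
  rw [Finset.card_le_one]
  have h : ∀ s ∈ (tight n k a).1.filter (fun s => s + 2 ∉ (tight n k a).1),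
      s = a + 2 * ((n - 1 : ℕ)) := by
    intro s hs
    rw [Finset.mem_filter, mem_tight] at hs
    obtain ⟨⟨i, hi, rfl⟩, h⟩ := hs
    by_cases h1 : i = n - 1
    · rw [h1]
    · exact absurd (mem_tight.2 ⟨i + 1, by omega, by push_cast; ring⟩) h
  intro s hs t ht
  rw [h s hs, h t ht]

theorem eq_tight_of_breaks (hn : 1 ≤ n) (hk : Odd k) {S : CVert n (2 * n + k)}
    (hS : (S.1.filter (fun s => s + 2 ∉ S.1)).card ≤ 1) : ∃ a, S = tight n k a := by
  obtain ⟨t, ht⟩ := hk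
  have : NeZero (2 * n + k) := ⟨by omega⟩
  have hm : Odd (2 * n + k) := ⟨n + t, by omega⟩
  have hne : S.1.Nonempty := Finset.card_pos.1 (by rw [S.2.1]; exact hn)
  obtain ⟨x, hx⟩ := hne
  obtain ⟨L, hL, hL2⟩ : ∃ s ∈ S.1, s + 2 ∉ S.1 := by
    by_contra! hc
    exact S.2.2 x hx (mem_of_add_two_closed hm (A := (S.1 : Set (ZMod (2 * n + k)))) hc hx (x + 1))
  have huniq : ∀ s ∈ S.1, s ≠ L → s + 2 ∈ S.1 := by
    intro s hs hsL
    by_contra hc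
    exact hsL (Finset.card_le_one.1 hS s (Finset.mem_filter.2 ⟨hs, hc⟩) L
      (Finset.mem_filter.2 ⟨hL, hL2⟩))
  have hhalf : (2 : ZMod (2 * n + k)) * ((n + t + 1 : ℕ)) = 1 := by
    have h1 := ZMod.natCast_self (2 * n + k)
    have h2 : 2 * n + k + 1 = 2 * (n + t + 1) := by omega
    have h3 : ((2 * n + k + 1 : ℕ) : ZMod (2 * n + k)) = 2 * ((n + t + 1 : ℕ)) := by
      rw [h2]; push_cast; ring
    rw [← h3, Nat.cast_add, h1]
    simp
  let d : ZMod (2 * n + k) → ℕ := fun s => ((L - s) * ((n + t + 1 : ℕ))).val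
  have hd : ∀ s, L - 2 * (d s : ZMod (2 * n + k)) = s := by
    intro s
    simp only [d]
    rw [ZMod.natCast_zmod_val]
    linear_combination (-(L - s)) * hhalf
  have hinj : Function.Injective d := fun s s' h => by rw [← hd s, ← hd s', h]
  have hdown : ∀ j, ∀ s ∈ S.1, d s = j + 1 → ∃ s' ∈ S.1, d s' = j := by
    intro j s hs hj
    have hsL : s ≠ L := by
      rintro rfl
      simp [d] at hj
    refine ⟨s + 2, huniq s hs hsL, ?_⟩
    have h1 : ((L - s) * ((n + t + 1 : ℕ)) : ZMod (2 * n + k)) = ((j + 1 : ℕ)) := by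
      rw [← hj, ZMod.natCast_zmod_val]
    have h2 : ((L - (s + 2)) * ((n + t + 1 : ℕ)) : ZMod (2 * n + k)) = (j : ℕ) := by
      push_cast at h1 hhalf ⊢
      linear_combination h1 - hhalf
    have h3 : j + 1 < 2 * n + k := by rw [← hj]; exact ZMod.val_lt _
    simp only [d]
    rw [h2, ZMod.val_natCast_of_lt (by omega)]
  have hdown' : ∀ i j, ∀ s ∈ S.1, d s = j + i → ∃ s' ∈ S.1, d s' = j := by
    intro i
    induction i with
    | zero => exact fun j s hs h => ⟨s, hs, h⟩
    | succ i ih =>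
      intro j s hs h
      obtain ⟨s', hs', h'⟩ := hdown (j + i) s hs h
      exact ih j s' hs' h'
  have hlt : ∀ s ∈ S.1, d s < n := by
    intro s hs
    have h1 : Finset.range (d s + 1) ⊆ S.1.image d := by
      intro j hj
      rw [Finset.mem_range] at hj
      obtain ⟨s', hs', h'⟩ := hdown' (d s - j) j s hs (by omega)
      exact Finset.mem_image.2 ⟨s', hs', h'⟩
    have h2 := Finset.card_le_card h1
    rw [Finset.card_range, Finset.card_image_of_injective _ hinj, S.2.1] at h2
    omega
  refine ⟨L - 2 * ((n - 1 : ℕ)), Subtype.ext (Finset.eq_of_subset_of_card_le (fun s hs => ?_)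
    (by rw [S.2.1, (tight n k _).2.1]))⟩
  rw [mem_tight]
  have h1 := hlt s hs
  refine ⟨n - 1 - d s, by omega, ?_⟩
  rw [Nat.cast_sub (show d s ≤ n - 1 by omega)]
  linear_combination hd s

theorem add_two_mul_notMem_tight {a : ZMod (2 * n + k)} {j : ℕ} (h1 : n ≤ j)
    (h2 : 2 * j < 2 * n + k) : a + 2 * (j : ℕ) ∉ (tight n k a).1 := by
  rw [mem_tight]
  rintro ⟨i, hi, h⟩
  refine intCast_ne_zero_of_lt (m := 2 * n + k) (d := 2 * j - 2 * i) (by omega)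
    (by push_cast; omega) (by push_cast; omega) ?_
  push_cast
  linear_combination -h

theorem near_tight_add_two (hn : 1 ≤ n) (hk : 1 ≤ k) (a : ZMod (2 * n + k)) :
    Near (tight n k a) (tight n k (a + 2)) := by
  refine Near.symm (Finset.card_eq_one.2 ⟨a + 2 * (n : ℕ), Finset.ext fun x => ?_⟩)
  rw [Finset.mem_sdiff, Finset.mem_singleton]
  constructor
  · rintro ⟨h1, h2⟩
    obtain ⟨i, hi, rfl⟩ := mem_tight.1 h1
    by_cases h : i + 1 = n
    · have h3 := congrArg (Nat.cast (R := ZMod (2 * n + k))) h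
      push_cast at h3
      linear_combination 2 * h3
    · exact absurd (mem_tight.2 ⟨i + 1, by omega, by push_cast; ring⟩) h2
  · rintro rfl
    refine ⟨mem_tight.2 ⟨n - 1, by omega, ?_⟩, add_two_mul_notMem_tight le_rfl (by omega)⟩
    rw [Nat.cast_sub hn]
    push_cast
    ring

theorem eq_of_near_tight (hn : 2 ≤ n) (hk : 3 ≤ k) {a b : ZMod (2 * n + k)}
    (h : Near (tight n k a) (tight n k b)) : b = a + 2 ∨ b = a - 2 := by
  have h2 := (one_ne_zero_two_ne_zero (m := 2 * n + k) (by omega)).2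
  have hle := Finset.card_le_one.1 h.symm.le
  have hmem : ∀ {i}, i < n → b + 2 * (i : ℕ) ∉ (tight n k a).1 →
      b + 2 * (i : ℕ) ∈ (tight n k b).1 \ (tight n k a).1 := fun hi hb =>
    Finset.mem_sdiff.2 ⟨mem_tight.2 ⟨_, hi, rfl⟩, hb⟩
  by_cases hb : b ∈ (tight n k a).1
  · obtain ⟨j, hj, rfl⟩ := mem_tight.1 hb
    rcases j with _ | _ | j
    · simp [Near] at h
    · left; push_cast; ring
    · exfalso
      have e1 : a + 2 * ((j + 2 : ℕ)) + 2 * ((n - (j + 2) : ℕ)) = a + 2 * (n : ℕ) := by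
        rw [Nat.cast_sub hj.le]; ring
      have e2 : a + 2 * ((j + 2 : ℕ)) + 2 * ((n - (j + 1) : ℕ)) = a + 2 * ((n + 1 : ℕ)) := by
        rw [Nat.cast_sub (by omega)]; push_cast; ring
      have e3 := hle _ (hmem (i := n - (j + 2)) (by omega)
          (by rw [e1]; exact add_two_mul_notMem_tight le_rfl (by omega)))
        _ (hmem (i := n - (j + 1)) (by omega)
          (by rw [e2]; exact add_two_mul_notMem_tight (by omega) (by omega)))
      rw [e1, e2] at e3
      push_cast at e3
      exact h2 (by linear_combination -e3)
  · right
    by_cases hb2 : b + 2 * ((1 : ℕ)) ∈ (tight n k a).1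
    · obtain ⟨j, hj, h3⟩ := mem_tight.1 hb2
      rcases j with _ | j
      · push_cast at h3; linear_combination -h3
      · refine absurd (mem_tight.2 ⟨j, by omega, ?_⟩) hb
        push_cast at h3
        linear_combination h3
    · have e := hle _ (hmem (i := 1) (by omega) hb2) _ (hmem (i := 0) (by omega) (by simpa using hb))
      push_cast at e
      exact absurd (by linear_combination e) h2

theorem tight_injective (hn : 1 ≤ n) (hk : Odd k) : Function.Injective (tight n k) := by
  intro a b hab
  have hk1 : 1 ≤ k := hk.pos
  have hself : ∀ c, c ∈ (tight n k c).1 := fun c => mem_tight.2 ⟨0, by omega, by simp⟩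
  obtain ⟨i, hi, h1⟩ := mem_tight.1 (hab ▸ hself a)
  obtain ⟨j, hj, h2⟩ := mem_tight.1 (hab.symm ▸ hself b)
  by_cases h0 : i + j = 0
  · obtain ⟨rfl, rfl⟩ : i = 0 ∧ j = 0 := by omega
    simpa using h1.symm
  · exfalso
    have h3 : ((2 * (i + j : ℕ) : ℤ) : ZMod (2 * n + k)) = 0 := by
      push_cast
      linear_combination h1 + h2
    rw [ZMod.intCast_zmod_eq_zero_iff_dvd] at h3
    obtain ⟨c, hc⟩ := h3
    have h4 : 0 < c := by
      by_contra h
      have : ((2 * n + k : ℕ) : ℤ) * c ≤ 0 := mul_nonpos_of_nonneg_of_nonpos (by omega) (by omega)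
      omega
    have h5 : c < 2 := by
      by_contra h
      have : ((2 * n + k : ℕ) : ℤ) * 2 ≤ ((2 * n + k : ℕ) : ℤ) * c :=
        mul_le_mul_of_nonneg_left (by omega) (by omega)
      push_cast at this hc
      omega
    obtain rfl : c = 1 := by omega
    obtain ⟨t, rfl⟩ := hk
    push_cast at hc
    omega

theorem exists_eq_two_mul {m : ℕ} (hm : Odd m) (a : ZMod m) : ∃ i : ℕ, a = 2 * (i : ℕ) := by
  obtain ⟨t, rfl⟩ := hm
  refine ⟨a.val * (t + 1), ?_⟩
  have h := ZMod.natCast_self (2 * t + 1)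
  push_cast at h ⊢
  rw [ZMod.natCast_zmod_val]
  linear_combination (-a) * h

/-- Automorphisms act on the tight sets as dihedral symmetries. -/
theorem exists_dihedral [NeZero (2 * n + k)] (hn : 2 ≤ n) (hk : Odd k) (hk3 : 3 ≤ k)
    (α : CG n (2 * n + k) ≃g CG n (2 * n + k)) :
    ∃ t, (∀ a, α (tight n k a) = rotate n t (tight n k a)) ∨
      ∀ a, α (tight n k a) = rotate n t (reflect n _ (tight n k a)) := by
  have hn1 : 1 ≤ n := by omega
  have hm : Odd (2 * n + k) := by obtain ⟨t, rfl⟩ := hk; exact ⟨n + t, by ring⟩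
  have hσ : ∀ a, ∃ b, α (tight n k a) = tight n k b := fun a =>
    eq_tight_of_breaks hn1 hk ((card_breaks_le hn1 hk α _).trans (tight_breaks a))
  choose σ hσ using hσ
  have hinj : Function.Injective σ := fun a b hab =>
    tight_injective hn1 hk (α.injective (by rw [hσ, hσ, hab]))
  have hstep : ∀ a, σ (a + 2) = σ a + 2 ∨ σ (a + 2) = σ a - 2 := by
    intro a
    have h := (near_tight_add_two hn1 hk.pos a).map hn1 hk α
    rw [hσ, hσ] at h
    exact eq_of_near_tight hn hk3 h
  have h4 : (4 : ZMod (2 * n + k)) ≠ 0 := by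
    have := intCast_ne_zero_of_lt (m := 2 * n + k) (d := 4) (by omega) (by push_cast; omega)
      (by omega)
    exact_mod_cast this
  have hlin : ∀ ε : ZMod (2 * n + k), (ε = 2 ∨ ε = -2) → σ 2 = σ 0 + ε →
      ∀ i : ℕ, σ (2 * (i : ℕ)) = σ 0 + i * ε ∧ σ (2 * (i : ℕ) + 2) = σ 0 + i * ε + ε := by
    intro ε hε h0 i
    induction i with
    | zero => simpa using h0
    | succ i ih =>
      have e1 : (2 * ((i + 1 : ℕ)) : ZMod (2 * n + k)) = 2 * (i : ℕ) + 2 := by push_cast; ring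
      rw [e1]
      refine ⟨by rw [ih.2]; push_cast; ring, ?_⟩
      have hne : σ (2 * (i : ℕ) + 2 + 2) ≠ σ (2 * (i : ℕ)) := fun h =>
        h4 (by linear_combination hinj h)
      have h5 := hstep (2 * (i : ℕ) + 2)
      rw [ih.2] at h5
      rw [ih.1] at hne
      rcases hε with rfl | rfl
      · rcases h5 with h | h
        · rw [h]; push_cast; ring
        · exact absurd (by rw [h]; ring) hne
      · rcases h5 with h | h
        · exact absurd (by rw [h]; ring) hne
        · rw [h]; push_cast; ring
  have h0 := hstep 0
  rw [zero_add] at h0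
  rcases h0 with h0 | h0
  · refine ⟨σ 0, Or.inl fun a => ?_⟩
    obtain ⟨i, rfl⟩ := exists_eq_two_mul hm a
    rw [hσ, rotate_tight, (hlin 2 (Or.inl rfl) h0 i).1]
    congr 1
    ring
  · refine ⟨σ 0 + 2 * ((n - 1 : ℕ)), Or.inr fun a => ?_⟩
    obtain ⟨i, rfl⟩ := exists_eq_two_mul hm a
    rw [hσ, reflect_tight hn1, rotate_tight,
      (hlin (-2) (Or.inr rfl) (by rw [h0]; ring) i).1]
    congr 1
    ring

end Tight

section Square
variable {n m : ℕ}

theorem eq_of_subset_vert {S R : CVert n m} (h : S.1 ⊆ R.1) : S = R :=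
  Subtype.ext (Finset.eq_of_subset_of_card_le h (by rw [S.2.1, R.2.1]))

theorem Near.mem_of_notMem {S R : CVert n m} (h : Near S R) {a : ZMod m} (ha : a ∈ S.1)
    (haR : a ∉ R.1) {x : ZMod m} (hx : x ∈ S.1) (hxa : x ≠ a) : x ∈ R.1 := by
  by_contra hxR
  exact hxa (Finset.card_le_one.1 h.le x (Finset.mem_sdiff.2 ⟨hx, hxR⟩) a
    (Finset.mem_sdiff.2 ⟨ha, haR⟩))

/-- A set that is near to the two middle corners of a square of exchanges is one of the
two extreme corners. -/
theorem eq_or_eq_of_near_of_near {T A B C R : CVert n m} {a c : ZMod m} (ha : a ∈ T.1)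
    (hc : c ∈ T.1) (hac : a ≠ c)
    (hA : ∀ x, x ∈ A.1 ↔ (x ∈ T.1 ∧ x ≠ a) ∨ x = a + 1)
    (hB : ∀ x, x ∈ B.1 ↔ (x ∈ T.1 ∧ x ≠ c) ∨ x = c - 1)
    (hC : ∀ x, x ∈ C.1 ↔ (x ∈ A.1 ∧ x ≠ c) ∨ x = c - 1)
    (hAR : Near A R) (hBR : Near B R) : R = T ∨ R = C := by
  have ha' : a + 1 ∉ T.1 := T.2.2 a ha
  have hc' : c - 1 ∉ T.1 := fun h => T.2.2 _ h (by rwa [sub_add_cancel])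
  have haA : a ∉ A.1 := by
    rw [hA]
    rintro (h | h)
    · exact h.2 rfl
    · exact ha' (h ▸ ha)
  have hcB : c ∉ B.1 := by
    rw [hB]
    rintro (h | h)
    · exact h.2 rfl
    · exact hc' (h ▸ hc)
  by_cases haR : a ∈ R.1
  · refine Or.inl (eq_of_subset_vert fun x hx => ?_)
    by_cases hxa : x = a
    · exact hxa ▸ ha
    rcases (hA x).1 (hAR.symm.mem_of_notMem haR haA hx hxa) with h | rfl
    · exact h.1
    · exact absurd hx (R.2.2 a haR)
  by_cases hcR : c ∈ R.1
  · refine Or.inl (eq_of_subset_vert fun x hx => ?_)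
    by_cases hxc : x = c
    · exact hxc ▸ hc
    rcases (hB x).1 (hBR.symm.mem_of_notMem hcR hcB hx hxc) with h | rfl
    · exact h.1
    · exact absurd (by rwa [sub_add_cancel]) (R.2.2 _ hx)
  · refine Or.inr (eq_of_subset_vert fun x hx => ?_).symm
    rcases (hC x).1 hx with h | rfl
    · exact hAR.mem_of_notMem ((hA c).2 (Or.inl ⟨hc, hac.symm⟩)) hcR h.1 h.2
    · exact hBR.mem_of_notMem ((hB a).2 (Or.inl ⟨ha, hac⟩)) haR ((hB _).2 (Or.inr rfl))
        fun h => hc' (h ▸ ha)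

end Square

section Rigid
variable {n k : ℕ}

theorem eq_zero_or_of_intCast_eq_zero {m : ℕ} {d : ℤ} (h : (d : ZMod m) = 0) (h1 : d < 2 * m)
    (h2 : -d < 2 * m) : d = 0 ∨ d = m ∨ d = -m := by
  rw [ZMod.intCast_zmod_eq_zero_iff_dvd] at h
  obtain ⟨c, rfl⟩ := h
  have h3 : c < 2 := by nlinarith
  have h4 : -2 < c := by nlinarith
  obtain rfl | rfl | rfl : c = -1 ∨ c = 0 ∨ c = 1 := by omega
  · right; right; ring
  · left; ring
  · right; left; ring

theorem Profile.vert_congr {y y' : ℕ → ℤ} (h : Profile n k y) (h' : Profile n k y')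
    (e : ∀ i < n, y i = y' i) : h.vert = h'.vert := by
  refine Subtype.ext (Finset.ext fun x => ?_)
  rw [h.mem_vert, h'.mem_vert]
  exact exists_congr fun i => and_congr_right fun hi => by rw [e i hi]

theorem vert_const_eq_tight (a : ℤ) : (profile_const n k a).vert = tight n k (a : ZMod _) := by
  refine Subtype.ext (Finset.ext fun x => ?_)
  rw [Profile.mem_vert, mem_tight]
  refine exists_congr fun i => and_congr_right fun hi => ?_
  push_cast
  rfl

theorem Profile.mem_vert_self {y : ℕ → ℤ} (h : Profile n k y) {i : ℕ} (hi : i < n) :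
    ((y i + 2 * i : ℤ) : ZMod (2 * n + k)) ∈ h.vert.1 := h.mem_vert.2 ⟨i, hi, rfl⟩

/-- An automorphism fixing all tight sets fixes `{z, z + 2, …}` shifted by one from some
point on. -/
theorem fixed_update_of_fixed (hn : 1 ≤ n) (hk : Odd k)
    (α : CG n (2 * n + k) ≃g CG n (2 * n + k)) (hα : ∀ a, α (tight n k a) = tight n k a)
    {y : ℕ → ℤ} (h : Profile n k y) {lo : ℤ} {j : ℕ} (hj : j < n) (hlo : ∀ i ≤ j, y i = lo)
    (hhi : ∀ i, j < i → i < n → y i = lo + 1)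
    (h' : Profile n k (Function.update y j (lo + 1))) (hfix : α h.vert = h.vert) :
    α h'.vert = h'.vert := by
  have : NeZero (2 * n + k) := ⟨by omega⟩
  obtain ⟨t, ht⟩ := hk
  set z : ZMod (2 * n + k) := ((lo + 2 * j : ℤ) : ZMod (2 * n + k)) with hz
  have hmem := fun x => h.mem_vert_update hj h' (x := x)
  rw [hlo j le_rfl, ← hz] at hmem
  have hz1 : (((lo + 1) + 2 * j : ℤ) : ZMod (2 * n + k)) = z + 1 := by
    rw [hz]; push_cast; ring
  rw [hz1] at hmem
  have hzT : z ∈ h.vert.1 := by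
    have := h.mem_vert_self hj
    rwa [hlo j le_rfl, ← hz] at this
  have hdisj : ∀ e ≤ t + 1, Disjoint h'.vert.1 (tight n k (z + 2 * (e : ℕ))).1 := by
    intro e he
    rw [Finset.disjoint_left]
    intro x hx hx'
    obtain ⟨i, hi, rfl⟩ := h'.mem_vert.1 hx
    obtain ⟨l, hl, hxl⟩ := mem_tight.1 hx'
    have h0 : ((Function.update y j (lo + 1) i + 2 * i - (lo + 2 * j + 2 * e + 2 * l) : ℤ) :
        ZMod (2 * n + k)) = 0 := by
      rw [Int.cast_sub, ← hxl, hz]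
      push_cast
      ring
    rcases lt_or_ge i j with hij | hij
    · rw [Function.update_of_ne hij.ne, hlo i hij.le] at h0
      have := eq_zero_or_of_intCast_eq_zero h0 (by push_cast; omega) (by push_cast; omega)
      push_cast at this
      omega
    · have hy : Function.update y j (lo + 1) i = lo + 1 := by
        rcases hij.eq_or_lt with rfl | hij
        · rw [Function.update_self]
        · rw [Function.update_of_ne hij.ne', hhi i hij hi]
      rw [hy] at h0
      exact intCast_ne_zero_of_lt (by omega) (by push_cast; omega) (by push_cast; omega) h0
  have hdisj' : ∀ b, Disjoint h'.vert.1 (tight n k b).1 ↔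
      Disjoint (α h'.vert).1 (tight n k b).1 := by
    intro b
    rw [← CG_adj hn, ← CG_adj hn, ← α.map_adj_iff, hα]
  have heven : ∀ e : ℕ, e ≤ n + t → z + 2 * (e : ℕ) ∉ (α h'.vert).1 := by
    intro e he hR
    have hd := (hdisj' _).1 (hdisj (min e (t + 1)) (min_le_right _ _))
    refine Finset.disjoint_left.1 hd hR (mem_tight.2 ⟨e - min e (t + 1), by omega, ?_⟩)
    rw [Nat.cast_sub (min_le_left _ _)]
    ring
  have hzR : z ∉ (α h'.vert).1 := by simpa using heven 0 (by omega)
  have hz1R : z + 1 ∈ (α h'.vert).1 := by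
    have hnd : ¬ Disjoint h'.vert.1 (tight n k (z + 1 - 2 * ((n - 1 : ℕ)))).1 := by
      rw [Finset.not_disjoint_iff]
      exact ⟨z + 1, (hmem _).2 (Or.inr rfl), mem_tight.2 ⟨n - 1, by omega, by ring⟩⟩
    rw [hdisj', Finset.not_disjoint_iff] at hnd
    obtain ⟨x, hx, hx'⟩ := hnd
    obtain ⟨i, hi, rfl⟩ := mem_tight.1 hx'
    by_cases h1 : i = n - 1
    · rw [h1] at hx
      rwa [sub_add_cancel] at hx
    · refine absurd ?_ (heven (i + t + 2) (by omega))
      convert hx using 1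
      have h2 := ZMod.natCast_self (2 * n + k)
      have h3 : (k : ZMod (2 * n + k)) = 2 * t + 1 := by
        have := congrArg (Nat.cast (R := ZMod (2 * n + k))) ht
        push_cast at this
        exact this
      rw [Nat.cast_sub hn]
      push_cast at h2 ⊢
      linear_combination h2 - h3
  have hnear : Near h.vert (α h'.vert) := by
    have := (near_of_exchange hzT (h.vert.2.2 z hzT) hmem).map hn ⟨t, ht⟩ α
    rwa [hfix] at this
  obtain ⟨s, hs, x, hx, hR⟩ := hnear.exists_exchange
  have hsz : s = z := by
    by_contra hne
    exact hzR ((hR z).2 (Or.inl ⟨hzT, Ne.symm hne⟩))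
  have hxz : x = z + 1 := by
    rcases (hR _).1 hz1R with h1 | h1
    · exact absurd h1.1 (h.vert.2.2 z hzT)
    · exact h1.symm
  refine Subtype.ext (Finset.ext fun w => ?_)
  rw [hR, hmem, hsz, hxz]

theorem fixed_of_two_values (hn : 1 ≤ n) (hk : Odd k)
    (α : CG n (2 * n + k) ≃g CG n (2 * n + k)) (hα : ∀ a, α (tight n k a) = tight n k a)
    {y : ℕ → ℤ} (h : Profile n k y) {lo : ℤ} (hy : ∀ i < n, lo ≤ y i ∧ y i ≤ lo + 1) :
    α h.vert = h.vert := by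
  have hk1 := hk.pos
  have key : ∀ p ≤ n, ∀ h' : Profile n k (fun i => if i < n - p then lo else lo + 1),
      α h'.vert = h'.vert := by
    intro p hp
    induction p with
    | zero =>
      intro h'
      rw [h'.vert_congr (profile_const n k lo) fun i hi => if_pos (by omega),
        vert_const_eq_tight, hα]
    | succ p ih =>
      intro h'
      have h1 : Profile n k (fun i => if i < n - p then lo else lo + 1) := by
        constructor <;> intros <;> split_ifs <;> omega
      have h2 : (fun i => if i < n - (p + 1) then lo else lo + 1) =
          Function.update (fun i => if i < n - p then lo else lo + 1) (n - (p + 1)) (lo + 1) := by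
        funext i
        rw [Function.update_apply]
        split_ifs <;> omega
      have h3 := fixed_update_of_fixed hn hk α hα h1 (j := n - (p + 1)) (lo := lo) (by omega)
        (fun i hi => if_pos (by omega)) (fun i hi hi' => if_neg (by omega)) (h2 ▸ h')
        (ih (by omega) h1)
      rwa [(h2 ▸ h' : Profile n k (Function.update _ _ _)).vert_congr h'
        fun i _ => (congrFun h2 i).symm] at h3
  let s := (Finset.range n).filter (fun i => y i = lo)
  have hs : ∀ i < n, i < s.card ↔ y i = lo := by
    have hdown : ∀ i < n, y i = lo → ∀ j ≤ i, y j = lo := by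
      intro i hi h1 j hj
      have := h.mono j i hj hi
      have := hy j (by omega)
      omega
    intro i hi
    constructor
    · intro h1
      by_contra h2
      have h3 : s ⊆ Finset.range i := by
        intro j hj
        simp only [s, Finset.mem_filter, Finset.mem_range] at hj ⊢
        by_contra h4
        exact h2 (hdown j hj.1 hj.2 i (by omega))
      have := Finset.card_le_card h3
      rw [Finset.card_range] at this
      omega
    · intro h1
      have h3 : Finset.range (i + 1) ⊆ s := by
        intro j hj
        simp only [s, Finset.mem_filter, Finset.mem_range] at hj ⊢
        exact ⟨by omega, hdown i hi h1 j (by omega)⟩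
      have := Finset.card_le_card h3
      rw [Finset.card_range] at this
      omega
  have hsn : s.card ≤ n := by
    have := Finset.card_filter_le (Finset.range n) (fun i => y i = lo)
    rwa [Finset.card_range] at this
  have h1 : Profile n k (fun i => if i < n - (n - s.card) then lo else lo + 1) := by
    constructor <;> intros <;> split_ifs <;> omega
  rw [h.vert_congr h1 fun i hi => ?_]
  · exact key _ (by omega) h1
  · have h2 := hs i hi
    have h3 := hy i hi
    split_ifs <;> omega

theorem Profile.raise {y : ℕ → ℤ} (h : Profile n k y) {lo : ℤ} {d p : ℕ} (hd : d ≤ k)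
    (hp : p < n) (hy : ∀ i < n, lo ≤ y i ∧ y i ≤ lo + d) (hlast : ∀ i, p < i → i < n → y p < y i)
    (hp' : y p < lo + d) :
    Profile n k (Function.update y p (y p + 1)) ∧
      ∀ i < n, lo ≤ Function.update y p (y p + 1) i ∧ Function.update y p (y p + 1) i ≤ lo + d := by
  have hb : ∀ i < n, lo ≤ Function.update y p (y p + 1) i ∧
      Function.update y p (y p + 1) i ≤ lo + d := by
    intro i hi
    have := hy i hi
    have := hy p hp
    rw [Function.update_apply]
    split_ifs <;> omega
  refine ⟨⟨fun i j hij hj => ?_, fun i hi j hj => ?_⟩, hb⟩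
  · have h1 := h.mono i j hij hj
    simp only [Function.update_apply]
    split_ifs with h2 h3 h3
    · omega
    · subst h2
      have := hlast j (by omega) hj
      omega
    · subst h3; omega
    · omega
  · have := hb i hi
    have := hb j hj
    omega

theorem Profile.lower {y : ℕ → ℤ} (h : Profile n k y) {lo : ℤ} {d p : ℕ} (hd : d ≤ k)
    (hp : p < n) (hy : ∀ i < n, lo ≤ y i ∧ y i ≤ lo + d) (hfirst : ∀ i < p, y i < y p)
    (hp' : lo < y p) :
    Profile n k (Function.update y p (y p - 1)) ∧
      ∀ i < n, lo ≤ Function.update y p (y p - 1) i ∧ Function.update y p (y p - 1) i ≤ lo + d := by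
  have hb : ∀ i < n, lo ≤ Function.update y p (y p - 1) i ∧
      Function.update y p (y p - 1) i ≤ lo + d := by
    intro i hi
    have := hy i hi
    have := hy p hp
    rw [Function.update_apply]
    split_ifs <;> omega
  refine ⟨⟨fun i j hij hj => ?_, fun i hi j hj => ?_⟩, hb⟩
  · have h1 := h.mono i j hij hj
    simp only [Function.update_apply]
    split_ifs with h2 h3 h3
    · omega
    · subst h2; omega
    · subst h3
      have := hfirst i (by omega)
      omega
    · omega
  · have := hb i hi
    have := hb j hj
    omega

/-- The indices at which `y` takes one of two values. -/
def extremes (n : ℕ) (y : ℕ → ℤ) (lo hi : ℤ) : Finset ℕ :=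
  (Finset.range n).filter (fun i => y i = lo ∨ y i = hi)

theorem card_extremes_update_lt {y : ℕ → ℤ} {lo hi v : ℤ} {p : ℕ} (hp : p < n)
    (hpy : y p = lo ∨ y p = hi) (h1 : v ≠ lo) (h2 : v ≠ hi) :
    (extremes n (Function.update y p v) lo hi).card < (extremes n y lo hi).card := by
  refine Finset.card_lt_card ((Finset.ssubset_iff_of_subset fun i hi' => ?_).2 ⟨p, ?_, ?_⟩)
  · simp only [extremes, Finset.mem_filter, Function.update_apply] at hi' ⊢
    split_ifs at hi'
    · omega
    · exact hi'
  · simp only [extremes, Finset.mem_filter, Finset.mem_range]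
    exact ⟨hp, hpy⟩
  · simp only [extremes, Finset.mem_filter, Function.update_self]
    omega

/-- An automorphism fixing all tight sets is the identity. -/
theorem fixed_of_profile (hn : 1 ≤ n) (hk : Odd k)
    (α : CG n (2 * n + k) ≃g CG n (2 * n + k)) (hα : ∀ a, α (tight n k a) = tight n k a)
    (d : ℕ) : ∀ lo : ℤ, ∀ N : ℕ, ∀ y : ℕ → ℤ, ∀ h : Profile n k y,
      (∀ i < n, lo ≤ y i ∧ y i ≤ lo + d) → (extremes n y lo (lo + d)).card < N →
        α h.vert = h.vert := by
  have : NeZero (2 * n + k) := ⟨by omega⟩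
  induction d with
  | zero =>
    intro lo N y h hy _
    exact fixed_of_two_values hn hk α hα h (lo := lo) fun i hi => by have := hy i hi; omega
  | succ d ihd =>
    rcases Nat.eq_zero_or_pos d with rfl | hd
    · intro lo N y h hy _
      exact fixed_of_two_values hn hk α hα h (lo := lo) fun i hi => by have := hy i hi; omega
    intro lo N
    induction N with
    | zero => intro y h _ hN; omega
    | succ N ih =>
      intro y h hy hN
      by_cases hL : ∃ i, i < n ∧ y i = lo
      swap
      · push Not at hL
        exact ihd (lo + 1) _ y h (fun i hi => by have := hy i hi; have := hL i hi; omega)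
          (Nat.lt_succ_self _)
      by_cases hH : ∃ i, i < n ∧ y i = lo + (d + 1 : ℕ)
      swap
      · push Not at hH
        exact ihd lo _ y h (fun i hi => by have := hy i hi; have := hH i hi; omega)
          (Nat.lt_succ_self _)
      obtain ⟨p, ⟨hp, hpy⟩, hlast⟩ : ∃ p, (p < n ∧ y p = lo) ∧ ∀ i, p < i → i < n → y i ≠ lo := by
        have hne : ((Finset.range n).filter (fun i => y i = lo)).Nonempty := by
          obtain ⟨i, hi⟩ := hL
          exact ⟨i, by simpa using hi⟩
        refine ⟨_, (Finset.mem_filter.1 (Finset.max'_mem _ hne)).imp_left Finset.mem_range.1,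
          fun i hi hin h1 => ?_⟩
        have := Finset.le_max' ((Finset.range n).filter (fun i => y i = lo)) i
          (by simpa using ⟨hin, h1⟩)
        omega
      obtain ⟨q, ⟨hq, hqy⟩, hfirst⟩ : ∃ q, (q < n ∧ y q = lo + (d + 1 : ℕ)) ∧
          ∀ i < q, y i ≠ lo + (d + 1 : ℕ) := by
        refine ⟨Nat.find hH, Nat.find_spec hH, fun i hi h1 => Nat.find_min hH hi ⟨?_, h1⟩⟩
        have := (Nat.find_spec hH).1
        omega
      have hdk : d + 1 ≤ k := by
        have := h.spread p hp q hq
        omega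
      have hpq : p ≠ q := by
        rintro rfl
        omega
      obtain ⟨hA, hAy⟩ := h.raise hdk hp hy
        (fun i hi hin => by have := hlast i hi hin; have := hy i hin; omega)
        (by push_cast; omega)
      obtain ⟨hB, hBy⟩ := h.lower hdk hq hy
        (fun i hi => by have := hfirst i hi; have := hy i (by omega); omega)
        (by omega)
      have hAq : Function.update y p (y p + 1) q = y q := Function.update_of_ne hpq.symm _ _
      obtain ⟨hC, hCy⟩ := hA.lower hdk hq hAy
        (fun i hi => by
          rw [hAq, Function.update_apply]
          have := hfirst i hi
          have := hy i (by omega)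
          split_ifs <;> omega)
        (by rw [hAq]; omega)
      have hA' := ih _ hA hAy (by
        have := card_extremes_update_lt (v := y p + 1) (hi := lo + (d + 1 : ℕ)) hp (Or.inl hpy)
          (by omega) (by push_cast; omega)
        omega)
      have hB' := ih _ hB hBy (by
        have := card_extremes_update_lt (v := y q - 1) (lo := lo) hq (Or.inr hqy)
          (by omega) (by omega)
        omega)
      have hC' := ih _ hC hCy (by
        have h1 := card_extremes_update_lt (v := y p + 1) (hi := lo + (d + 1 : ℕ)) hp (Or.inl hpy)
          (by omega) (by push_cast; omega)
        have := card_extremes_update_lt (y := Function.update y p (y p + 1))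
          (v := Function.update y p (y p + 1) q - 1) (lo := lo) hq
          (Or.inr (hAq.trans hqy)) (by omega) (by omega)
        omega)
      have hmA := fun x => h.mem_vert_update hp hA (x := x)
      have hmB := fun x => h.mem_vert_update hq hB (x := x)
      have e1 : ((y p + 1 + 2 * p : ℤ) : ZMod (2 * n + k)) =
          ((y p + 2 * p : ℤ) : ZMod (2 * n + k)) + 1 := by push_cast; ring
      have e2 : ((y q - 1 + 2 * q : ℤ) : ZMod (2 * n + k)) =
          ((y q + 2 * q : ℤ) : ZMod (2 * n + k)) - 1 := by push_cast; ring
      rw [e1] at hmA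
      rw [e2] at hmB
      have hmC : ∀ x, x ∈ hC.vert.1 ↔
          (x ∈ hA.vert.1 ∧ x ≠ ((y q + 2 * q : ℤ) : ZMod (2 * n + k))) ∨
            x = ((y q + 2 * q : ℤ) : ZMod (2 * n + k)) - 1 := by
        intro x
        rw [hA.mem_vert_update hq hC]
        simp only [hAq, e2]
      have hpT := h.mem_vert_self hp
      have hqT := h.mem_vert_self hq
      have hnA := (near_of_exchange hpT (h.vert.2.2 _ hpT) hmA).symm.map hn hk α
      have hnB := (near_of_exchange hqT
        (fun h1 => h.vert.2.2 _ h1 (by rwa [sub_add_cancel])) hmB).symm.map hn hk α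
      rw [hA'] at hnA
      rw [hB'] at hnB
      rcases eq_or_eq_of_near_of_near hpT hqT (fun h1 => hpq (h.eq_of_eq hp hq h1)) hmA hmB hmC
        hnA hnB with h1 | h1
      · exact h1
      · have h2 : h.vert = hC.vert := α.injective (h1.trans hC'.symm)
        exact h1.trans h2.symm

theorem eq_self_of_fix_tight [NeZero (2 * n + k)] (hn : 1 ≤ n) (hk : Odd k)
    (α : CG n (2 * n + k) ≃g CG n (2 * n + k)) (hα : ∀ a, α (tight n k a) = tight n k a)
    (S : CVert n (2 * n + k)) : α S = S := by
  obtain ⟨y, h, rfl⟩ := exists_profile S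
  refine fixed_of_profile hn hk α hα k (y 0) _ y h (fun i hi => ⟨h.mono 0 i (by omega) hi,
    h.spread 0 (by omega) i hi⟩) (Nat.lt_succ_self _)

/-- Every endomorphism of the cyclic model is a dihedral symmetry. -/
theorem endo_eq_dihedral [NeZero (2 * n + k)] (hn : 2 ≤ n) (hk : Odd k) (hk3 : 3 ≤ k)
    (φ : CG n (2 * n + k) →g CG n (2 * n + k)) :
    ∃ t, (∀ S, φ S = rotate n t S) ∨ ∀ S, φ S = rotate n t (reflect n _ S) := by
  obtain ⟨α, hα⟩ := exists_iso_of_endo (by omega) hk.pos φ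
  obtain ⟨t, h | h⟩ := exists_dihedral hn hk hk3 α
  · refine ⟨t, Or.inl fun S => ?_⟩
    have h1 := eq_self_of_fix_tight (by omega) hk (α.trans (rotate n t).symm)
      (fun a => by
        change (rotate n t).symm (α _) = _
        rw [h, (rotate n t).symm_apply_apply]) S
    rw [← hα, ← (rotate n t).apply_symm_apply (α S)]
    exact congrArg _ h1
  · refine ⟨t, Or.inr fun S => ?_⟩
    have h1 := eq_self_of_fix_tight (by omega) hk
      (α.trans ((rotate n t).symm.trans (reflect n _).symm))
      (fun a => by
        change (reflect n _).symm ((rotate n t).symm (α _)) = _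
        rw [h, (rotate n t).symm_apply_apply, (reflect n _).symm_apply_apply]) S
    rw [← hα, ← (rotate n t).apply_symm_apply (α S),
      ← (reflect n _).apply_symm_apply ((rotate n t).symm (α S))]
    exact congrArg (fun X => rotate n t (reflect n _ X)) h1

end Rigid

open Equiv

section Homotopy
variable {U V W : Type*} {F : SimpleGraph U} {G : SimpleGraph V} {H : SimpleGraph W}

theorem homHomotopic_of_adj {f g : G →g H} (h : GraphMapsAdj G H f g) : HomHomotopic G H f g :=
  Relation.ReflTransGen.single h

theorem _root_.HomHomotopic.symm {f g : G →g H} (h : HomHomotopic G H f g) : HomHomotopic G H g f := by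
  induction h with
  | refl => exact Relation.ReflTransGen.refl
  | tail _ hab ih => exact Relation.ReflTransGen.head (fun _ _ huv => (hab huv.symm).symm) ih

theorem _root_.HomHomotopic.trans {f g h : G →g H} (h1 : HomHomotopic G H f g)
    (h2 : HomHomotopic G H g h) : HomHomotopic G H f h :=
  Relation.ReflTransGen.trans h1 h2

theorem _root_.HomHomotopic.comp_left {f g : F →g G} (p : G →g H) (h : HomHomotopic F G f g) :
    HomHomotopic F H (p.comp f) (p.comp g) := by
  induction h with
  | refl => exact Relation.ReflTransGen.refl
  | tail _ hab ih => exact ih.tail fun _ _ huv => p.map_adj (hab huv)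

theorem _root_.HomHomotopic.comp_right {f g : G →g H} (p : F →g G) (h : HomHomotopic G H f g) :
    HomHomotopic F H (f.comp p) (g.comp p) := by
  induction h with
  | refl => exact Relation.ReflTransGen.refl
  | tail _ hab ih => exact ih.tail fun _ _ huv => hab (p.map_adj huv)

end Homotopy

section Colours
variable {V C : Type*} {G : SimpleGraph V}

/-- Recolouring by a permutation of the colours. -/
def recolour (π : Perm C) : (⊤ : SimpleGraph C) →g (⊤ : SimpleGraph C) where
  toFun := π
  map_rel' h := fun e => h (π.injective e)

/-- The permutations of the colours that do not change the homotopy class of a colouring. -/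
def colourGroup (c : G →g (⊤ : SimpleGraph C)) : Subgroup (Perm C) where
  carrier := {π | HomHomotopic G ⊤ ((recolour π).comp c) c}
  one_mem' := Relation.ReflTransGen.refl
  mul_mem' {π ψ} hπ hψ := (hψ.comp_left (recolour π)).trans hπ
  inv_mem' {π} hπ := by
    refine (hπ.comp_left (recolour π⁻¹)).symm.trans ?_
    rw [show (recolour π⁻¹).comp ((recolour π).comp c) = c from
      RelHom.ext fun x => π.symm_apply_apply (c x)]
    exact Relation.ReflTransGen.refl

theorem mem_colourGroup {c : G →g (⊤ : SimpleGraph C)} {π : Perm C} :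
    π ∈ colourGroup c ↔ HomHomotopic G ⊤ ((recolour π).comp c) c := Iff.rfl

/-- If an automorphism acts on a colouring as a permutation of the colours up to homotopy, then
that permutation normalizes the group of colour changes. -/
theorem conj_mem_colourGroup {c : G →g (⊤ : SimpleGraph C)} {τ π : Perm C} {ρ : G ≃g G}
    (h : HomHomotopic G ⊤ (c.comp ρ.toHom) ((recolour τ).comp c)) (hπ : π ∈ colourGroup c) :
    τ * π * τ⁻¹ ∈ colourGroup c := by
  have h1 : HomHomotopic G ⊤ ((recolour τ).comp (c.comp ρ.symm.toHom)) c := by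
    have := (h.comp_right ρ.symm.toHom).symm
    rwa [show (c.comp ρ.toHom).comp ρ.symm.toHom = c from
      RelHom.ext fun x => congrArg c (ρ.apply_symm_apply x)] at this
  have h2 : HomHomotopic G ⊤ ((recolour τ⁻¹).comp c) (c.comp ρ.symm.toHom) := by
    have := (h1.comp_left (recolour τ⁻¹)).symm
    rwa [show (recolour τ⁻¹).comp ((recolour τ).comp (c.comp ρ.symm.toHom)) =
      c.comp ρ.symm.toHom from RelHom.ext fun x => τ.symm_apply_apply _] at this
  have h3 := h2.comp_left (recolour (τ * π))
  have h4 := (((mem_colourGroup.1 hπ).comp_right ρ.symm.toHom)).comp_left (recolour τ)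
  exact h3.trans (h4.trans h1)

end Colours

section Alternating
variable {N : ℕ}

/-- A group of permutations containing the products of adjacent transpositions contains every
even permutation. -/
theorem mem_of_sign_eq_one {H : Subgroup (Perm (Fin (N + 1)))} {s : Perm (Fin (N + 1))}
    (hs : s * s = 1)
    (h : ∀ i : Fin N, s * swap i.castSucc i.succ ∈ H) {π : Perm (Fin (N + 1))}
    (hπ : Perm.sign π = 1) : π ∈ H := by
  have key : ∀ σ : Perm (Fin (N + 1)),
      (Perm.sign σ = 1 → σ ∈ H) ∧ (Perm.sign σ = -1 → σ * s ∈ H) := by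
    intro σ
    have hσ : σ ∈ Submonoid.closure
        (Set.range fun i : Fin N => swap i.castSucc i.succ) := by
      rw [Perm.mclosure_swap_castSucc_succ]
      trivial
    induction hσ using Submonoid.closure_induction_right with
    | one => exact ⟨fun _ => H.one_mem, fun h => by simp at h⟩
    | mul_right σ _ t ht ih =>
      obtain ⟨i, rfl⟩ := ht
      have ht : Perm.sign (swap i.castSucc i.succ) = -1 :=
        Perm.sign_swap (Fin.castSucc_lt_succ).ne
      have hh := h i
      refine ⟨fun h1 => ?_, fun h1 => ?_⟩
      · rw [Perm.sign_mul, ht, mul_neg_one, neg_eq_iff_eq_neg] at h1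
        have h2 := H.mul_mem (ih.2 h1) hh
        rwa [mul_assoc, ← mul_assoc s, hs, one_mul] at h2
      · rw [Perm.sign_mul, ht, mul_neg_one, neg_inj] at h1
        have h2 := H.mul_mem (ih.1 h1) (H.inv_mem hh)
        rwa [mul_inv_rev, swap_inv, inv_eq_of_mul_eq_one_right hs, ← mul_assoc] at h2
  exact (key π).1 hπ

theorem sign_revPerm_eq_one (h : N % 4 = 0) : Perm.sign (Fin.revPerm (n := N + 1)) = 1 := by
  rw [Perm.sign_of_pow_two_eq_one (by ext; simp [sq])]
  have : Fintype.card (Function.fixedPoints (Fin.revPerm (n := N + 1))) = 1 := by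
    rw [Fintype.card_eq_one_iff]
    refine ⟨⟨⟨N / 2, by omega⟩, ?_⟩, fun y => ?_⟩
    · simp only [Function.mem_fixedPoints, Function.IsFixedPt, Fin.revPerm_apply, Fin.ext_iff,
        Fin.val_rev]
      omega
    · obtain ⟨y, hy⟩ := y
      simp only [Function.mem_fixedPoints, Function.IsFixedPt, Fin.revPerm_apply, Fin.ext_iff,
        Fin.val_rev] at hy
      simp only [Subtype.mk.injEq, Fin.ext_iff]
      omega
  rw [this, Fintype.card_fin]
  exact Even.neg_one_pow ⟨N / 4, by omega⟩

/-- A group of permutations of `Fin (N + 1)` that contains one cycle of three consecutive elements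
and is normalized by the cyclic shift contains every even permutation. -/
theorem mem_of_normalized (hN : 2 ≤ N) {H : Subgroup (Perm (Fin (N + 1)))}
    (hnorm : ∀ π ∈ H, finRotate (N + 1) * π * (finRotate (N + 1))⁻¹ ∈ H)
    (h0 : swap (⟨0, by omega⟩ : Fin (N + 1)) ⟨1, by omega⟩ * swap ⟨1, by omega⟩ ⟨2, by omega⟩ ∈ H)
    {π : Perm (Fin (N + 1))} (hπ : Perm.sign π = 1) : π ∈ H := by
  have hcons : ∀ (i : ℕ) (h : i + 2 < N + 1),
      swap (⟨i, by omega⟩ : Fin (N + 1)) ⟨i + 1, by omega⟩ * swap ⟨i + 1, by omega⟩ ⟨i + 2, h⟩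
        ∈ H := by
    intro i
    induction i with
    | zero => exact fun _ => h0
    | succ i ih =>
      intro h
      have h1 := hnorm _ (ih (by omega))
      have h2 : ∀ (j : ℕ) (hj : j + 1 < N + 1), (⟨j + 1, hj⟩ : Fin (N + 1)) =
          finRotate (N + 1) ⟨j, by omega⟩ := fun j hj => (finRotate_of_lt (by omega)).symm
      rw [h2 i (by omega), h2 (i + 1) (by omega), h2 (i + 2) h, swap_apply_apply, swap_apply_apply]
      convert h1 using 1
      group
  refine mem_of_sign_eq_one (s := swap ⟨0, by omega⟩ ⟨1, by omega⟩) (swap_mul_self _ _)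
    (fun i => ?_) hπ
  obtain ⟨i, hi⟩ := i
  change swap _ _ * swap (⟨i, by omega⟩ : Fin (N + 1)) ⟨i + 1, by omega⟩ ∈ H
  induction i with
  | zero => rw [swap_mul_self]; exact H.one_mem
  | succ i ih =>
    have h1 := H.mul_mem (ih (by omega)) (hcons i (by omega))
    rwa [mul_assoc, swap_mul_self_mul] at h1

end Alternating

section Sparse

theorem add_two_mul_card_le {F : Finset ℕ} (hF : ∀ p ∈ F, p + 1 ∉ F) {a b : ℕ}
    (h : ∀ p ∈ F, a ≤ p ∧ p ≤ b) (hne : F.Nonempty) : a + 2 * F.card ≤ b + 2 := by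
  have hab : a ≤ b := by
    obtain ⟨p, hp⟩ := hne
    have := h p hp
    omega
  have h1 : F.card ≤ (Finset.range ((b - a) / 2 + 1)).card := by
    refine Finset.card_le_card_of_injOn (fun p => (p - a) / 2) (fun p hp => ?_)
      fun p hp q hq hpq => ?_
    · have := h p hp
      rw [Finset.mem_coe, Finset.mem_range]
      change (p - a) / 2 < _
      omega
    · have hp' := h p hp
      have hq' := h q hq
      simp only at hpq
      by_contra hne
      rcases Nat.lt_or_gt_of_ne hne with h2 | h2
      · exact hF p hp (by rwa [show p + 1 = q by omega])
      · exact hF q hq (by rwa [show q + 1 = p by omega])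
  rw [Finset.card_range] at h1
  omega

theorem add_two_mul_mem {F : Finset ℕ} (hF : ∀ p ∈ F, p + 1 ∉ F) {a b : ℕ}
    (h : ∀ p ∈ F, a ≤ p ∧ p ≤ b) (hb : b + 2 = a + 2 * F.card) {i : ℕ} (hi : i < F.card) :
    a + 2 * i ∈ F := by
  by_contra hc
  have h1 := Finset.card_filter_add_card_filter_not (s := F) (fun p => p < a + 2 * i)
  have hsub : ∀ (P : ℕ → Prop) [DecidablePred P], ∀ p ∈ F.filter P, p + 1 ∉ F.filter P :=
    fun P _ p hp hp' => hF p (Finset.mem_filter.1 hp).1 (Finset.mem_filter.1 hp').1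
  have h2 : (F.filter (fun p => p < a + 2 * i)).card ≤ i := by
    rcases (F.filter (fun p => p < a + 2 * i)).eq_empty_or_nonempty with h3 | h3
    · rw [h3, Finset.card_empty]
      omega
    · have h4 := add_two_mul_card_le (hsub _) (a := a) (b := a + 2 * i - 1) (fun p hp => by
        rw [Finset.mem_filter] at hp
        have := h p hp.1
        omega) h3
      have : 0 < i := by
        obtain ⟨p, hp⟩ := h3
        rw [Finset.mem_filter] at hp
        have := h p hp.1
        omega
      omega
  have h5 : (F.filter (fun p => ¬ p < a + 2 * i)).card + i + 1 ≤ F.card := by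
    rcases (F.filter (fun p => ¬ p < a + 2 * i)).eq_empty_or_nonempty with h3 | h3
    · rw [h3, Finset.card_empty]
      omega
    · have h4 := add_two_mul_card_le (hsub _) (a := a + 2 * i + 1) (b := b) (fun p hp => by
        rw [Finset.mem_filter] at hp
        have := h p hp.1
        have : p ≠ a + 2 * i := fun h6 => hc (h6 ▸ hp.1)
        omega) h3
      omega
  omega

end Sparse

section Colouring
variable {n k : ℕ}

/-- The largest element of a stable set. -/
def top (S : SGVert n k) : ℕ := S.1.sup id

theorem le_top {S : SGVert n k} {p : ℕ} (hp : p ∈ S.1) : p ≤ top S := Finset.le_sup (f := id) hp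

theorem top_mem (hn : 1 ≤ n) (S : SGVert n k) : top S ∈ S.1 := by
  have hne : S.1.Nonempty := Finset.card_pos.1 (by rw [S.2.1]; exact hn)
  obtain ⟨p, hp, h⟩ := Finset.exists_mem_eq_sup S.1 hne id
  rw [top, h]
  exact hp

theorem add_le_top (hn : 1 ≤ n) {S : SGVert n k} {a : ℕ} (h : ∀ p ∈ S.1, a ≤ p) :
    a + 2 * n ≤ top S + 2 := by
  have := add_two_mul_card_le (fun p hp => succ_notMem S hp) (fun p hp => ⟨h p hp, le_top hp⟩)
    ⟨_, top_mem hn S⟩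
  rwa [S.2.1] at this

theorem le_top_add_two (hn : 1 ≤ n) (S : SGVert n k) : 2 * n ≤ top S + 2 := by
  have := add_le_top hn (S := S) (a := 0) fun _ _ => Nat.zero_le _
  omega

theorem top_lt (hn : 1 ≤ n) (S : SGVert n k) : top S < 2 * n + k := vert_lt S (top_mem hn S)

theorem mem_of_top_eq {S : SGVert n k} {a : ℕ} (h : ∀ p ∈ S.1, a ≤ p)
    (ht : top S + 2 ≤ a + 2 * n) {i : ℕ} (hi : i < n) : a + 2 * i ∈ S.1 := by
  have hn : 1 ≤ n := by omega
  have := add_le_top hn h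
  exact add_two_mul_mem (fun p hp => succ_notMem S hp) (fun p hp => ⟨h p hp, le_top hp⟩)
    (by rw [S.2.1]; omega) (by rwa [S.2.1])

open Classical in
/-- The colour of a set: its largest element, except that the sets inside `{0, …, 2n}` are
coloured `1`, `2` or `0` according to the properties `P` and `Q`. -/
noncomputable def col (P Q : SGVert n k → Prop) (S : SGVert n k) : ℕ :=
  if 2 * n + 1 ≤ top S then top S - (2 * n - 2) else if P S then 1 else if Q S then 2 else 0

/-- The condition under which `col P Q` and `col P' Q'` are adjacent. -/
def Compat (P Q P' Q' : SGVert n k → Prop) : Prop :=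
  ∀ S T : SGVert n k, Disjoint S.1 T.1 → top S ≤ 2 * n → top T ≤ 2 * n →
    ¬ (P S ∧ P' T) ∧ ¬ (¬ P S ∧ Q S ∧ ¬ P' T ∧ Q' T) ∧ ¬ (¬ P S ∧ ¬ Q S ∧ ¬ P' T ∧ ¬ Q' T)

theorem Compat.col_ne (hn : 1 ≤ n) {P Q P' Q' : SGVert n k → Prop} (h : Compat P Q P' Q')
    {S T : SGVert n k} (hST : Disjoint S.1 T.1) : col P Q S ≠ col P' Q' T := by
  intro he
  have h1 := h S T hST
  simp only [col] at he
  by_cases hS : 2 * n + 1 ≤ top S <;> by_cases hT : 2 * n + 1 ≤ top T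
  · rw [if_pos hS, if_pos hT] at he
    exact Finset.disjoint_left.1 hST (top_mem hn S)
      (by rw [show top S = top T by omega]; exact top_mem hn T)
  · rw [if_pos hS, if_neg hT] at he
    split_ifs at he <;> omega
  · rw [if_neg hS, if_pos hT] at he
    split_ifs at he <;> omega
  · rw [if_neg hS, if_neg hT] at he
    obtain ⟨h2, h3, h4⟩ := h1 (by omega) (by omega)
    split_ifs at he <;> tauto

theorem col_lt (hn : 1 ≤ n) (hk : 1 ≤ k) (P Q : SGVert n k → Prop) (S : SGVert n k) :
    col P Q S < k + 2 := by
  have := top_lt hn S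
  rw [col]
  split_ifs <;> omega

/-- The colouring given by `col`. -/
noncomputable def colHom (hn : 1 ≤ n) (hk : 1 ≤ k) {P Q : SGVert n k → Prop}
    (h : Compat P Q P Q) : SG n k →g (⊤ : SimpleGraph (Fin (k + 2))) where
  toFun S := ⟨col P Q S, col_lt hn hk P Q S⟩
  map_rel' hST := fun he => h.col_ne hn ((SG_adj hn).1 hST) (Fin.mk.inj he)

theorem colHom_homotopic (hn : 1 ≤ n) (hk : 1 ≤ k) {P Q P' Q' : SGVert n k → Prop}
    (h : Compat P Q P Q) (h' : Compat P' Q' P' Q') (h'' : Compat P Q P' Q') :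
    HomHomotopic (SG n k) ⊤ (colHom hn hk h) (colHom hn hk h') :=
  homHomotopic_of_adj fun _ _ hST he => h''.col_ne hn ((SG_adj hn).1 hST) (Fin.mk.inj he)

theorem even_mem {S : SGVert n k} (hS : top S ≤ 2 * n) (h1 : 2 * n - 1 ∉ S.1)
    (h2 : 2 * n ∉ S.1) {i : ℕ} (hi : i < n) : 2 * i ∈ S.1 := by
  have hm := top_mem (by omega) S
  have : top S ≠ 2 * n - 1 := fun h => h1 (by rwa [h] at hm)
  have : top S ≠ 2 * n := fun h => h2 (by rwa [h] at hm)
  simpa using mem_of_top_eq (S := S) (a := 0) (fun _ _ => Nat.zero_le _) (by omega) hi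

theorem even_mem' {S : SGVert n k} (hS : top S ≤ 2 * n) (h0 : 0 ∉ S.1)
    (h1 : 1 ∉ S.1) {i : ℕ} (hi : i < n) : 2 + 2 * i ∈ S.1 := by
  refine mem_of_top_eq (S := S) (a := 2) (fun p hp => ?_) (by omega) hi
  by_contra h
  rcases (by omega : p = 0 ∨ p = 1) with rfl | rfl <;> contradiction

theorem exists_even_mem_of_ne (hn : 2 ≤ n) {S : SGVert n k} {q : ℕ} (hS : top S ≤ 2 * n)
    (h : 1 ∉ S.1) (h' : 2 * n - 1 ∉ S.1) :
    ∃ p ∈ S.1, p ≠ q ∧ p % 2 = 0 := by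
  by_contra! hc
  have hcard : n ≤ (S.1.erase q).card + 1 := by
    have h1 := S.2.1
    have h2 := Finset.pred_card_le_card_erase (s := S.1) (a := q)
    omega
  have := add_two_mul_card_le (F := S.1.erase q) (a := 3) (b := 2 * n - 3)
    (fun p hp hp' => succ_notMem S (Finset.mem_of_mem_erase hp) (Finset.mem_of_mem_erase hp'))
    (fun p hp => by
      rw [Finset.mem_erase] at hp
      have h1 := hc p hp.2 hp.1
      have h2 := le_top hp.2
      have h3 : p ≠ 1 := fun h3 => h (h3 ▸ hp.2)
      have h4 : p ≠ 2 * n - 1 := fun h4 => h' (h4 ▸ hp.2)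
      omega) (Finset.card_pos.1 (by omega))
  omega

theorem one_mem (hn : 2 ≤ n) {S : SGVert n k} (hS : top S ≤ 2 * n) (h : 2 * n ∈ S.1)
    (hE : ∀ i < n, 2 * i ∉ S.1) : 1 ∈ S.1 := by
  have hcard : n = (S.1.erase (2 * n)).card + 1 := by
    have h1 := S.2.1
    have h2 := Finset.card_erase_add_one h
    omega
  have h' : 2 * n - 1 ∉ S.1 := fun h1 => succ_notMem S h1 (by rwa [Nat.sub_add_cancel (by omega)])
  have := add_two_mul_mem (F := S.1.erase (2 * n)) (a := 1) (b := 2 * n - 3) (i := 0)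
    (fun p hp hp' => succ_notMem S (Finset.mem_of_mem_erase hp) (Finset.mem_of_mem_erase hp'))
    (fun p hp => by
      rw [Finset.mem_erase] at hp
      have h2 := le_top hp.2
      have h3 : p % 2 = 1 := by
        by_contra h3
        exact hE (p / 2) (by omega) (by rw [show 2 * (p / 2) = p by omega]; exact hp.2)
      have h4 : p ≠ 2 * n - 1 := fun h4 => h' (h4 ▸ hp.2)
      omega) (by omega) (by omega)
  exact Finset.mem_of_mem_erase this

theorem zero_mem (hn : 2 ≤ n) {S : SGVert n k} (hS : top S ≤ 2 * n) (h : 2 * n - 1 ∈ S.1)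
    (h1 : 1 ∉ S.1) : 0 ∈ S.1 := by
  by_contra h0
  have h2 := even_mem' hS h0 h1 (i := n - 1) (by omega)
  refine succ_notMem S h ?_
  rwa [show 2 * n - 1 + 1 = 2 + 2 * (n - 1) by omega]

theorem inter_even (hn : 2 ≤ n) {S T : SGVert n k} (hT : top T ≤ 2 * n)
    (hS : ∀ i < n, 2 * i ∈ S.1) (hT1 : 1 ∉ T.1) (hT2 : 2 * n - 1 ∉ T.1) : ¬ Disjoint S.1 T.1 := by
  obtain ⟨p, hp, h1, h2⟩ := exists_even_mem_of_ne hn hT hT1 hT2 (q := 2 * n)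
  have := le_top hp
  refine Finset.not_disjoint_iff.2 ⟨p, ?_, hp⟩
  rw [show p = 2 * (p / 2) by omega]
  exact hS _ (by omega)

/-- The last but one element of `{0, …, 2n}` is in the set. -/
def PenultMem (S : SGVert n k) : Prop := 2 * n - 1 ∈ S.1
/-- The last element of `{0, …, 2n}` is in the set. -/
def LastMem (S : SGVert n k) : Prop := 2 * n ∈ S.1
/-- The last element of `{0, …, 2n}` is in the set, and no other even one. -/
def LastMemOddRest (S : SGVert n k) : Prop := 2 * n ∈ S.1 ∧ ∀ i < n, 2 * i ∉ S.1
/-- The last but one element of `{0, …, 2n}` is in the set, and `1` is not. -/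
def PenultMemNotOne (S : SGVert n k) : Prop := 2 * n - 1 ∈ S.1 ∧ 1 ∉ S.1
/-- The set contains `1`. -/
def OneMem (S : SGVert n k) : Prop := 1 ∈ S.1
/-- The set contains `0`. -/
def ZeroMem (S : SGVert n k) : Prop := 0 ∈ S.1

theorem compat_max_max (hn : 2 ≤ n) : Compat (PenultMem (n := n) (k := k)) LastMem PenultMem LastMem := by
  intro S T hd hS hT
  refine ⟨fun h => Finset.disjoint_left.1 hd h.1 h.2, fun h => Finset.disjoint_left.1 hd h.2.1 h.2.2.2,
    fun ⟨h1, h2, h3, h4⟩ => ?_⟩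
  exact Finset.disjoint_left.1 hd (even_mem hS h1 h2 (i := 0) (by omega))
    (even_mem hT h3 h4 (i := 0) (by omega))

theorem compat_max_odd (hn : 2 ≤ n) : Compat (PenultMem (n := n) (k := k)) LastMem PenultMem LastMemOddRest := by
  intro S T hd hS hT
  refine ⟨fun h => Finset.disjoint_left.1 hd h.1 h.2,
    fun h => Finset.disjoint_left.1 hd h.2.1 h.2.2.2.1, fun ⟨h1, h2, h3, h4⟩ => ?_⟩
  obtain ⟨i, hi, h⟩ : ∃ i < n, 2 * i ∈ T.1 := by
    by_cases h5 : 2 * n ∈ T.1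
    · by_contra! hc
      exact h4 ⟨h5, hc⟩
    · exact ⟨0, by omega, even_mem hT h3 h5 (by omega)⟩
  exact Finset.disjoint_left.1 hd (even_mem hS h1 h2 hi) h

theorem compat_odd_odd (hn : 2 ≤ n) : Compat (PenultMem (n := n) (k := k)) LastMemOddRest PenultMem LastMemOddRest := by
  intro S T hd hS hT
  refine ⟨fun h => Finset.disjoint_left.1 hd h.1 h.2,
    fun h => Finset.disjoint_left.1 hd h.2.1.1 h.2.2.2.1, fun ⟨h1, h2, h3, h4⟩ => ?_⟩
  by_cases h5 : 2 * n ∈ S.1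
  · have h6 : 2 * n ∉ T.1 := Finset.disjoint_left.1 hd h5
    exact (compat_max_odd hn T S hd.symm hT hS).2.2 ⟨h3, h6, h1, h2⟩
  · exact (compat_max_odd hn S T hd hS hT).2.2 ⟨h1, h5, h3, h4⟩

theorem compat_odd_mixed (hn : 2 ≤ n) : Compat (PenultMem (n := n) (k := k)) LastMemOddRest PenultMemNotOne OneMem := by
  intro S T hd hS hT
  refine ⟨fun h => Finset.disjoint_left.1 hd h.1 h.2.1, fun ⟨_, h2, _, h4⟩ =>
    Finset.disjoint_left.1 hd (one_mem hn hS h2.1 h2.2) h4, fun ⟨h1, h2, h3, h4⟩ => ?_⟩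
  have h5 : 2 * n - 1 ∉ T.1 := fun h => h3 ⟨h, h4⟩
  by_cases h6 : 2 * n ∈ S.1
  · have h7 : 2 * n ∉ T.1 := Finset.disjoint_left.1 hd h6
    refine h2 ⟨h6, fun i hi => ?_⟩
    exact Finset.disjoint_right.1 hd (even_mem hT h5 h7 hi)
  · exact inter_even hn hT (fun i hi => even_mem hS h1 h6 hi) h4 h5 hd

theorem compat_mixed_mixed (hn : 2 ≤ n) : Compat (PenultMemNotOne (n := n) (k := k)) OneMem PenultMemNotOne OneMem := by
  intro S T hd hS hT
  refine ⟨fun h => Finset.disjoint_left.1 hd h.1.1 h.2.1,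
    fun h => Finset.disjoint_left.1 hd h.2.1 h.2.2.2, fun ⟨h1, h2, h3, h4⟩ => ?_⟩
  have h5 : 2 * n - 1 ∉ S.1 := fun h => h1 ⟨h, h2⟩
  have h6 : 2 * n - 1 ∉ T.1 := fun h => h3 ⟨h, h4⟩
  by_cases h7 : 2 * n ∈ S.1
  · have h8 : 2 * n ∉ T.1 := Finset.disjoint_left.1 hd h7
    exact inter_even hn hS (fun i hi => even_mem hT h6 h8 hi) h2 h5 hd.symm
  · exact inter_even hn hT (fun i hi => even_mem hS h5 h7 hi) h4 h6 hd

theorem compat_mixed_min (hn : 2 ≤ n) : Compat (PenultMemNotOne (n := n) (k := k)) OneMem ZeroMem OneMem := by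
  intro S T hd hS hT
  refine ⟨fun h => Finset.disjoint_left.1 hd (zero_mem hn hS h.1.1 h.1.2) h.2,
    fun h => Finset.disjoint_left.1 hd h.2.1 h.2.2.2, fun ⟨h1, h2, h3, h4⟩ => ?_⟩
  obtain ⟨p, hp, h5, h6⟩ := exists_even_mem_of_ne hn hS h2 (fun h => h1 ⟨h, h2⟩) (q := 0)
  have := le_top hp
  refine Finset.disjoint_left.1 hd hp ?_
  rw [show p = 2 + 2 * (p / 2 - 1) by omega]
  exact even_mem' hT h3 h4 (by omega)

theorem compat_min_min (hn : 2 ≤ n) : Compat (ZeroMem (n := n) (k := k)) OneMem ZeroMem OneMem := by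
  intro S T hd hS hT
  refine ⟨fun h => Finset.disjoint_left.1 hd h.1 h.2,
    fun h => Finset.disjoint_left.1 hd h.2.1 h.2.2.2, fun ⟨h1, h2, h3, h4⟩ => ?_⟩
  exact Finset.disjoint_left.1 hd (even_mem' hS h1 h2 (i := 0) (by omega))
    (even_mem' hT h3 h4 (i := 0) (by omega))

/-- The colouring of a set by its largest element. -/
noncomputable def stdCol (hn : 2 ≤ n) (hk : 1 ≤ k) : SG n k →g (⊤ : SimpleGraph (Fin (k + 2))) :=
  colHom (by omega) hk (compat_max_max hn)

theorem val_stdCol (hn : 2 ≤ n) (hk : 1 ≤ k) (S : SGVert n k) :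
    (stdCol hn hk S : ℕ) + (2 * n - 2) = top S := by
  have hm := top_mem (by omega) S
  have h1 := le_top_add_two (by omega) S
  change col PenultMem LastMem S + _ = _
  rw [col]
  split_ifs with h2 h3 h4
  · omega
  · have h5 := le_top h3
    have h6 : top S ≠ 2 * n := fun h6 => by
      rw [h6] at hm
      exact succ_notMem S h3 (by rwa [Nat.sub_add_cancel (by omega)])
    omega
  · have := le_top h4
    omega
  · have : top S ≠ 2 * n - 1 := fun h => h3 (by rwa [h] at hm)
    have : top S ≠ 2 * n := fun h => h4 (by rwa [h] at hm)
    omega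

/-- The colouring that gives sets inside `{0, …, 2n}` a colour by their elements `0` and `1`. -/
noncomputable def endCol (hn : 2 ≤ n) (hk : 1 ≤ k) : SG n k →g (⊤ : SimpleGraph (Fin (k + 2))) :=
  colHom (by omega) hk (compat_min_min hn)

theorem stdCol_homotopic_endCol (hn : 2 ≤ n) (hk : 1 ≤ k) :
    HomHomotopic (SG n k) ⊤ (stdCol hn hk) (endCol hn hk) :=
  ((colHom_homotopic _ hk (compat_max_max hn) (compat_odd_odd hn) (compat_max_odd hn)).trans
    (colHom_homotopic _ hk _ (compat_mixed_mixed hn) (compat_odd_mixed hn))).trans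
    (colHom_homotopic _ hk _ _ (compat_mixed_min hn))

end Colouring

/-- The cyclic permutation of the first three colours. -/
def cycle₃ (N : ℕ) (hN : 3 ≤ N) : Perm (Fin N) :=
  swap ⟨0, by omega⟩ ⟨1, by omega⟩ * swap ⟨1, by omega⟩ ⟨2, by omega⟩

theorem val_cycle₃ {N : ℕ} (hN : 3 ≤ N) (x : Fin N) : (cycle₃ N hN x : ℕ) =
    if (x : ℕ) = 0 then (1 : ℕ) else if (x : ℕ) = 1 then 2 else if (x : ℕ) = 2 then 0 else x := by
  simp only [cycle₃, Perm.mul_apply, swap_apply_def, Fin.ext_iff]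
  by_cases h0 : (x : ℕ) = 0
  · simp [h0]
  by_cases h1 : (x : ℕ) = 1
  · simp [h1]
  by_cases h2 : (x : ℕ) = 2
  · simp [h2]
  simp [h0, h1, h2]

theorem val_finRotate {N : ℕ} (x : Fin (N + 2)) :
    (finRotate (N + 2) x : ℕ) = if (x : ℕ) = N + 1 then 0 else (x : ℕ) + 1 := by
  simp only [coe_finRotate, Fin.ext_iff, Fin.val_last]

theorem mem_colourGroup_of_homotopic {V C : Type*} {G : SimpleGraph V}
    {c : G →g (⊤ : SimpleGraph C)} {π σ : Perm C}
    (h : HomHomotopic G ⊤ ((recolour (π * σ)).comp c) ((recolour σ).comp c)) :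
    σ⁻¹ * (π * σ) ∈ colourGroup c := by
  refine (h.comp_left (recolour σ⁻¹)).trans ?_
  rw [show (recolour σ⁻¹).comp ((recolour σ).comp c) = c from
    RelHom.ext fun x => σ.symm_apply_apply _]
  exact Relation.ReflTransGen.refl

theorem zero_mem_of_stdCol_eq_zero {n k : ℕ} (hn : 2 ≤ n) (hk : 1 ≤ k) {S : SGVert n k} (h : (stdCol hn hk S : ℕ) = 0) : 0 ∈ S.1 := by
  have h1 := val_stdCol hn hk S
  exact mem_of_top_eq (S := S) (a := 0) (i := 0) (fun _ _ => Nat.zero_le _) (by omega) (by omega)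

section Invariance
variable {n k : ℕ} [NeZero (2 * n + k)]

/-- Rotation of the stable sets. -/
def rot (n k : ℕ) [NeZero (2 * n + k)] (a : ZMod (2 * n + k)) : SG n k ≃g SG n k :=
  ((toCG n k).trans (rotate n a)).trans (toCG n k).symm

/-- A reflection of the stable sets. -/
def flip (n k : ℕ) [NeZero (2 * n + k)] : SG n k ≃g SG n k :=
  ((toCG n k).trans ((reflect n _).trans (rotate n ((2 * n - 3 : ℕ) : ZMod _)))).trans
    (toCG n k).symm

theorem mem_rot {a : ZMod (2 * n + k)} {S : SGVert n k} {p : ℕ} (hp : p < 2 * n + k) :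
    p ∈ (rot n k a S).1 ↔ (p : ZMod (2 * n + k)) - a ∈ (toCG n k S).1 := by
  change p ∈ ((toCG n k).symm (rotate n a (toCG n k S))).1 ↔ _
  rw [mem_toCG_symm hp, mem_rotate]

theorem succ_mem_rot {S : SGVert n k} {p : ℕ} (hp : p + 1 < 2 * n + k) :
    p + 1 ∈ (rot n k 1 S).1 ↔ p ∈ S.1 := by
  rw [mem_rot hp, Nat.cast_add, Nat.cast_one, add_sub_cancel_right, natCast_mem_toCG (by omega)]

theorem zero_mem_rot {S : SGVert n k} :
    0 ∈ (rot n k 1 S).1 ↔ 2 * n + k - 1 ∈ S.1 := by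
  have h := Nat.pos_of_ne_zero (NeZero.ne (2 * n + k))
  rw [mem_rot h, ← natCast_mem_toCG (by omega), Nat.cast_sub h, ZMod.natCast_self, Nat.cast_zero,
    Nat.cast_one]

theorem mem_flip {S : SGVert n k} {p q : ℕ} (hq : q < 2 * n + k)
    (h : p + q = 2 * n + k + (2 * n - 3)) (hp : p < 2 * n + k) :
    p ∈ (flip n k S).1 ↔ q ∈ S.1 := by
  change p ∈ ((toCG n k).symm (rotate n _ (reflect n _ (toCG n k S)))).1 ↔ _
  rw [mem_toCG_symm hp, mem_rotate, mem_reflect, ← natCast_mem_toCG hq]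
  have h1 := congrArg (Nat.cast : ℕ → ZMod (2 * n + k)) h
  rw [Nat.cast_add, Nat.cast_add, ZMod.natCast_self] at h1
  rw [show -((p : ZMod (2 * n + k)) - ((2 * n - 3 : ℕ) : ZMod (2 * n + k))) = q by
    linear_combination -h1]

variable (hn : 2 ≤ n) (hk : 1 ≤ k)

theorem stdCol_rot :
    HomHomotopic (SG n k) ⊤ ((stdCol hn hk).comp (rot n k 1).toHom)
      ((recolour (finRotate (k + 2))).comp (stdCol hn hk)) := by
  refine homHomotopic_of_adj fun S T hST => ?_
  rw [SG_adj (by omega)] at hST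
  rw [SimpleGraph.top_adj]
  intro he
  replace he : (stdCol hn hk (rot n k 1 S) : ℕ) = finRotate (k + 2) (stdCol hn hk T) :=
    congrArg Fin.val he
  have h1 := val_stdCol hn hk T
  have h2 := val_stdCol hn hk (rot n k 1 S)
  have h3 := top_mem (by omega) T
  have h4 := top_mem (by omega) (rot n k 1 S)
  refine Finset.disjoint_right.1 hST h3 ?_
  rw [coe_finRotate] at he
  split_ifs at he with h5
  · rw [h5, Fin.val_last] at h1
    rw [show top T = 2 * n + k - 1 by omega]
    exact zero_mem_rot.1 (zero_mem_of_stdCol_eq_zero hn hk he)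
  · have h6 := top_lt (by omega) (rot n k 1 S)
    rw [show top (rot n k 1 S) = top T + 1 by omega] at h4 h6
    exact (succ_mem_rot h6).1 h4

theorem stdCol_flip :
    HomHomotopic (SG n k) ⊤ ((stdCol hn hk).comp (flip n k).toHom)
      ((recolour Fin.revPerm).comp (stdCol hn hk)) := by
  refine homHomotopic_of_adj fun S T hST => ?_
  rw [SG_adj (by omega)] at hST
  rw [SimpleGraph.top_adj]
  intro he
  replace he : (stdCol hn hk (flip n k S) : ℕ) = Fin.rev (stdCol hn hk T) :=
    congrArg Fin.val he
  have h1 := val_stdCol hn hk T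
  have h2 := val_stdCol hn hk (flip n k S)
  rw [Fin.val_rev] at he
  have h5 := (stdCol hn hk T).2
  exact Finset.disjoint_right.1 hST (top_mem (by omega) T)
    ((mem_flip (top_lt (by omega) T) (by omega) (top_lt (by omega) (flip n k S))).1
      (top_mem (by omega) (flip n k S)))

theorem endCol_rot :
    HomHomotopic (SG n k) ⊤ ((endCol hn hk).comp ((rot n k 1).toHom.comp (rot n k 1).toHom))
      ((recolour (cycle₃ (k + 2) (by omega) * (finRotate (k + 2) * finRotate (k + 2)))).comp
        (stdCol hn hk)) := by
  refine homHomotopic_of_adj fun S T hST => ?_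
  rw [SG_adj (by omega)] at hST
  rw [SimpleGraph.top_adj]
  intro he
  replace he : col ZeroMem OneMem (rot n k 1 (rot n k 1 S)) =
      cycle₃ (k + 2) (by omega) (finRotate (k + 2) (finRotate (k + 2) (stdCol hn hk T))) :=
    congrArg Fin.val he
  have h1 := val_stdCol hn hk T
  have h3 := top_mem (by omega) T
  have h4 := top_mem (by omega) (rot n k 1 (rot n k 1 S))
  have h5 := top_lt (by omega) (rot n k 1 (rot n k 1 S))
  have h6 := (stdCol hn hk T).2
  refine Finset.disjoint_right.1 hST h3 ?_
  rw [col] at he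
  have hx := val_finRotate (stdCol hn hk T)
  have hy := val_finRotate (finRotate (k + 2) (stdCol hn hk T))
  have hz := val_cycle₃ (by omega) (finRotate (k + 2) (finRotate (k + 2) (stdCol hn hk T)))
  have hm : 2 * n + k - 2 + 1 = 2 * n + k - 1 := by omega
  by_cases hrest : 2 * n + 1 ≤ top (rot n k 1 (rot n k 1 S))
  · rw [if_pos hrest] at he
    have h7 : top (rot n k 1 (rot n k 1 S)) = top T + 1 + 1 := by split_ifs at hx hy hz <;> omega
    rw [h7] at h4 h5
    exact (succ_mem_rot (by omega)).1 ((succ_mem_rot h5).1 h4)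
  · rw [if_neg hrest] at he
    by_cases hP : ZeroMem (rot n k 1 (rot n k 1 S))
    · rw [if_pos hP] at he
      have h7 : top T = 2 * n + k - 2 := by split_ifs at hx hy hz <;> omega
      have h8 := zero_mem_rot.1 hP
      rw [← hm] at h8
      rw [h7]
      exact (succ_mem_rot (by omega)).1 h8
    · rw [if_neg hP] at he
      by_cases hQ : OneMem (rot n k 1 (rot n k 1 S))
      · rw [if_pos hQ] at he
        have h7 : top T = 2 * n + k - 1 := by split_ifs at hx hy hz <;> omega
        rw [h7]
        exact zero_mem_rot.1 ((succ_mem_rot (p := 0) (by omega)).1 hQ)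
      · rw [if_neg hQ] at he
        have h7 : (stdCol hn hk T : ℕ) = 0 := by split_ifs at hx hy hz <;> omega
        have h8 := even_mem' (by omega) hP hQ (i := 0) (by omega)
        exact absurd (zero_mem_of_stdCol_eq_zero hn hk h7) (Finset.disjoint_left.1 hST
          ((succ_mem_rot (p := 0) (by omega)).1 ((succ_mem_rot (p := 1) (by omega)).1 h8)))

theorem stdCol_rot_rot : HomHomotopic (SG n k) ⊤
    ((stdCol hn hk).comp ((rot n k 1).toHom.comp (rot n k 1).toHom))
      ((recolour (finRotate (k + 2) * finRotate (k + 2))).comp (stdCol hn hk)) :=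
  ((stdCol_rot hn hk).comp_right (rot n k 1).toHom).trans
    ((stdCol_rot hn hk).comp_left (recolour (finRotate (k + 2))))

theorem cycle₃_mem_colourGroup : cycle₃ (k + 2) (by omega) ∈ colourGroup (stdCol hn hk) := by
  set τ := finRotate (k + 2)
  have h1 : HomHomotopic (SG n k) ⊤
      ((recolour (cycle₃ (k + 2) (by omega) * (τ * τ))).comp (stdCol hn hk))
      ((recolour (τ * τ)).comp (stdCol hn hk)) :=
    ((endCol_rot hn hk).symm.trans ((stdCol_homotopic_endCol hn hk).comp_right _).symm).trans
      (stdCol_rot_rot hn hk)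
  have h3 := conj_mem_colourGroup (stdCol_rot hn hk) (conj_mem_colourGroup (stdCol_rot hn hk)
    (mem_colourGroup_of_homotopic h1))
  convert h3 using 1
  change _ = τ * (τ * _ * τ⁻¹) * τ⁻¹
  group

/-- Even permutations of the colours do not change the homotopy class of `stdCol`. -/
theorem mem_colourGroup_of_sign {π : Perm (Fin (k + 2))} (hπ : Perm.sign π = 1) :
    π ∈ colourGroup (stdCol hn hk) :=
  mem_of_normalized (N := k + 1) (by omega)
    (fun _ h => conj_mem_colourGroup (stdCol_rot hn hk) h) (cycle₃_mem_colourGroup hn hk) hπ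

theorem stdCol_rot_homotopic (hodd : Odd k) (t : ZMod (2 * n + k)) :
    HomHomotopic (SG n k) ⊤ ((stdCol hn hk).comp (rot n k t).toHom) (stdCol hn hk) := by
  have h1 : HomHomotopic (SG n k) ⊤ ((stdCol hn hk).comp (rot n k 1).toHom) (stdCol hn hk) := by
    refine (stdCol_rot hn hk).trans (mem_colourGroup.1 (mem_colourGroup_of_sign hn hk ?_))
    rw [sign_finRotate]
    exact Even.neg_one_pow (by simpa using hodd.add_one)
  rw [← ZMod.natCast_zmod_val t]
  induction t.val with
  | zero =>
    rw [show (stdCol hn hk).comp (rot n k ((0 : ℕ) : ZMod (2 * n + k))).toHom = stdCol hn hk from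
      RelHom.ext fun S => congrArg (stdCol hn hk) ?_]
    · exact Relation.ReflTransGen.refl
    · change (toCG n k).symm (rotate n _ (toCG n k S)) = S
      rw [show rotate n ((0 : ℕ) : ZMod (2 * n + k)) (toCG n k S) = toCG n k S by ext x; simp,
        (toCG n k).symm_apply_apply]
  | succ i ih =>
    have h2 := (h1.comp_right (rot n k (i : ZMod (2 * n + k))).toHom).trans ih
    rwa [show ((stdCol hn hk).comp (rot n k 1).toHom).comp (rot n k (i : ZMod (2 * n + k))).toHom =
      (stdCol hn hk).comp (rot n k ((i + 1 : ℕ) : ZMod (2 * n + k))).toHom from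
      RelHom.ext fun S => congrArg (stdCol hn hk) ?_] at h2
    change (toCG n k).symm (rotate n _ (toCG n k ((toCG n k).symm _))) = (toCG n k).symm _
    rw [(toCG n k).apply_symm_apply]
    congr 1
    ext x
    simp [sub_sub, add_comm]

/-- All endomorphisms fix the homotopy class of `stdCol`. -/
theorem stdCol_comp_homotopic (hk3 : k % 4 = 3) (φ : SG n k →g SG n k) :
    HomHomotopic (SG n k) ⊤ ((stdCol hn hk).comp φ) (stdCol hn hk) := by
  have hodd : Odd k := Nat.odd_iff.2 (by omega)
  have hφ : ∀ S, φ S = (toCG n k).symm (toCG n k (φ ((toCG n k).symm (toCG n k S)))) := fun S => by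
    rw [(toCG n k).symm_apply_apply, (toCG n k).symm_apply_apply]
  obtain ⟨t, ht | ht⟩ := endo_eq_dihedral hn hodd (by omega)
    ((toCG n k).toHom.comp (φ.comp (toCG n k).symm.toHom))
  · rw [show φ = (rot n k t).toHom from RelHom.ext fun S =>
      (hφ S).trans (congrArg (toCG n k).symm (ht _))]
    exact stdCol_rot_homotopic hn hk hodd t
  · have h1 : HomHomotopic (SG n k) ⊤ ((stdCol hn hk).comp (flip n k).toHom) (stdCol hn hk) :=
      (stdCol_flip hn hk).trans (mem_colourGroup.1 (mem_colourGroup_of_sign hn hk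
        (sign_revPerm_eq_one (by omega))))
    rw [show φ = (rot n k (t - ((2 * n - 3 : ℕ) : ZMod (2 * n + k)))).toHom.comp (flip n k).toHom
      from RelHom.ext fun S => (hφ S).trans ((congrArg (toCG n k).symm (ht _)).trans ?_)]
    · exact ((stdCol_rot_homotopic hn hk hodd _).comp_right (flip n k).toHom).trans h1
    · change _ = (toCG n k).symm (rotate n _ (toCG n k ((toCG n k).symm _)))
      rw [(toCG n k).apply_symm_apply]
      congr 1
      change rotate n t (reflect n _ _) = rotate n _ (rotate n _ (reflect n _ _))
      ext x
      rw [mem_rotate, mem_rotate, mem_rotate, sub_sub, sub_add_cancel]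
      rfl

end Invariance

section Cylinders
variable {V : Type*} {X : SimpleGraph V} {M : ℕ}

/-- A homotopy can be written as a sequence of any sufficiently large length. -/
theorem exists_path_of_homHomotopic {W : Type*} {Y : SimpleGraph W} {f g : X →g Y}
    (h : HomHomotopic X Y f g) : ∃ L : ℕ, ∀ M, L ≤ M → ∃ p : ℕ → (X →g Y),
      p 0 = f ∧ p M = g ∧ ∀ i, GraphMapsAdj X Y (p i) (p (i + 1)) := by
  induction h with
  | refl => exact ⟨0, fun M _ => ⟨fun _ => f, rfl, rfl, fun _ _ _ huv => f.map_adj huv⟩⟩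
  | @tail a b _ hab ih =>
    obtain ⟨L, hL⟩ := ih
    refine ⟨L + 1, fun M hM => ?_⟩
    obtain ⟨p, h0, hp, hadj⟩ := hL (M - 1) (by omega)
    refine ⟨fun i => if i < M then p i else b, ?_, ?_, fun i => ?_⟩
    · exact (if_pos (by omega)).trans h0
    · exact if_neg (lt_irrefl M)
    · beta_reduce
      rcases lt_trichotomy (i + 1) M with h | h | h
      · rw [if_pos (by omega), if_pos h]
        exact hadj i
      · rw [if_pos (by omega), if_neg (by omega), show i = M - 1 by omega, hp]
        exact hab
      · rw [if_neg (by omega), if_neg (by omega)]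
        exact fun _ _ huv => b.map_adj huv

/-- The adjacency relation of `cylGraph`. -/
def CylAdj (X : SimpleGraph V) (M : ℕ) :
    V ⊕ (V × (X →g X) × Fin M) → V ⊕ (V × (X →g X) × Fin M) → Prop
  | .inl S, .inl T => X.Adj S T
  | .inl S, .inr (T, φ, i) => ((i : ℕ) = 0 ∧ X.Adj S T) ∨ ((i : ℕ) + 1 = M ∧ X.Adj S (φ T))
  | .inr (S, φ, i), .inl T => ((i : ℕ) = 0 ∧ X.Adj S T) ∨ ((i : ℕ) + 1 = M ∧ X.Adj (φ S) T)
  | .inr (S, φ, i), .inr (T, ψ, j) =>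
      X.Adj S T ∧ φ = ψ ∧ (i : ℕ) ≤ j + 1 ∧ (j : ℕ) ≤ i + 1

theorem CylAdj.symm {u v : V ⊕ (V × (X →g X) × Fin M)} (h : CylAdj X M u v) : CylAdj X M v u := by
  rcases u with S | ⟨S, φ, i⟩ <;> rcases v with T | ⟨T, ψ, j⟩
  · exact SimpleGraph.Adj.symm h
  · exact h.imp (And.imp_right SimpleGraph.Adj.symm) (And.imp_right SimpleGraph.Adj.symm)
  · exact h.imp (And.imp_right SimpleGraph.Adj.symm) (And.imp_right SimpleGraph.Adj.symm)
  · exact ⟨h.1.symm, h.2.1.symm, h.2.2.2, h.2.2.1⟩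

/-- The graph `X` with a cylinder of `M` levels glued in for each endomorphism `φ`, whose lower end
is attached to `X` by the identity and whose upper end is attached by `φ`. -/
def cylGraph (X : SimpleGraph V) (M : ℕ) : SimpleGraph (V ⊕ (V × (X →g X) × Fin M)) where
  Adj := CylAdj X M
  symm := ⟨fun _ _ => CylAdj.symm⟩
  loopless := ⟨by
    rintro (S | ⟨S, φ, i⟩) h
    · exact X.loopless.irrefl S h
    · exact X.loopless.irrefl S h.1⟩

/-- The inclusion of `X`. -/
def cylBase (X : SimpleGraph V) (M : ℕ) : X →g cylGraph X M where
  toFun := Sum.inl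
  map_rel' h := h

/-- The inclusion of one level of a cylinder. -/
def cylLevel (M : ℕ) (φ : X →g X) (i : Fin M) : X →g cylGraph X M where
  toFun S := .inr (S, φ, i)
  map_rel' h := ⟨h, rfl, Nat.le_succ _, Nat.le_succ _⟩

theorem cylBase_homotopic_cylLevel (φ : X →g X) {i : ℕ} (hi : i < M) :
    HomHomotopic X (cylGraph X M) (cylBase X M) (cylLevel M φ ⟨i, hi⟩) := by
  induction i with
  | zero => exact homHomotopic_of_adj fun _ _ h => Or.inl ⟨rfl, h⟩
  | succ i ih =>
    refine (ih (by omega)).tail fun _ _ h => ⟨h, rfl, ?_, le_refl _⟩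
    change i ≤ i + 1 + 1
    omega

theorem cylBase_homotopic_comp (hM : 0 < M) (φ : X →g X) :
    HomHomotopic X (cylGraph X M) (cylBase X M) ((cylBase X M).comp φ) :=
  (cylBase_homotopic_cylLevel φ (Nat.sub_lt hM one_pos)).tail fun _ _ h =>
    Or.inr ⟨Nat.sub_add_cancel hM, φ.map_adj h⟩

/-- The level of a vertex, where the base has level `M`. -/
def cylHeight : V ⊕ (V × (X →g X) × Fin M) → ℕ
  | .inl _ => M
  | .inr (_, _, i) => i

/-- The cylinders cut at level `μ` are retracted to depth at most `t`. -/
def cylPush (μ t : ℕ) : V ⊕ (V × (X →g X) × Fin M) → V ⊕ (V × (X →g X) × Fin M)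
  | .inl S => .inl S
  | .inr (S, φ, i) =>
    if (i : ℕ) < μ then
      if t = 0 then .inl S else .inr (S, φ, ⟨min i (t - 1), lt_of_le_of_lt (min_le_left _ _) i.2⟩)
    else if ht : t = 0 then .inl (φ S) else .inr (S, φ, ⟨max i (M - t),
      max_lt i.2 (Nat.sub_lt (i.1.zero_le.trans_lt i.2) (Nat.pos_of_ne_zero ht))⟩)

theorem cylPush_adj {μ s t : ℕ} (hμ : μ < M) (hst : s ≤ t + 1) (hts : t ≤ s + 1)
    {u v : V ⊕ (V × (X →g X) × Fin M)} (hu : cylHeight u ≠ μ) (hv : cylHeight v ≠ μ)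
    (h : CylAdj X M u v) : CylAdj X M (cylPush μ s u) (cylPush μ t v) := by
  have key : ∀ {t : ℕ} {S T : V} {φ : X →g X} {i : Fin M}, (i : ℕ) ≠ μ →
      CylAdj X M (.inl S) (.inr (T, φ, i)) →
      CylAdj X M (.inl S) (cylPush μ t (.inr (T, φ, i))) := by
    intro t S T φ i hi h
    have := i.2
    rw [cylPush]
    rcases h with ⟨h0, h⟩ | ⟨h0, h⟩
    · rw [if_pos (by omega)]
      split_ifs with ht
      · exact h
      · exact Or.inl ⟨by simp only; omega, h⟩
    · rw [if_neg (by omega)]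
      split_ifs with ht
      · exact h
      · exact Or.inr ⟨by simp only; omega, h⟩
  rcases u with S | ⟨S, φ, i⟩ <;> rcases v with T | ⟨T, ψ, j⟩
  · exact h
  · exact key hv h
  · exact (key hu h.symm).symm
  · obtain ⟨h, rfl, hij, hji⟩ := h
    change (i : ℕ) ≠ μ at hu
    change (j : ℕ) ≠ μ at hv
    have := i.2
    have := j.2
    rw [cylPush, cylPush]
    by_cases hi : (i : ℕ) < μ
    · rw [if_pos hi, if_pos (show (j : ℕ) < μ by omega)]
      split_ifs with hs ht ht
      · exact h
      · exact Or.inl ⟨by simp only; omega, h⟩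
      · exact Or.inl ⟨by simp only; omega, h⟩
      · exact ⟨h, rfl, by simp only; omega, by simp only; omega⟩
    · rw [if_neg hi, if_neg (show ¬ (j : ℕ) < μ by omega)]
      split_ifs with hs ht ht
      · exact φ.map_adj h
      · exact Or.inr ⟨by simp only; omega, φ.map_adj h⟩
      · exact Or.inr ⟨by simp only; omega, φ.map_adj h⟩
      · exact ⟨h, rfl, by simp only; omega, by simp only; omega⟩

theorem cylPush_zero {μ : ℕ} (u : V ⊕ (V × (X →g X) × Fin M)) : ∃ S, cylPush μ 0 u = .inl S := by
  rcases u with S | ⟨S, φ, i⟩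
  · exact ⟨S, rfl⟩
  · by_cases h : (i : ℕ) < μ
    · exact ⟨S, if_pos h⟩
    · exact ⟨φ S, if_neg h⟩

theorem cylPush_self {μ : ℕ} (u : V ⊕ (V × (X →g X) × Fin M)) : cylPush μ M u = u := by
  rcases u with S | ⟨S, φ, i⟩
  · rfl
  · have := i.2
    rw [cylPush]
    split_ifs <;> first | omega | (congr 3; exact Fin.ext (by simp only; omega))

/-- Every homomorphism from `X` is homotopic to the inclusion when there are enough levels. -/
theorem homotopic_cylBase [Fintype V] (hM : Fintype.card V < M) (f : X →g cylGraph X M) :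
    HomHomotopic X (cylGraph X M) f (cylBase X M) := by
  classical
  obtain ⟨μ, hμ, hf⟩ : ∃ μ < M, ∀ v, cylHeight (f v) ≠ μ := by
    obtain ⟨μ, h1, h2⟩ := Finset.exists_mem_notMem_of_card_lt_card
      (s := Finset.univ.image fun v => cylHeight (f v)) (t := Finset.range M)
      (by rw [Finset.card_range]; exact Finset.card_image_le.trans_lt hM)
    exact ⟨μ, Finset.mem_range.1 h1, fun v hv =>
      h2 (Finset.mem_image.2 ⟨v, Finset.mem_univ v, hv⟩)⟩
  let q : ℕ → (X →g cylGraph X M) := fun t =>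
    ⟨fun v => cylPush μ t (f v), fun h =>
      cylPush_adj hμ (Nat.le_succ t) (Nat.le_succ t) (hf _) (hf _) (f.map_adj h)⟩
  have hq : ∀ t, HomHomotopic X (cylGraph X M) (q 0) (q t) := by
    intro t
    induction t with
    | zero => exact Relation.ReflTransGen.refl
    | succ t ih => exact ih.tail fun _ _ h =>
        cylPush_adj hμ (by omega) le_rfl (hf _) (hf _) (f.map_adj h)
  have hqM : q M = f := RelHom.ext fun v => cylPush_self (f v)
  choose ψ hψ using fun v => cylPush_zero (μ := μ) (f v)
  have hq0 : q 0 = (cylBase X M).comp ⟨ψ, fun {u v} h => by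
      have h1 := (q 0).map_adj h
      change CylAdj X M (cylPush μ 0 (f u)) (cylPush μ 0 (f v)) at h1
      rwa [hψ, hψ] at h1⟩ := RelHom.ext fun v => hψ v
  rw [← hqM]
  refine (hq M).symm.trans ?_
  rw [hq0]
  exact (cylBase_homotopic_comp (by omega) _).symm

theorem cylGraph_colorable {N : ℕ} {c : X →g (⊤ : SimpleGraph (Fin N))}
    (h : ∀ φ : X →g X, ∃ p : ℕ → (X →g (⊤ : SimpleGraph (Fin N))), p 0 = c ∧
      p (M - 1) = c.comp φ ∧ ∀ i, GraphMapsAdj X ⊤ (p i) (p (i + 1))) :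
    (cylGraph X M).Colorable N := by
  choose p h0 h1 hp using h
  let C : V ⊕ (V × (X →g X) × Fin M) → Fin N := fun
    | .inl S => c S
    | .inr (S, φ, i) => p φ i S
  have key : ∀ {S T : V} {φ : X →g X} {i : Fin M}, CylAdj X M (.inl S) (.inr (T, φ, i)) →
      c S ≠ p φ i T := by
    rintro S T φ i (⟨hi, h⟩ | ⟨hi, h⟩)
    · rw [hi, h0]
      exact c.map_adj h
    · rw [show (i : ℕ) = M - 1 by omega, h1]
      exact c.map_adj h
  refine ⟨SimpleGraph.Coloring.mk C fun {u v} h => ?_⟩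
  change CylAdj X M u v at h
  rcases u with S | ⟨S, φ, i⟩ <;> rcases v with T | ⟨T, ψ, j⟩
  · exact c.map_adj h
  · exact key h
  · exact (key h.symm).symm
  · obtain ⟨h, rfl, hij, hji⟩ := h
    change p φ i S ≠ p φ j T
    rcases (by omega : (i : ℕ) = j ∨ (i : ℕ) = j + 1 ∨ (j : ℕ) = i + 1) with h2 | h2 | h2
    · rw [h2]
      exact (p φ j).map_adj h
    · rw [h2]
      exact (hp φ j h.symm).symm
    · rw [h2]
      exact hp φ i h

end Cylinders

/-- A finite graph with a colouring whose homotopy class is fixed by all endomorphisms maps to a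
graph with the same colours in exactly one way up to homotopy. -/
theorem exists_connected_target {V : Type} [Finite V] {X : SimpleGraph V} {N : ℕ}
    {c : X →g (⊤ : SimpleGraph (Fin N))} (hc : ∀ φ : X →g X, HomHomotopic X ⊤ (c.comp φ) c) :
    ∃ (W : Type) (_ : Fintype W) (G : SimpleGraph W), G.Colorable N ∧ Nonempty (X →g G) ∧
      ∀ f g : X →g G, HomHomotopic X G f g := by
  classical
  have := Fintype.ofFinite V
  have : Finite (X →g X) := Finite.of_injective (fun φ => (φ : V → V)) DFunLike.coe_injective
  have := Fintype.ofFinite (X →g X)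
  choose L hL using fun φ => exists_path_of_homHomotopic (hc φ).symm
  set M := Finset.univ.sup L + Fintype.card V + 1 with hM
  refine ⟨_, inferInstance, cylGraph X M, cylGraph_colorable (c := c) fun φ => hL φ _ ?_,
    ⟨cylBase X M⟩, fun f g => ?_⟩
  · have := Finset.le_sup (f := L) (Finset.mem_univ φ)
    omega
  · exact (homotopic_cylBase (by omega) f).trans (homotopic_cylBase (by omega) g).symm

instance (n k : ℕ) : Finite (SGVert n k) :=
  Finite.of_injective (β := (Finset.range (2 * n + k)).powerset)
    (fun S => ⟨S.1, Finset.mem_powerset.2 S.2.2.1.1⟩)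
    fun _ _ h => Subtype.ext (Subtype.mk.inj h)

end StableKneser

theorem stable_kneser_not_test_graph (n k : ℕ) (hk : k % 4 = 3) (hn : 2 ≤ n) :
    ∃ (V : Type) (_ : Fintype V) (G : SimpleGraph V),
      G.chromaticNumber = (k + 2 : ℕ) ∧ Nonempty (SG n k →g G) ∧
      ∀ f g : SG n k →g G, HomHomotopic (SG n k) G f g := by
  have : NeZero (2 * n + k) := ⟨by omega⟩
  obtain ⟨V, hV, G, hcol, ⟨f⟩, h⟩ := StableKneser.exists_connected_target
    (StableKneser.stdCol_comp_homotopic (k := k) hn (by omega) hk)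
  refine ⟨V, hV, G, ?_, ⟨f⟩, h⟩
  refine le_antisymm hcol.chromaticNumber_le (not_lt.1 fun hlt => ?_)
  obtain ⟨r, hr⟩ := ENat.ne_top_iff_exists.1 (ne_top_of_lt hlt)
  rw [← hr, Nat.cast_lt] at hlt
  have hr' : G.Colorable r := SimpleGraph.chromaticNumber_le_iff_colorable.1 hr.ge
  obtain ⟨C⟩ := hr'.mono (by omega : r ≤ k + 1)
  exact StableKneser.SG_not_colorable (by omega) (by omega) ⟨C.comp f⟩
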